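/- Let (R, m, k) be a Cohen–Macaulay Noetherian local ring of Krull dimension d. The following are equivalent: (i) every maximal Cohen–Macaulay R-module is G–Gorenstein; (ii) every m-torsion R-module has finite Gorenstein injective dimension; (iii) Gid_R(H_m^d(R)) < ∞; (iv) R is Gorenstein. -/

import Mathlib

universe u

namespace GG

open RingTheory.Sequence

variable (R : Type u) [CommRing R]

/-- A module `N` is Gorenstein injective if it is a kernel in a `Hom(Inj,−)`-exact exact
doubly infinite complex of injective modules. -/
def IsGorensteinInjective (N : Type u) [AddCommGroup N] [Module R N] : Prop :=
  ∃ (X : ℤ → ModuleCat.{u} R) (d : ∀ n : ℤ, X n →ₗ[R] X (n + 1)),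
    (∀ n, Module.Injective R (X n)) ∧
    (∀ n, LinearMap.range (d n) = LinearMap.ker (d (n + 1))) ∧
    (∀ (I : ModuleCat.{u} R), Module.Injective R I →
      ∀ (n : ℤ) (φ : I →ₗ[R] X (n + 1)), (d (n + 1)).comp φ = 0 →
        ∃ ψ : I →ₗ[R] X n, (d n).comp ψ = φ) ∧
    Nonempty (N ≃ₗ[R] LinearMap.ker (d 0))

/-- A module `N` is Gorenstein projective if it is a kernel in a `Hom(−,Proj)`-exact exact
doubly infinite complex of projective modules. -/
def IsGorensteinProjective (N : Type u) [AddCommGroup N] [Module R N] : Prop :=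
  ∃ (X : ℤ → ModuleCat.{u} R) (d : ∀ n : ℤ, X n →ₗ[R] X (n + 1)),
    (∀ n, Module.Projective R (X n)) ∧
    (∀ n, LinearMap.range (d n) = LinearMap.ker (d (n + 1))) ∧
    (∀ (P : ModuleCat.{u} R), Module.Projective R P →
      ∀ (n : ℤ) (φ : X (n + 1) →ₗ[R] P), φ.comp (d n) = 0 →
        ∃ ψ : X (n + 1 + 1) →ₗ[R] P, ψ.comp (d (n + 1)) = φ) ∧
    Nonempty (N ≃ₗ[R] LinearMap.ker (d 0))

/-- A module `N` is Gorenstein flat if it is a kernel in an `(Inj ⊗ −)`-exact exact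
doubly infinite complex of flat modules. -/
def IsGorensteinFlat (N : Type u) [AddCommGroup N] [Module R N] : Prop :=
  ∃ (X : ℤ → ModuleCat.{u} R) (d : ∀ n : ℤ, X n →ₗ[R] X (n + 1)),
    (∀ n, Module.Flat R (X n)) ∧
    (∀ n, LinearMap.range (d n) = LinearMap.ker (d (n + 1))) ∧
    (∀ (I : ModuleCat.{u} R), Module.Injective R I →
      ∀ n : ℤ, LinearMap.range (LinearMap.lTensor (R := R) I (d n)) =
        LinearMap.ker (LinearMap.lTensor (R := R) I (d (n + 1)))) ∧
    Nonempty (N ≃ₗ[R] LinearMap.ker (d 0))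

/-- Existence of a right resolution of length `≤ n` by modules satisfying `P`. -/
def CoresolutionLE (P : ModuleCat.{u} R → Prop) (M : Type u) [AddCommGroup M] [Module R M]
    (n : ℕ) : Prop :=
  ∃ (G : ℕ → ModuleCat.{u} R) (d : ∀ i : ℕ, G i →ₗ[R] G (i + 1)) (ε : M →ₗ[R] G 0),
    (∀ i, P (G i)) ∧ Function.Injective ε ∧
    LinearMap.range ε = LinearMap.ker (d 0) ∧
    (∀ i, LinearMap.range (d i) = LinearMap.ker (d (i + 1))) ∧
    (∀ i, n < i → ∀ x : G i, x = 0)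

/-- Existence of a left resolution of length `≤ n` by modules satisfying `P`. -/
def ResolutionLE (P : ModuleCat.{u} R → Prop) (M : Type u) [AddCommGroup M] [Module R M]
    (n : ℕ) : Prop :=
  ∃ (G : ℕ → ModuleCat.{u} R) (d : ∀ i : ℕ, G (i + 1) →ₗ[R] G i) (ε : G 0 →ₗ[R] M),
    (∀ i, P (G i)) ∧ Function.Surjective ε ∧
    LinearMap.ker ε = LinearMap.range (d 0) ∧
    (∀ i, LinearMap.ker (d i) = LinearMap.range (d (i + 1))) ∧
    (∀ i, n < i → ∀ x : G i, x = 0)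

/-- `Gid_R M ≤ n`. -/
def gidLE (M : Type u) [AddCommGroup M] [Module R M] (n : ℕ) : Prop :=
  CoresolutionLE R (fun N => IsGorensteinInjective R N) M n

/-- `id_R M ≤ n`. -/
def idLE (M : Type u) [AddCommGroup M] [Module R M] (n : ℕ) : Prop :=
  CoresolutionLE R (fun N => Module.Injective R N) M n

/-- `pd_R M ≤ n`. -/
def pdLE (M : Type u) [AddCommGroup M] [Module R M] (n : ℕ) : Prop :=
  ResolutionLE R (fun N => Module.Projective R N) M n

/-- `fd_R M ≤ n`. -/
def fdLE (M : Type u) [AddCommGroup M] [Module R M] (n : ℕ) : Prop :=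
  ResolutionLE R (fun N => Module.Flat R N) M n

/-- `Gfd_R M ≤ n`. -/
def gfdLE (M : Type u) [AddCommGroup M] [Module R M] (n : ℕ) : Prop :=
  ResolutionLE R (fun N => IsGorensteinFlat R N) M n

/-- Gorenstein injective dimension, as an extended natural number. -/
noncomputable def gid (M : Type u) [AddCommGroup M] [Module R M] : ℕ∞ :=
  sInf {c : ℕ∞ | ∃ n : ℕ, c = n ∧ gidLE R M n}

/-- The depth of a module over a local ring: the supremum of the lengths of regular
sequences contained in the maximal ideal. -/
noncomputable def mdepth [IsLocalRing R] (M : Type u) [AddCommGroup M] [Module R M] : ℕ∞ :=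
  sSup {c : ℕ∞ | ∃ rs : List R, c = rs.length ∧
    (∀ r ∈ rs, r ∈ IsLocalRing.maximalIdeal R) ∧ RingTheory.Sequence.IsRegular M rs}

/-- The Krull dimension of a module: the Krull dimension of its support. -/
noncomputable def mdim (M : Type u) [AddCommGroup M] [Module R M] : WithBot ℕ∞ :=
  Order.krullDim ↥(Module.support R M)

/-- The height of a prime in the support of `M`. -/
noncomputable def htM (M : Type u) [AddCommGroup M] [Module R M] (p : PrimeSpectrum R) : ℕ∞ :=
  ⨆ h : p ∈ Module.support R M, Order.height (⟨p, h⟩ : ↥(Module.support R M))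

/-- A Cohen–Macaulay module over a local ring: depth equals Krull dimension. -/
def IsCMModule [IsLocalRing R] (M : Type u) [AddCommGroup M] [Module R M] : Prop :=
  (mdepth R M : WithBot ℕ∞) = mdim R M

/-- A maximal Cohen–Macaulay module over a local ring. -/
def IsMaximalCM [IsLocalRing R] (M : Type u) [AddCommGroup M] [Module R M] : Prop :=
  IsCMModule R M ∧ mdim R M = ringKrullDim R

/-- A Cohen–Macaulay local ring. -/
def IsCMLocalRing [IsLocalRing R] : Prop :=
  (mdepth R R : WithBot ℕ∞) = ringKrullDim R

/-- A Gorenstein local ring: a Noetherian local ring of finite self-injective dimension. -/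
def IsGorensteinLocalRing [IsLocalRing R] : Prop :=
  IsNoetherianRing R ∧ ∃ n : ℕ, idLE R R n

/-- A regular local ring: Noetherian, and the maximal ideal is generated by `dim R` elements. -/
def IsRegularLocal [IsLocalRing R] : Prop :=
  IsNoetherianRing R ∧ ∃ s : Finset R, Ideal.span (s : Set R) = IsLocalRing.maximalIdeal R ∧
    (s.card : WithBot ℕ∞) = ringKrullDim R

/-- A (not necessarily local) Gorenstein ring: all localizations at primes are Gorenstein. -/
def IsGorensteinRing : Prop :=
  ∀ p : PrimeSpectrum R, ∃ n : ℕ,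
    idLE (Localization.AtPrime p.asIdeal) (Localization.AtPrime p.asIdeal) n

/-- `R` admits a dualizing complex; by Kawasaki's theorem this is equivalent to being a
homomorphic image of a finite-dimensional Gorenstein ring. -/
def HasDualizingComplex : Prop :=
  ∃ Q : CommRingCat.{u}, IsNoetherianRing Q ∧ ringKrullDim Q < ⊤ ∧ IsGorensteinRing Q ∧
    ∃ f : Q →+* R, Function.Surjective f

section Cousin

/-- The product of the localizations of `N` at the primes in `S`. -/
noncomputable abbrev locProd (S : Set (PrimeSpectrum R)) (N : Type u) [AddCommGroup N]
    [Module R N] : Type u :=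
  Π p : S, LocalizedModule p.1.asIdeal.primeCompl N

/-- The submodule of the product of localizations consisting of finitely supported families;
this is the direct sum `⊕_{p ∈ S} N_p`. -/
noncomputable def finSupp (S : Set (PrimeSpectrum R)) (N : Type u) [AddCommGroup N]
    [Module R N] : Submodule R (locProd R S N) where
  carrier := {f | {p : S | f p ≠ 0}.Finite}
  add_mem' := by
    intro f g hf hg
    refine (hf.union hg).subset ?_
    intro p hp
    by_contra h
    simp only [Set.mem_union, Set.mem_setOf_eq, not_or, not_not] at h
    exact hp (by simp [Pi.add_apply, h.1, h.2])
  zero_mem' := by simp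
  smul_mem' := by
    intro c f hf
    refine hf.subset ?_
    intro p hp
    by_contra h
    simp only [Set.mem_setOf_eq, not_not] at h
    exact hp (by simp [Pi.smul_apply, h])

/-- The canonical map `N → ∏_{p ∈ S} N_p`. -/
noncomputable def thetaFull (S : Set (PrimeSpectrum R)) (N : Type u) [AddCommGroup N]
    [Module R N] : N →ₗ[R] locProd R S N :=
  LinearMap.pi fun p => LocalizedModule.mkLinearMap p.1.asIdeal.primeCompl N

/-- The cokernel of `N → ⊕_{p ∈ S} N_p` (computed inside the direct sum). -/
noncomputable abbrev nextKType (S : Set (PrimeSpectrum R)) (N : Type u) [AddCommGroup N]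
    [Module R N] : Type u :=
  ↥(finSupp R S N) ⧸
    (Submodule.comap (finSupp R S N).subtype (LinearMap.range (thetaFull R S N)))

/-- The sequence of "kernel/cokernel" modules in the inductive construction
of the Cousin complex of `M` with respect to the filtration `F`. -/
noncomputable def cousinK (F : ℕ → Set (PrimeSpectrum R)) (M : ModuleCat.{u} R) :
    ℕ → ModuleCat.{u} R
  | 0 => M
  | n + 1 => ModuleCat.of R (nextKType R (F n \ F (n + 1)) (cousinK F M n))

/-- The `n`-th term `M^n = ⊕_{p ∈ ∂F_n} (coker d^{n-2})_p` of the Cousin complex. -/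
noncomputable abbrev cousinC (F : ℕ → Set (PrimeSpectrum R)) (M : ModuleCat.{u} R) (n : ℕ) :
    Type u :=
  ↥(finSupp R (F n \ F (n + 1)) (cousinK R F M n))

/-- The canonical map from the `n`-th cokernel into the product of its localizations. -/
noncomputable def cousinTheta (F : ℕ → Set (PrimeSpectrum R)) (M : ModuleCat.{u} R) (n : ℕ) :
    (cousinK R F M n) →ₗ[R] locProd R (F n \ F (n + 1)) (cousinK R F M n) :=
  thetaFull R _ _

/-- The (full) `n`-th differential of the Cousin complex, from `M^n` to the product at
level `n+1` (it lands inside the direct sum `M^{n+1}`). -/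
noncomputable def cousinD (F : ℕ → Set (PrimeSpectrum R)) (M : ModuleCat.{u} R) (n : ℕ) :
    (cousinC R F M n) →ₗ[R] locProd R (F (n + 1) \ F (n + 2)) (cousinK R F M (n + 1)) :=
  (cousinTheta R F M (n + 1)).comp
    (Submodule.mkQ (Submodule.comap (finSupp R (F n \ F (n + 1)) (cousinK R F M n)).subtype
      (LinearMap.range (thetaFull R (F n \ F (n + 1)) (cousinK R F M n)))))

/-- `F` is a filtration of `Spec R`: descending, and every element of `∂F_n = F_n \ F_{n+1}`
is a minimal member of `F_n`. -/
def IsFiltration (F : ℕ → Set (PrimeSpectrum R)) : Prop :=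
  (∀ n, F (n + 1) ⊆ F n) ∧
    ∀ n, ∀ p ∈ F n \ F (n + 1), ∀ q ∈ F n, q ≤ p → q = p

/-- The filtration `F` admits `M`. -/
def Admits (F : ℕ → Set (PrimeSpectrum R)) (M : Type u) [AddCommGroup M] [Module R M] : Prop :=
  Module.support R M ⊆ F 0

/-- The `M`-height filtration `K_i = {p ∈ Supp M | ht_M p ≥ i}`. -/
noncomputable def heightFiltration (M : Type u) [AddCommGroup M] [Module R M] :
    ℕ → Set (PrimeSpectrum R) :=
  fun i => {p | p ∈ Module.support R M ∧ (i : ℕ∞) ≤ htM R M p}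

/-- The Cousin complex `C(F, M)` is exact at `M, M⁰, …, M^t`
(together with the well-definedness of the differentials into the direct sums). -/
def CousinPartiallyExact (F : ℕ → Set (PrimeSpectrum R)) (M : ModuleCat.{u} R) (t : ℕ) : Prop :=
  (∀ n, LinearMap.range (cousinTheta R F M n) ≤ finSupp R (F n \ F (n + 1)) (cousinK R F M n)) ∧
  Function.Injective (cousinTheta R F M 0) ∧
  (∀ n ≤ t, LinearMap.ker (cousinD R F M n) =
    Submodule.comap (finSupp R (F n \ F (n + 1)) (cousinK R F M n)).subtype
      (LinearMap.range (cousinTheta R F M n)))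

/-- The Cousin complex `C(F, M)` is exact and all of its terms satisfy `P`, i.e. it provides
a `P`-resolution of `M`. -/
def CousinResolves (F : ℕ → Set (PrimeSpectrum R)) (M : ModuleCat.{u} R)
    (P : ModuleCat.{u} R → Prop) : Prop :=
  (∀ n, LinearMap.range (cousinTheta R F M n) ≤ finSupp R (F n \ F (n + 1)) (cousinK R F M n)) ∧
  Function.Injective (cousinTheta R F M 0) ∧
  (∀ n, LinearMap.ker (cousinD R F M n) =
    Submodule.comap (finSupp R (F n \ F (n + 1)) (cousinK R F M n)).subtype
      (LinearMap.range (cousinTheta R F M n))) ∧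
  (∀ n, P (ModuleCat.of R (cousinC R F M n)))

/-- A G–Gorenstein module: a nonzero finitely generated module whose Cousin complex with
respect to the `M`-height filtration is a Gorenstein injective resolution. -/
def IsGGorenstein (M : ModuleCat.{u} R) : Prop :=
  (∃ x : M, x ≠ 0) ∧ Module.Finite R M ∧
    CousinResolves R (heightFiltration R M) M (fun N => IsGorensteinInjective R N)

/-- A Gorenstein module: a nonzero finitely generated module whose Cousin complex with
respect to the `M`-height filtration is an injective resolution. -/
def IsGorensteinModule (M : ModuleCat.{u} R) : Prop :=
  (∃ x : M, x ≠ 0) ∧ Module.Finite R M ∧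
    CousinResolves R (heightFiltration R M) M (fun N => Module.Injective R N)

end Cousin

/-- A system of parameters of a local ring. -/
def IsSOP [IsLocalRing R] (rs : List R) : Prop :=
  (rs.length : WithBot ℕ∞) = ringKrullDim R ∧
    (∀ r ∈ rs, r ∈ IsLocalRing.maximalIdeal R) ∧
    IsLocalRing.maximalIdeal R ≤ (Ideal.span {r | r ∈ rs}).radical

/-- A balanced big Cohen–Macaulay module: every system of parameters of `R` is a regular
sequence on `M`. -/
def IsBalancedBigCM [IsLocalRing R] (M : Type u) [AddCommGroup M] [Module R M] : Prop :=
  ∀ rs : List R, IsSOP R rs → RingTheory.Sequence.IsRegular M rs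

end GG


universe v


namespace GG

open CategoryTheory CategoryTheory.Abelian

section P1

variable {R : Type u} [CommRing R]

/-- short exact sequences, unbundled -/
structure SES {A B C : Type u} [AddCommGroup A] [Module R A] [AddCommGroup B] [Module R B]
    [AddCommGroup C] [Module R C] (f : A →ₗ[R] B) (g : B →ₗ[R] C) : Prop where
  inj : Function.Injective f
  exact : Function.Exact f g
  surj : Function.Surjective g

variable (R) in
/-- Ext vanishing -/
def EV (X N : Type u) [AddCommGroup X] [Module R X] [AddCommGroup N] [Module R N] (i : ℕ) : Prop :=
  Subsingleton (Ext (ModuleCat.of R X) (ModuleCat.of R N) i)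

variable {A B C X Y N M : Type u} [AddCommGroup A] [Module R A] [AddCommGroup B] [Module R B]
    [AddCommGroup C] [Module R C] [AddCommGroup X] [Module R X] [AddCommGroup Y] [Module R Y]
    [AddCommGroup N] [Module R N] [AddCommGroup M] [Module R M]

theorem SES.comp_zero {f : A →ₗ[R] B} {g : B →ₗ[R] C} (h : SES f g) : g.comp f = 0 := by
  ext a; exact h.exact.apply_apply_eq_zero a

theorem SES.app {f : A →ₗ[R] B} {g : B →ₗ[R] C} (h : SES f g) (a : A) : g (f a) = 0 :=
  h.exact.apply_apply_eq_zero a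

theorem SES.lift {f : A →ₗ[R] B} {g : B →ₗ[R] C} (h : SES f g) {b : B} (hb : g b = 0) :
    ∃ a, f a = b := (h.exact b).1 hb

/-- associated short complex -/
noncomputable abbrev SES.sc {f : A →ₗ[R] B} {g : B →ₗ[R] C} (h : SES f g) :
    ShortComplex (ModuleCat.{u} R) :=
  ModuleCat.shortComplexOfCompEqZero f g h.comp_zero

theorem SES.shortExact {f : A →ₗ[R] B} {g : B →ₗ[R] C} (h : SES f g) : h.sc.ShortExact :=
  ModuleCat.shortComplex_shortExact _ h.exact h.inj h.surj

theorem SES.ker {g : B →ₗ[R] C} (hg : Function.Surjective g) :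
    SES (LinearMap.ker g).subtype g :=
  ⟨Subtype.val_injective, fun x => by simp, hg⟩

theorem SES.mkQ (S : Submodule R B) : SES S.subtype S.mkQ :=
  ⟨Subtype.val_injective, fun x => by simp, S.mkQ_surjective⟩

theorem SES.coker {f : A →ₗ[R] B} (hf : Function.Injective f) :
    SES f (LinearMap.range f).mkQ :=
  ⟨hf, fun x => by simp, Submodule.mkQ_surjective _⟩

theorem EV.iff {i : ℕ} : EV R X N i ↔ ∀ e : Ext (ModuleCat.of R X) (ModuleCat.of R N) i, e = 0 :=
  ⟨fun h e => h.elim _ _, fun h => ⟨fun a b => by rw [h a, h b]⟩⟩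

theorem EV.zero_iff : EV R X N 0 ↔ ∀ f : X →ₗ[R] N, f = 0 := by
  rw [EV.iff]
  constructor
  · intro h f
    have := h (Ext.mk₀ (ModuleCat.ofHom f))
    rw [Ext.mk₀_eq_zero_iff] at this
    exact congrArg ModuleCat.Hom.hom this
  · intro h e
    obtain ⟨f, rfl⟩ := Ext.addEquiv₀.symm.surjective e
    have : f = 0 := by
      ext x
      exact congrArg (fun g : X →ₗ[R] N => g x) (h f.hom)
    simp [this]

theorem EV.of_retract {i : ℕ} (h : EV R X N i) (s : Y →ₗ[R] X) (r : X →ₗ[R] Y)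
    (hrs : r.comp s = LinearMap.id) (s' : M →ₗ[R] N) (r' : N →ₗ[R] M)
    (hrs' : r'.comp s' = LinearMap.id) : EV R Y M i := by
  rw [EV.iff] at *
  intro e
  have h1 : (Ext.mk₀ (ModuleCat.ofHom s)).comp ((Ext.mk₀ (ModuleCat.ofHom r)).comp e (zero_add i)) (zero_add i) = e := by
    rw [Ext.mk₀_comp_mk₀_assoc, ← ModuleCat.ofHom_comp, hrs]
    exact Ext.mk₀_id_comp e
  set e1 := (Ext.mk₀ (ModuleCat.ofHom r)).comp e (zero_add i)
  have h2 : (e1.comp (Ext.mk₀ (ModuleCat.ofHom s')) (add_zero i)).comp (Ext.mk₀ (ModuleCat.ofHom r')) (add_zero i) = e1 := by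
    rw [Ext.comp_assoc_of_second_deg_zero, Ext.mk₀_comp_mk₀, ← ModuleCat.ofHom_comp, hrs']
    exact Ext.comp_mk₀_id e1
  rw [h (e1.comp (Ext.mk₀ (ModuleCat.ofHom s')) (add_zero i))] at h2
  rw [← h1, ← h2]
  simp

theorem EV.congr {i : ℕ} (h : EV R X N i) (e : X ≃ₗ[R] Y) (e' : N ≃ₗ[R] M) : EV R Y M i :=
  h.of_retract e.symm.toLinearMap e.toLinearMap (by ext; simp) e'.symm.toLinearMap
    e'.toLinearMap (by ext; simp)

theorem EV.congr_left {i : ℕ} (h : EV R X N i) (e : X ≃ₗ[R] Y) : EV R Y N i :=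
  h.congr e (LinearEquiv.refl R N)

theorem EV.congr_right {i : ℕ} (h : EV R X N i) (e' : N ≃ₗ[R] M) : EV R X M i :=
  h.congr (LinearEquiv.refl R X) e'

theorem EV.of_subsingleton_left [Subsingleton X] (i : ℕ) : EV R X N i := by
  rw [EV.iff]
  intro e
  rw [← Ext.mk₀_id_comp e]
  have : (𝟙 (ModuleCat.of R X)) = 0 := by ext x; exact Subsingleton.elim (α := X) _ _
  rw [this]; simp

theorem EV.of_subsingleton_right [Subsingleton N] (i : ℕ) : EV R X N i := by
  rw [EV.iff]
  intro e
  rw [← Ext.comp_mk₀_id e]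
  have : (𝟙 (ModuleCat.of R N)) = 0 := by ext x; exact Subsingleton.elim (α := N) _ _
  rw [this]; simp

section LES
variable {f : A →ₗ[R] B} {g : B →ₗ[R] C} (h : SES f g)
include h

theorem SES.cov1 {i : ℕ} (h1 : EV R X C i) (h2 : EV R X B (i+1)) : EV R X A (i+1) := by
  rw [EV.iff] at *
  intro e
  obtain ⟨y, rfl⟩ := Ext.covariant_sequence_exact₁ (X := ModuleCat.of R X) h.shortExact e (h2 _) rfl
  rw [h1 y]; simp

theorem SES.cov2 {i : ℕ} (h1 : EV R X A i) (h2 : EV R X C i) : EV R X B i := by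
  rw [EV.iff] at *
  intro e
  obtain ⟨y, rfl⟩ := Ext.covariant_sequence_exact₂ (X := ModuleCat.of R X) h.shortExact e (h2 _)
  rw [h1 y]; simp

theorem SES.cov3 {i : ℕ} (h1 : EV R X B i) (h2 : EV R X A (i+1)) : EV R X C i := by
  rw [EV.iff] at *
  intro e
  obtain ⟨y, rfl⟩ := Ext.covariant_sequence_exact₃ (X := ModuleCat.of R X) h.shortExact e rfl (h2 _)
  rw [h1 y]; simp

theorem SES.con1 {i : ℕ} (h1 : EV R B N i) (h2 : EV R C N (i+1)) : EV R A N i := by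
  rw [EV.iff] at *
  intro e
  obtain ⟨y, rfl⟩ := Ext.contravariant_sequence_exact₁ h.shortExact (ModuleCat.of R N) e (add_comm 1 i) (h2 _)
  rw [h1 y]; simp

theorem SES.con2 {i : ℕ} (h1 : EV R A N i) (h2 : EV R C N i) : EV R B N i := by
  rw [EV.iff] at *
  intro e
  obtain ⟨y, rfl⟩ := Ext.contravariant_sequence_exact₂ h.shortExact (ModuleCat.of R N) e (h1 _)
  rw [h2 y]; simp

theorem SES.con3 {i : ℕ} (h1 : EV R A N i) (h2 : EV R B N (i+1)) : EV R C N (i+1) := by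
  rw [EV.iff] at *
  intro e
  obtain ⟨y, rfl⟩ := Ext.contravariant_sequence_exact₃ h.shortExact (ModuleCat.of R N) e (h2 _) (add_comm 1 i)
  rw [h1 y]; simp

/-- lifting along `g` -/
theorem SES.lift_of_ev (h1 : EV R X A 1) (φ : X →ₗ[R] C) : ∃ ψ : X →ₗ[R] B, g.comp ψ = φ := by
  rw [EV.iff] at *
  obtain ⟨y, hy⟩ := Ext.covariant_sequence_exact₃ (X := ModuleCat.of R X) h.shortExact (Ext.mk₀ (ModuleCat.ofHom φ)) rfl (h1 _)
  obtain ⟨f', rfl⟩ := Ext.addEquiv₀.symm.surjective y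
  refine ⟨f'.hom, ?_⟩
  have := Ext.mk₀_bijective _ _ |>.1 ((Ext.mk₀_comp_mk₀ _ _).symm.trans hy)
  exact congrArg ModuleCat.Hom.hom this

theorem SES.extend_of_ev (h1 : EV R C N 1) (φ : A →ₗ[R] N) : ∃ ψ : B →ₗ[R] N, ψ.comp f = φ := by
  rw [EV.iff] at *
  obtain ⟨y, hy⟩ := Ext.contravariant_sequence_exact₁ h.shortExact (ModuleCat.of R N) (Ext.mk₀ (ModuleCat.ofHom φ)) rfl (h1 _)
  obtain ⟨f', rfl⟩ := Ext.addEquiv₀.symm.surjective y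
  refine ⟨f'.hom, ?_⟩
  have := Ext.mk₀_bijective _ _ |>.1 ((Ext.mk₀_comp_mk₀ _ _).symm.trans hy)
  exact congrArg ModuleCat.Hom.hom this

theorem SES.ev_of_lift (h1 : EV R X B 1) (hl : ∀ φ : X →ₗ[R] C, ∃ ψ : X →ₗ[R] B, g.comp ψ = φ) :
    EV R X A 1 := by
  rw [EV.iff] at *
  intro e
  obtain ⟨y, rfl⟩ := Ext.covariant_sequence_exact₁ (X := ModuleCat.of R X) h.shortExact e (h1 _) (zero_add 1)
  obtain ⟨f', rfl⟩ := Ext.addEquiv₀.symm.surjective y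
  obtain ⟨ψ, hψ⟩ := hl f'.hom
  have : f' = (ModuleCat.ofHom ψ) ≫ h.sc.g := by
    apply ModuleCat.hom_ext
    simpa using hψ.symm
  rw [this, Ext.addEquiv₀_symm_apply, ← Ext.mk₀_comp_mk₀]
  rw [Ext.comp_assoc_of_second_deg_zero, ShortComplex.ShortExact.comp_extClass]
  simp

theorem SES.ev_of_extend (h1 : EV R B N 1) (hl : ∀ φ : A →ₗ[R] N, ∃ ψ : B →ₗ[R] N, ψ.comp f = φ) :
    EV R C N 1 := by
  rw [EV.iff] at *
  intro e
  obtain ⟨y, rfl⟩ := Ext.contravariant_sequence_exact₃ h.shortExact (ModuleCat.of R N) e (h1 _) (add_zero 1)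
  obtain ⟨f', rfl⟩ := Ext.addEquiv₀.symm.surjective y
  obtain ⟨ψ, hψ⟩ := hl f'.hom
  have : f' = h.sc.f ≫ (ModuleCat.ofHom ψ)  := by
    apply ModuleCat.hom_ext
    simpa using hψ.symm
  rw [this, Ext.addEquiv₀_symm_apply, ← Ext.mk₀_comp_mk₀]
  rw [← Ext.comp_assoc_of_second_deg_zero, ShortComplex.ShortExact.extClass_comp]
  simp

end LES

theorem EV.of_projective [Module.Projective R X] (i : ℕ) : EV R X N (i+1) := by
  rw [EV.iff]
  intro e
  have : Projective (ModuleCat.of R X) := (IsProjective.iff_projective X).1 inferInstance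
  exact Ext.eq_zero_of_projective e

theorem EV.of_injective [Module.Injective R N] (i : ℕ) : EV R X N (i+1) := by
  rw [EV.iff]
  intro e
  have : Injective (ModuleCat.of R N) := (Module.injective_iff_injective_object R N).1 inferInstance
  exact Ext.eq_zero_of_injective e

theorem injective_of_ev (h : ∀ I : Ideal R, EV R (R ⧸ I) N 1) : Module.Injective R N := by
  apply Module.Baer.injective
  intro I g
  obtain ⟨ψ, hψ⟩ := (SES.mkQ (R := R) (B := R) I).extend_of_ev (h I) g
  exact ⟨ψ, fun x hx => by rw [← hψ]; rfl⟩

theorem projective_of_ev (h : ∀ (N : Type u) [AddCommGroup N] [Module R N], EV R X N 1) :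
    Module.Projective R X := by
  let g : (X →₀ R) →ₗ[R] X := Finsupp.linearCombination R (id : X → X)
  have hg : Function.Surjective g := Finsupp.linearCombination_id_surjective R X
  obtain ⟨s, hs⟩ := (SES.ker hg).lift_of_ev (h _) LinearMap.id
  exact Module.Projective.of_split s g hs

theorem SES.split_of_ev {f : A →ₗ[R] B} {g : B →ₗ[R] C} (h : SES f g) (h1 : EV R C A 1) :
    ∃ s : C →ₗ[R] B, g.comp s = LinearMap.id := h.lift_of_ev h1 _

/-- if `x` acts bijectively on `N` and `x ^ t` kills `X` then all Ext vanish -/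
theorem EV.of_smul (x : R) (t : ℕ) (hX : ∀ y : X, x ^ t • y = 0)
    (hN : Function.Bijective fun n : N => x • n) (i : ℕ) : EV R X N i := by
  rw [EV.iff]
  intro e
  have hN' : Function.Bijective fun n : N => x ^ t • n := by
    clear hX
    induction t with
    | zero => simp only [pow_zero, one_smul]; exact Function.bijective_id
    | succ t ih =>
      have : (fun n : N => x ^ (t+1) • n) = (fun n : N => x ^ t • n) ∘ fun n : N => x • n := by
        funext n; simp [pow_succ, mul_smul]
      rw [this]
      exact ih.comp hN
  let φ : N ≃ₗ[R] N := LinearEquiv.ofBijective (LinearMap.lsmul R N (x^t)) hN'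
  have h0 : x ^ t • e = 0 := by
    rw [← Ext.mk₀_id_comp (x^t • e), Ext.comp_smul, ← Ext.smul_comp, ← Ext.mk₀_smul]
    have : x ^ t • 𝟙 (ModuleCat.of R X) = 0 := by
      ext y; exact hX y
    rw [this]; simp
  have h1 : x ^ t • e = e.comp (Ext.mk₀ (ModuleCat.ofHom φ.toLinearMap)) (add_zero i) := by
    have : ModuleCat.ofHom φ.toLinearMap = x ^ t • 𝟙 (ModuleCat.of R N) := by
      ext y; rfl
    rw [this, Ext.mk₀_smul, Ext.comp_smul, Ext.comp_mk₀_id]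
  rw [← Ext.comp_mk₀_id e]
  have : 𝟙 (ModuleCat.of R N) = ModuleCat.ofHom φ.toLinearMap ≫ ModuleCat.ofHom φ.symm.toLinearMap := by
    ext y; exact (φ.symm_apply_apply y).symm
  rw [this, ← Ext.mk₀_comp_mk₀, ← Ext.comp_assoc_of_second_deg_zero, ← h1, h0]
  simp

end P1
end GG


namespace GG

open CategoryTheory CategoryTheory.Abelian

section P1b

variable {R : Type u} [CommRing R]

variable (R) in
/-- injective dimension at most `n`, via Ext -/
def ID (N : Type u) [AddCommGroup N] [Module R N] (n : ℕ) : Prop :=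
  ∀ (X : Type u) [AddCommGroup X] [Module R X] (i : ℕ), n < i → EV R X N i

variable (R) in
/-- projective dimension at most `n`, via Ext -/
def PD (X : Type u) [AddCommGroup X] [Module R X] (n : ℕ) : Prop :=
  ∀ (N : Type u) [AddCommGroup N] [Module R N] (i : ℕ), n < i → EV R X N i

variable {A B C X Y N M : Type u} [AddCommGroup A] [Module R A] [AddCommGroup B] [Module R B]
    [AddCommGroup C] [Module R C] [AddCommGroup X] [Module R X] [AddCommGroup Y] [Module R Y]
    [AddCommGroup N] [Module R N] [AddCommGroup M] [Module R M]

theorem ID.mono {n m : ℕ} (h : ID R N n) (hnm : n ≤ m) : ID R N m :=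
  fun X _ _ i hi => h X i (by omega)

theorem PD.mono {n m : ℕ} (h : PD R N n) (hnm : n ≤ m) : PD R N m :=
  fun X _ _ i hi => h X i (by omega)

theorem ID.congr {n : ℕ} (h : ID R N n) (e : N ≃ₗ[R] M) : ID R M n :=
  fun X _ _ i hi => (h X i hi).congr_right e

theorem ID.retract {n : ℕ} (h : ID R N n) (s : M →ₗ[R] N) (r : N →ₗ[R] M)
    (hrs : r.comp s = LinearMap.id) : ID R M n :=
  fun X _ _ i hi => (h X i hi).of_retract LinearMap.id LinearMap.id rfl s r hrs

theorem PD.congr {n : ℕ} (h : PD R N n) (e : N ≃ₗ[R] M) : PD R M n :=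
  fun X _ _ i hi => (h X i hi).congr_left e

theorem ID.zero_of_injective (h : Module.Injective R N) : ID R N 0 := by
  intro X _ _ i hi
  obtain ⟨i, rfl⟩ := Nat.exists_eq_add_of_lt hi
  exact EV.of_injective _

theorem ID.injective (h : ID R N 0) : Module.Injective R N :=
  injective_of_ev fun I => h _ _ (by omega)

theorem PD.zero_of_projective (h : Module.Projective R N) : PD R N 0 := by
  intro X _ _ i hi
  obtain ⟨i, rfl⟩ := Nat.exists_eq_add_of_lt hi
  exact EV.of_projective _

theorem PD.projective (h : PD R N 0) : Module.Projective R N :=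
  projective_of_ev fun M _ _ => h _ _ (by omega)

variable (R) in
/-- enough injectives -/
theorem exists_inj (N : Type u) [AddCommGroup N] [Module R N] :
    ∃ (I : Type u) (_ : AddCommGroup I) (_ : Module R I) (f : N →ₗ[R] I),
      Module.Injective R I ∧ Function.Injective f := by
  obtain ⟨⟨J, hJ, f, hf⟩⟩ := EnoughInjectives.presentation (ModuleCat.of R N)
  refine ⟨J, inferInstance, inferInstance, f.hom, ?_, ?_⟩
  · rw [Module.injective_iff_injective_object]; exact hJ
  · exact (ModuleCat.mono_iff_injective f).1 hf

variable (R) in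
theorem exists_inj_ses (N : Type u) [AddCommGroup N] [Module R N] :
    ∃ (I C : Type u) (_ : AddCommGroup I) (_ : Module R I) (_ : AddCommGroup C) (_ : Module R C)
      (f : N →ₗ[R] I) (g : I →ₗ[R] C), Module.Injective R I ∧ SES f g := by
  obtain ⟨I, _, _, f, hI, hf⟩ := exists_inj R N
  exact ⟨I, _, _, _, _, _, f, _, hI, SES.coker hf⟩

variable (R) in
/-- enough free modules -/
theorem exists_free_ses (X : Type u) [AddCommGroup X] [Module R X] :
    ∃ (K P : Type u) (_ : AddCommGroup K) (_ : Module R K) (_ : AddCommGroup P) (_ : Module R P)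
      (f : K →ₗ[R] P) (g : P →ₗ[R] X), Module.Free R P ∧ SES f g := by
  let g : (X →₀ R) →ₗ[R] X := Finsupp.linearCombination R (id : X → X)
  have hg : Function.Surjective g := Finsupp.linearCombination_id_surjective R X
  exact ⟨_, _, _, _, _, _, _, g, inferInstance, SES.ker hg⟩

variable (R) in
theorem exists_free_ses_finite [IsNoetherianRing R] (X : Type u) [AddCommGroup X] [Module R X]
    [Module.Finite R X] :
    ∃ (K P : Type u) (_ : AddCommGroup K) (_ : Module R K) (_ : AddCommGroup P) (_ : Module R P)
      (f : K →ₗ[R] P) (g : P →ₗ[R] X), Module.Free R P ∧ Module.Finite R P ∧ Module.Finite R K ∧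
        SES f g := by
  obtain ⟨n, g, hg⟩ := Module.Finite.exists_fin' R X
  exact ⟨_, _, _, _, _, _, _, g, inferInstance, inferInstance, inferInstance, SES.ker hg⟩

theorem ID.of_ideal {n : ℕ} (h : ∀ I : Ideal R, EV R (R ⧸ I) N (n+1)) : ID R N n := by
  induction n generalizing N with
  | zero => exact ID.zero_of_injective (injective_of_ev h)
  | succ n ih =>
    obtain ⟨I, C, _, _, _, _, f, g, hI, hs⟩ := exists_inj_ses R N
    have hC : ID R C n := ih fun J => hs.cov3 (EV.of_injective _) (h J)
    intro X _ _ i hi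
    obtain ⟨i, rfl⟩ : ∃ j, i = j + 1 := ⟨i - 1, by omega⟩
    exact hs.cov1 (hC _ _ (by omega)) (EV.of_injective _)

theorem PD.of_succ {n : ℕ} (h : ∀ (N : Type u) [AddCommGroup N] [Module R N], EV R X N (n+1)) :
    PD R X n := by
  induction n generalizing X with
  | zero => exact PD.zero_of_projective (projective_of_ev h)
  | succ n ih =>
    obtain ⟨K, P, _, _, _, _, f, g, hP, hs⟩ := exists_free_ses R X
    have hC : PD R K n := ih fun J _ _ => hs.con1 (EV.of_projective _) (h J)
    intro N _ _ i hi
    obtain ⟨i, rfl⟩ : ∃ j, i = j + 1 := ⟨i - 1, by omega⟩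
    exact hs.con3 (hC _ _ (by omega)) (EV.of_projective _)

section
variable {f : A →ₗ[R] B} {g : B →ₗ[R] C} (h : SES f g)
include h

theorem SES.id1 {n : ℕ} (hB : ID R B (n+1)) (hC : ID R C n) : ID R A (n+1) := by
  intro X _ _ i hi
  obtain ⟨i, rfl⟩ : ∃ j, i = j + 1 := ⟨i - 1, by omega⟩
  exact h.cov1 (hC _ _ (by omega)) (hB _ _ (by omega))

theorem SES.id2 {n : ℕ} (hB : ID R A n) (hC : ID R C n) : ID R B n := by
  intro X _ _ i hi
  exact h.cov2 (hB _ _ (by omega)) (hC _ _ (by omega))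

theorem SES.id3 {n : ℕ} (hB : ID R B n) (hC : ID R A (n+1)) : ID R C n := by
  intro X _ _ i hi
  exact h.cov3 (hB _ _ (by omega)) (hC _ _ (by omega))

theorem SES.id3' {n : ℕ} (hB : ID R B n) (hC : ID R A n) : ID R C n := h.id3 hB (hC.mono (by omega))

theorem SES.pd1 {n : ℕ} (hB : PD R B n) (hC : PD R C (n+1)) : PD R A n := by
  intro X _ _ i hi
  exact h.con1 (hB _ _ (by omega)) (hC _ _ (by omega))

theorem SES.pd2 {n : ℕ} (hB : PD R A n) (hC : PD R C n) : PD R B n := by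
  intro X _ _ i hi
  exact h.con2 (hB _ _ (by omega)) (hC _ _ (by omega))

theorem SES.pd3 {n : ℕ} (hA : PD R A n) (hB : PD R B (n+1)) : PD R C (n+1) := by
  intro X _ _ i hi
  obtain ⟨i, rfl⟩ : ∃ j, i = j + 1 := ⟨i - 1, by omega⟩
  exact h.con3 (hA _ _ (by omega)) (hB _ _ (by omega))

end

/-- prime filtration -/
theorem EV.of_primes [IsNoetherianRing R] [hX : Module.Finite R X] {i : ℕ}
    (h : ∀ q : PrimeSpectrum R, q ∈ Module.support R X → EV R (R ⧸ q.asIdeal) N i) :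
    EV R X N i := by
  induction hX using IsNoetherianRing.induction_on_isQuotientEquivQuotientPrime R with
  | subsingleton X => exact EV.of_subsingleton_left _
  | quotient X p f =>
    refine EV.congr_left (h p ?_) f.symm
    rw [f.support_eq, Module.support_eq_zeroLocus, Ideal.annihilator_quotient]
    simp [PrimeSpectrum.mem_zeroLocus]
  | exact N₁ N₂ N₃ f g hf hg hfg h₁ h₃ =>
    have hs : SES f g := ⟨hf, hfg, hg⟩
    rw [Module.support_of_exact hfg hf hg] at h
    exact hs.con2 (h₁ fun q hq => h q (Or.inl hq)) (h₃ fun q hq => h q (Or.inr hq))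

theorem ID.of_primes [IsNoetherianRing R] {n : ℕ}
    (h : ∀ q : PrimeSpectrum R, EV R (R ⧸ q.asIdeal) N (n+1)) : ID R N n :=
  ID.of_ideal fun _ => EV.of_primes fun q _ => h q

/-- The Nakayama lemma step. -/
theorem EV.nakayama [IsNoetherianRing R] [IsLocalRing R] [Module.Finite R M] {i : ℕ}
    (q : PrimeSpectrum R) (hq : q.asIdeal ≠ IsLocalRing.maximalIdeal R)
    (h : ∀ q' : PrimeSpectrum R, q < q' → EV R (R ⧸ q'.asIdeal) M (i+1)) :
    EV R (R ⧸ q.asIdeal) M i := by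
  obtain ⟨x, hxm, hxq⟩ : ∃ x ∈ IsLocalRing.maximalIdeal R, x ∉ q.asIdeal := by
    by_contra! hcon
    exact hq (le_antisymm (IsLocalRing.le_maximalIdeal q.2.ne_top) hcon)
  let f : (R ⧸ q.asIdeal) →ₗ[R] (R ⧸ q.asIdeal) := LinearMap.lsmul R _ x
  have hf : Function.Injective f := by
    rw [← LinearMap.ker_eq_bot, LinearMap.ker_eq_bot']
    intro y hy
    obtain ⟨y, rfl⟩ := Ideal.Quotient.mk_surjective y
    have : Ideal.Quotient.mk q.asIdeal (x * y) = 0 := hy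
    rw [Ideal.Quotient.eq_zero_iff_mem] at this ⊢
    exact (q.2.mem_or_mem this).resolve_left hxq
  have hs := SES.coker hf
  have hC : EV R ((R ⧸ q.asIdeal) ⧸ LinearMap.range f) M (i+1) := by
    refine EV.of_primes fun q' hq' => h q' ?_
    have h1 : q' ∈ Module.support R (R ⧸ q.asIdeal) :=
      Module.support_subset_of_surjective _ (Submodule.mkQ_surjective _) hq'
    rw [Module.support_eq_zeroLocus, Ideal.annihilator_quotient] at h1
    refine lt_of_le_of_ne h1 ?_
    rintro rfl
    rw [Module.mem_support_iff'] at hq'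
    obtain ⟨m, hm⟩ := hq'
    obtain ⟨m, rfl⟩ := Submodule.mkQ_surjective _ m
    apply hm x hxq
    rw [← map_smul, Submodule.mkQ_apply, Submodule.Quotient.mk_eq_zero]
    exact ⟨m, rfl⟩
  rw [EV.iff] at hC ⊢
  have hsurj : ∀ e : Ext (ModuleCat.of R (R ⧸ q.asIdeal)) (ModuleCat.of R M) i, ∃ e', x • e' = e := by
    intro e
    obtain ⟨y, hy⟩ := Ext.contravariant_sequence_exact₁ hs.shortExact (ModuleCat.of R M) e (add_comm 1 i) (hC _)
    refine ⟨y, ?_⟩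
    rw [← hy]
    have : hs.sc.f = x • 𝟙 (ModuleCat.of R (R ⧸ q.asIdeal)) := by ext; rfl
    rw [this, Ext.mk₀_smul, Ext.smul_comp]
    congr 1
    exact (Ext.mk₀_id_comp y).symm
  have hle : (⊤ : Submodule R (Ext (ModuleCat.of R (R ⧸ q.asIdeal)) (ModuleCat.of R M) i)) ≤
      IsLocalRing.maximalIdeal R • ⊤ := by
    intro e _
    obtain ⟨e', rfl⟩ := hsurj e
    exact Submodule.smul_mem_smul hxm trivial
  have hfin : Module.Finite R (Ext (ModuleCat.of R (R ⧸ q.asIdeal)) (ModuleCat.of R M) i) := by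
    have : Module.Finite R (ModuleCat.of R (R ⧸ q.asIdeal)) := inferInstanceAs (Module.Finite R (R ⧸ q.asIdeal))
    have : Module.Finite R (ModuleCat.of R M) := inferInstanceAs (Module.Finite R M)
    infer_instance
  have := Submodule.eq_bot_of_le_smul_of_le_jacobson_bot _ _ hfin.fg_top hle (IsLocalRing.maximalIdeal_le_jacobson _)
  intro e
  have he : e ∈ (⊤ : Submodule R (Ext (ModuleCat.of R (R ⧸ q.asIdeal)) (ModuleCat.of R M) i)) := trivial
  rw [this] at he
  exact he

/-- direct sums -/
theorem EV.directSum [IsNoetherianRing R] {ι : Type u} (F : ι → Type u) [∀ j, AddCommGroup (F j)]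
    [∀ j, Module R (F j)] [Module.Finite R X] {i : ℕ} (h : ∀ j, EV R X (F j) i) :
    EV R X (DirectSum ι F) i := by
  classical
  induction i generalizing X with
  | zero =>
    rw [EV.zero_iff]
    intro f
    ext x : 1
    refine DFinsupp.ext fun j => ?_
    have := EV.zero_iff.1 (h j) ((DirectSum.component R ι F j).comp f)
    exact congrArg (fun g => g x) this
  | succ i ih =>
    obtain ⟨K, P, _, _, _, _, f, g, _, _, _, hs⟩ := exists_free_ses_finite R X
    rcases i with _ | i
    · refine hs.ev_of_extend (EV.of_projective _) fun φ => ?_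
      obtain ⟨s, hs'⟩ := Module.Finite.fg_top (R := R) (M := K)
      let J : Finset ι := s.biUnion fun k => DFinsupp.support (φ k)
      have hJ : ∀ k : K, ∀ j, j ∉ J → (φ k) j = 0 := by
        intro k j hj
        have : (DirectSum.component R ι F j).comp φ = 0 := by
          apply LinearMap.ext_on hs'
          intro k hk
          simp only [LinearMap.comp_apply, LinearMap.zero_apply]
          by_contra hne
          exact hj (Finset.mem_biUnion.2 ⟨k, hk, DFinsupp.mem_support_iff.2 hne⟩)
        exact congrArg (fun g => g k) this
      choose ψ hψ using fun j => hs.extend_of_ev (h j) ((DirectSum.component R ι F j).comp φ)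
      refine ⟨∑ j ∈ J, (DirectSum.lof R ι F j).comp (ψ j), ?_⟩
      ext k : 1
      have h1 : ∀ j, ψ j (f k) = (φ k) j := fun j => congrArg (fun g => g k) (hψ j)
      simp only [LinearMap.comp_apply, LinearMap.sum_apply, h1]
      refine DFinsupp.ext fun j => ?_
      rw [DFinsupp.finsetSum_apply]
      by_cases hj : j ∈ J
      · rw [Finset.sum_eq_single j]
        · exact DirectSum.of_eq_same _ _
        · intro b _ hb
          exact DirectSum.of_eq_of_ne _ _ _ (Ne.symm hb)
        · exact fun h => absurd hj h
      · rw [hJ k j hj]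
        refine Finset.sum_eq_zero fun b hb => ?_
        exact DirectSum.of_eq_of_ne _ _ _ (fun h => hj (h ▸ hb))
    · exact hs.con3 (ih fun j => hs.con1 (EV.of_projective _) (h j)) (EV.of_projective _)

theorem injective_directSum [IsNoetherianRing R] {ι : Type u} (F : ι → Type u) [∀ j, AddCommGroup (F j)]
    [∀ j, Module R (F j)] (h : ∀ j, Module.Injective R (F j)) : Module.Injective R (DirectSum ι F) :=
  injective_of_ev fun _ => EV.directSum F fun _ => EV.of_injective _

end P1b
end GG


namespace GG

open CategoryTheory CategoryTheory.Abelian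

section P1c

variable {R : Type u} [CommRing R]
variable {A B C X Y N M : Type u} [AddCommGroup A] [Module R A] [AddCommGroup B] [Module R B]
    [AddCommGroup C] [Module R C] [AddCommGroup X] [Module R X] [AddCommGroup Y] [Module R Y]
    [AddCommGroup N] [Module R N] [AddCommGroup M] [Module R M]

theorem SES.congr1 {f : A →ₗ[R] B} {g : B →ₗ[R] C} (h : SES f g) (e : X ≃ₗ[R] A) :
    SES (f.comp e.toLinearMap) g := by
  refine ⟨h.inj.comp e.injective, ?_, h.surj⟩
  intro b
  rw [h.exact b]
  constructor
  · rintro ⟨a, rfl⟩; exact ⟨e.symm a, by simp⟩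
  · rintro ⟨a, rfl⟩; exact ⟨e a, by simp⟩

theorem SES.congr3 {f : A →ₗ[R] B} {g : B →ₗ[R] C} (h : SES f g) (e : C ≃ₗ[R] X) :
    SES f (e.toLinearMap.comp g) := by
  refine ⟨h.inj, ?_, e.surjective.comp h.surj⟩
  intro b
  rw [← h.exact b]
  simp

theorem SES.congr2 {f : A →ₗ[R] B} {g : B →ₗ[R] C} (h : SES f g) (e : B ≃ₗ[R] X) :
    SES (e.toLinearMap.comp f) (g.comp e.symm.toLinearMap) := by
  refine ⟨e.injective.comp h.inj, ?_, h.surj.comp e.symm.surjective⟩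
  intro b
  simp only [LinearMap.comp_apply, LinearEquiv.coe_coe, Set.mem_range, h.exact (e.symm b)]
  constructor
  · rintro ⟨a, ha⟩; exact ⟨a, by rw [ha]; simp⟩
  · rintro ⟨a, rfl⟩; exact ⟨a, by simp⟩

theorem CoresolutionLE.split {P : ModuleCat.{u} R → Prop} {n : ℕ} (h : CoresolutionLE R P M n) :
    ∃ (G : ModuleCat.{u} R) (C : Type u) (_ : AddCommGroup C) (_ : Module R C) (f : M →ₗ[R] G)
      (g : G →ₗ[R] C), P G ∧ SES f g ∧ CoresolutionLE R P C (n - 1) ∧ (n = 0 → Subsingleton C) := by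
  obtain ⟨G, d, ε, hP, hε, h0, hd, hz⟩ := h
  refine ⟨G 0, LinearMap.range (d 0), inferInstance, inferInstance, ε, (d 0).rangeRestrict, hP 0,
    ⟨hε, ?_, LinearMap.surjective_rangeRestrict _⟩, ?_, ?_⟩
  · intro x
    have : x ∈ LinearMap.range ε ↔ x ∈ LinearMap.ker (d 0) := by rw [h0]
    rw [← LinearMap.coe_range, SetLike.mem_coe, this, LinearMap.mem_ker, Subtype.ext_iff]
    rfl
  · refine ⟨fun i => G (i+1), fun i => d (i+1), (LinearMap.range (d 0)).subtype, fun i => hP _,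
      Subtype.val_injective, ?_, fun i => hd _, fun i hi => hz _ (by omega)⟩
    rw [Submodule.range_subtype]
    exact hd 0
  · rintro rfl
    refine ⟨?_⟩
    rintro ⟨a, ha⟩ ⟨b, hb⟩
    rw [Subtype.ext_iff]
    change a = b
    rw [hz 1 (by omega) a, hz 1 (by omega) b]

/-- prepend to a family -/
def consG (G : ModuleCat.{u} R) (H : ℕ → ModuleCat.{u} R) : ℕ → ModuleCat.{u} R
  | 0 => G
  | n+1 => H n

/-- prepend to differentials -/
def consD (G : ModuleCat.{u} R) (H : ℕ → ModuleCat.{u} R) (f : G →ₗ[R] H 0)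
    (d : ∀ i : ℕ, H i →ₗ[R] H (i + 1)) : ∀ i, consG G H i →ₗ[R] consG G H (i+1)
  | 0 => f
  | n+1 => d n

theorem CoresolutionLE.cons {P : ModuleCat.{u} R → Prop} {n : ℕ} {G : ModuleCat.{u} R}
    (hG : P G) {f : M →ₗ[R] G} {g : G →ₗ[R] C} (hs : SES f g) (h : CoresolutionLE R P C n) :
    CoresolutionLE R P M (n+1) := by
  obtain ⟨H, d, ε, hP, hε, h0, hd, hz⟩ := h
  refine ⟨consG G H, consD G H (ε.comp g) d, f, ?_, hs.inj, ?_, ?_, ?_⟩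
  · rintro (_ | i)
    · exact hG
    · exact hP i
  · change _ = LinearMap.ker (ε.comp g)
    rw [LinearMap.ker_comp, LinearMap.ker_eq_bot.2 hε]
    ext x
    have := hs.exact x
    exact this.symm
  · rintro (_ | i)
    · change LinearMap.range (ε.comp g) = LinearMap.ker (d 0)
      rw [LinearMap.range_comp, LinearMap.range_eq_top.2 hs.surj, Submodule.map_top, h0]
    · exact hd i
  · rintro (_ | i) hi
    · omega
    · exact hz i (by omega)

theorem CoresolutionLE.single {P : ModuleCat.{u} R → Prop}
    (hM : P (ModuleCat.of R M)) (h0 : P (ModuleCat.of R PUnit)) : CoresolutionLE R P M 0 := by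
  refine ⟨consG (ModuleCat.of R M) fun _ => ModuleCat.of R PUnit, consD _ _ 0 0, LinearMap.id,
    ?_, Function.injective_id, ?_, ?_, ?_⟩
  · rintro (_ | i)
    · exact hM
    · exact h0
  · change _ = LinearMap.ker 0
    rw [LinearMap.ker_zero]; exact LinearMap.range_id
  · rintro (_ | i)
    · change LinearMap.range 0 = LinearMap.ker 0
      ext x
      have : x = 0 := Subsingleton.elim (α := PUnit) _ _
      simp [this]
    · change LinearMap.range 0 = LinearMap.ker 0
      ext x
      have : x = 0 := Subsingleton.elim (α := PUnit) _ _
      simp [this]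
  · rintro (_ | i) hi x
    · omega
    · exact Subsingleton.elim (α := PUnit) _ _

theorem ID.of_idLE {n : ℕ} (h : idLE R N n) : ID R N n := by
  induction n generalizing N with
  | zero =>
    obtain ⟨G, C, _, _, f, g, hG, hs, -, hC⟩ := h.split
    have := hC rfl
    have h1 := ID.zero_of_injective hG
    intro X _ _ i hi
    obtain ⟨i, rfl⟩ : ∃ j, i = j + 1 := ⟨i - 1, by omega⟩
    exact hs.cov1 (EV.of_subsingleton_right _) (h1 _ _ hi)
  | succ n ih =>
    obtain ⟨G, C, _, _, f, g, hG, hs, hC, -⟩ := h.split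
    exact hs.id1 ((ID.zero_of_injective hG).mono (by omega)) (ih hC)

theorem injective_punit : Module.Injective R PUnit.{u+1} :=
  injective_of_ev fun _ => EV.of_subsingleton_right _

theorem ID.idLE {n : ℕ} (h : ID R N n) : idLE R N n := by
  induction n generalizing N with
  | zero => exact CoresolutionLE.single h.injective injective_punit
  | succ n ih =>
    obtain ⟨I, C, _, _, _, _, f, g, hI, hs⟩ := exists_inj_ses R N
    exact CoresolutionLE.cons (G := ModuleCat.of R I) hI hs (ih (hs.id3 ((ID.zero_of_injective hI).mono (by omega)) h))

end P1c
end GG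


namespace GG

open CategoryTheory CategoryTheory.Abelian

section P3

variable {R : Type u} [CommRing R]
variable {A B C X Y N M : Type u} [AddCommGroup A] [Module R A] [AddCommGroup B] [Module R B]
    [AddCommGroup C] [Module R C] [AddCommGroup X] [Module R X] [AddCommGroup Y] [Module R Y]
    [AddCommGroup N] [Module R N] [AddCommGroup M] [Module R M]

variable (R) in
/-- Ext-one orthogonal to injectives -/
def Orth (X : Type u) [AddCommGroup X] [Module R X] : Prop :=
  ∀ (E : Type u) [AddCommGroup E] [Module R E], Module.Injective R E → EV R E X 1

/-- left step -/
def LStep (P : ModuleCat.{u} R → Prop) (X : Type u) [AddCommGroup X] [Module R X] : Prop :=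
  ∃ (Y I : ModuleCat.{u} R) (f : Y →ₗ[R] I) (g : I →ₗ[R] X), Module.Injective R I ∧ SES f g ∧ P Y

/-- right step -/
def RStep (P : ModuleCat.{u} R → Prop) (X : Type u) [AddCommGroup X] [Module R X] : Prop :=
  ∃ (Y I : ModuleCat.{u} R) (f : X →ₗ[R] I) (g : I →ₗ[R] Y), Module.Injective R I ∧ SES f g ∧ P Y

variable (R) in
/-- the class of modules with orthogonal left resolutions -/
def Wg (X : Type u) [AddCommGroup X] [Module R X] : Prop :=
  ∃ P : ModuleCat.{u} R → Prop, (∀ Y : ModuleCat.{u} R, P Y → Orth R Y ∧ LStep P Y) ∧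
    ∃ Y : ModuleCat.{u} R, P Y ∧ Nonempty (X ≃ₗ[R] Y)

theorem Orth.congr (h : Orth R X) (e : X ≃ₗ[R] Y) : Orth R Y :=
  fun E _ _ hE => (h E hE).congr_right e

theorem LStep.congr {P : ModuleCat.{u} R → Prop} (h : LStep P X) (e : X ≃ₗ[R] Y) : LStep P Y := by
  obtain ⟨Z, I, f, g, hI, hs, hZ⟩ := h
  exact ⟨Z, I, f, _, hI, hs.congr3 e, hZ⟩

theorem LStep.mono {P Q : ModuleCat.{u} R → Prop} (h : LStep P X) (hPQ : ∀ Y, P Y → Q Y) : LStep Q X := by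
  obtain ⟨Z, I, f, g, hI, hs, hZ⟩ := h
  exact ⟨Z, I, f, g, hI, hs, hPQ _ hZ⟩

theorem RStep.congr {P : ModuleCat.{u} R → Prop} (h : RStep P X) (e : Y ≃ₗ[R] X) : RStep P Y := by
  obtain ⟨Z, I, f, g, hI, hs, hZ⟩ := h
  exact ⟨Z, I, _, g, hI, hs.congr1 e, hZ⟩

theorem RStep.mono {P Q : ModuleCat.{u} R → Prop} (h : RStep P X) (hPQ : ∀ Y, P Y → Q Y) : RStep Q X := by
  obtain ⟨Z, I, f, g, hI, hs, hZ⟩ := h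
  exact ⟨Z, I, f, g, hI, hs, hPQ _ hZ⟩

theorem Wg.congr (h : Wg R X) (e : X ≃ₗ[R] Y) : Wg R Y := by
  obtain ⟨P, hP, Z, hZ, ⟨e'⟩⟩ := h
  exact ⟨P, hP, Z, hZ, ⟨e.symm.trans e'⟩⟩

theorem Wg.orth (h : Wg R X) : Orth R X := by
  obtain ⟨P, hP, Z, hZ, ⟨e'⟩⟩ := h
  exact (hP Z hZ).1.congr e'.symm

theorem Wg.lstep (h : Wg R X) : LStep (fun Y : ModuleCat.{u} R => Wg R Y) X := by
  obtain ⟨P, hP, Z, hZ, ⟨e'⟩⟩ := h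
  exact ((hP Z hZ).2.congr e'.symm).mono fun Y hY => ⟨P, hP, Y, hY, ⟨LinearEquiv.refl R Y⟩⟩

theorem Wg.of_GI (h : IsGorensteinInjective R X) : Wg R X := by
  obtain ⟨Z, d, hZ, hd, hl, ⟨e⟩⟩ := h
  refine ⟨fun Y => ∃ m, Nonempty (Y ≃ₗ[R] LinearMap.ker (d m)), ?_, ModuleCat.of R (LinearMap.ker (d 0)),
    ⟨0, ⟨LinearEquiv.refl R _⟩⟩, ⟨e⟩⟩
  rintro Y ⟨m, ⟨e⟩⟩
  constructor
  · refine Orth.congr ?_ e.symm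
    intro E _ _ hE
    have hs := SES.ker (LinearMap.surjective_rangeRestrict (d m))
    have : Module.Injective R (Z m) := hZ m
    have h1 : EV R E (LinearMap.ker (d m).rangeRestrict) 1 := by
      refine hs.ev_of_lift (EV.of_injective _) fun φ => ?_
      obtain ⟨ψ, hψ⟩ := hl (ModuleCat.of R E) hE m ((LinearMap.range (d m)).subtype.comp φ) (by
        ext x
        have : ((φ x : LinearMap.range (d m)) : Z (m+1)) ∈ LinearMap.ker (d (m+1)) := by
          rw [← hd]; exact (φ x).2
        exact this)
      refine ⟨ψ, ?_⟩
      ext x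
      exact congrArg (fun g => g x) hψ
    exact h1.congr_right (LinearEquiv.ofEq _ _ (LinearMap.ker_rangeRestrict (d m)))
  · obtain ⟨k, rfl⟩ : ∃ k, m = k + 1 := ⟨m - 1, by omega⟩
    refine LStep.congr ?_ e.symm
    have hs := SES.ker (LinearMap.surjective_rangeRestrict (d k))
    exact ⟨ModuleCat.of R _, Z k, _, _, hZ k, hs.congr3 (LinearEquiv.ofEq _ _ (hd k)), k,
      ⟨LinearEquiv.ofEq _ _ (LinearMap.ker_rangeRestrict (d k))⟩⟩

theorem Wg.ext {f : A →ₗ[R] B} {g : B →ₗ[R] C} (h : SES f g) (hA : Wg R A) (hC : Wg R C) :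
    Wg R B := by
  refine ⟨fun B => ∃ (A C : ModuleCat.{u} R) (f : A →ₗ[R] B) (g : B →ₗ[R] C), SES f g ∧
    Wg R A ∧ Wg R C, ?_, ModuleCat.of R B, ⟨ModuleCat.of R A, ModuleCat.of R C, f, g, h, hA, hC⟩,
    ⟨LinearEquiv.refl R B⟩⟩
  clear hC hA h
  rintro B ⟨A, C, f, g, h, hA, hC⟩
  refine ⟨fun E _ _ hE => h.cov2 (hA.orth E hE) (hC.orth E hE), ?_⟩
  obtain ⟨YA, IA, fA, pA, hIA, hsA, hYA⟩ := hA.lstep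
  obtain ⟨YC, IC, fC, pC, hIC, hsC, hYC⟩ := hC.lstep
  obtain ⟨s, hs⟩ := h.lift_of_ev (hA.orth IC hIC) pC
  let q : (IA × IC) →ₗ[R] B := LinearMap.coprod (f.comp pA) s
  have hgs : ∀ c, g (s c) = pC c := fun c => congrArg (fun t => t c) hs
  have hq : Function.Surjective q := by
    intro b
    obtain ⟨c, hc⟩ := hsC.surj (g b)
    obtain ⟨a, ha⟩ := h.lift (b := b - s c) (by rw [map_sub, hgs, hc, sub_self])
    obtain ⟨a, rfl⟩ := hsA.surj a
    exact ⟨(a, c), by simp [q, ha]⟩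
  have hI : Module.Injective R (IA × IC) := by
    apply injective_of_ev
    intro J
    have hs2 : SES (LinearMap.inl R IA IC) (LinearMap.snd R IA IC) :=
      ⟨LinearMap.inl_injective, Function.Exact.inl_snd, LinearMap.snd_surjective⟩
    exact hs2.cov2 (EV.of_injective _) (EV.of_injective _)
  refine ⟨ModuleCat.of R (LinearMap.ker q), ModuleCat.of R (IA × IC), _, _, hI, SES.ker hq, YA, YC, ?_⟩
  have hin : ∀ x : LinearMap.ker q, pC x.1.2 = 0 := by
    rintro ⟨⟨a, c⟩, hx⟩
    rw [LinearMap.mem_ker] at hx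
    have := congrArg g hx
    simpa [q, h.app, hgs] using this
  let k : YA →ₗ[R] LinearMap.ker q := LinearMap.codRestrict _ ((LinearMap.inl R IA IC).comp fA) (fun y => by
    simp [q, hsA.app])
  have hrange : ∀ x : LinearMap.ker q, x.1.2 ∈ LinearMap.range fC := fun x => hsC.lift (hin x)
  let l0 : LinearMap.ker q →ₗ[R] LinearMap.range fC :=
    LinearMap.codRestrict _ ((LinearMap.snd R IA IC).comp (LinearMap.ker q).subtype) hrange
  let e : LinearMap.range fC ≃ₗ[R] YC := (LinearEquiv.ofInjective fC hsC.inj).symm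
  have hs0 : SES k l0 := by
    refine ⟨?_, ?_, ?_⟩
    · intro x y hxy
      apply hsA.inj
      exact congrArg (fun z : LinearMap.ker q => z.1.1) hxy
    · rintro ⟨⟨a, c⟩, hx⟩
      constructor
      · intro h0
        have hc : c = 0 := congrArg (fun z : LinearMap.range fC => z.1) h0
        subst hc
        rw [LinearMap.mem_ker] at hx
        have : f (pA a) = 0 := by simpa [q] using hx
        have h1 : pA a = 0 := h.inj (by simpa using this)
        obtain ⟨y, rfl⟩ := hsA.lift h1
        exact ⟨y, rfl⟩
      · rintro ⟨y, hy⟩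
        rw [← hy]; rfl
    · rintro ⟨c, y, rfl⟩
      have h0 : g (s (fC y)) = 0 := by rw [hgs, hsC.app]
      obtain ⟨a, ha⟩ := h.lift h0
      obtain ⟨a, rfl⟩ := hsA.surj a
      refine ⟨⟨(-a, fC y), ?_⟩, rfl⟩
      simp [q, ha]
  exact ⟨k, _, hs0.congr3 e, hYA, hYC⟩

theorem gid_key {n : ℕ} (h : gidLE R M n) :
    ∃ (H P : ModuleCat.{u} R) (f : H →ₗ[R] P) (g : P →ₗ[R] M), SES f g ∧ ID R P n ∧ Wg R H := by
  induction n generalizing M with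
  | zero =>
    obtain ⟨G, C, _, _, f, g, hG, hs, -, hC⟩ := h.split
    have hC := hC rfl
    have hf : Function.Surjective f := fun x => hs.lift (Subsingleton.elim _ _)
    let e := LinearEquiv.ofBijective f ⟨hs.inj, hf⟩
    obtain ⟨Y, I, f, g, hI, hs, hY⟩ := ((Wg.of_GI hG).congr e.symm).lstep
    exact ⟨Y, I, f, g, hs, ID.zero_of_injective hI, hY⟩
  | succ n ih =>
    obtain ⟨G, C, _, _, f, g, hG, hs, hC, -⟩ := h.split
    obtain ⟨H, P, j, p, hs', hP, hH⟩ := ih hC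
    let Q := LinearMap.ker (LinearMap.coprod g (-p))
    have hQ : ∀ x : Q, g x.1.1 = p x.1.2 := by
      rintro ⟨⟨a, b⟩, hx⟩
      have : g a + - p b = 0 := hx
      exact add_neg_eq_zero.1 this
    have hQ' : ∀ a b, g a = p b → (a, b) ∈ Q := by
      intro a b hab
      change g a + - p b = 0
      rw [hab, add_neg_cancel]
    let k : H →ₗ[R] Q := LinearMap.codRestrict _ ((LinearMap.inr R G P).comp j) (fun y =>
      hQ' _ _ (by simp [hs'.app]))
    let l : Q →ₗ[R] G := (LinearMap.fst R G P).comp Q.subtype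
    have hkl : SES k l := by
      refine ⟨?_, ?_, ?_⟩
      · intro x y hxy
        exact hs'.inj (congrArg (fun z : Q => z.1.2) hxy)
      · rintro ⟨⟨a, b⟩, hx⟩
        constructor
        · intro h0
          have ha : a = 0 := h0
          subst ha
          have h1 := hQ ⟨(0, b), hx⟩
          obtain ⟨y, rfl⟩ := hs'.lift (b := b) (by rw [← h1]; simp)
          exact ⟨y, rfl⟩
        · rintro ⟨y, hy⟩; rw [← hy]; rfl
      · intro a
        obtain ⟨b, hb⟩ := hs'.surj (g a)
        exact ⟨⟨(a, b), hQ' _ _ hb.symm⟩, rfl⟩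
    have hWQ : Wg R Q := Wg.ext hkl hH (Wg.of_GI hG)
    obtain ⟨H'', I, u, v, hI, huv, hH''⟩ := hWQ.lstep
    let w : I →ₗ[R] P := ((LinearMap.snd R G P).comp Q.subtype).comp v
    have hw : Function.Surjective w := by
      intro b
      obtain ⟨a, ha⟩ := hs.surj (p b)
      obtain ⟨i, hi⟩ := huv.surj ⟨(a, b), hQ' _ _ ha⟩
      exact ⟨i, by simp [w, hi]⟩
    have hL : ID R (LinearMap.ker w) (n+1) :=
      (SES.ker hw).id1 ((ID.zero_of_injective hI).mono (by omega)) hP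
    have hmem : ∀ x : LinearMap.ker w, (v x.1).1.1 ∈ LinearMap.range f := by
      rintro ⟨x, hx⟩
      apply hs.lift
      rw [hQ]
      have : (v x).1.2 = 0 := hx
      simp [this]
    let t : LinearMap.ker w →ₗ[R] LinearMap.range f :=
      LinearMap.codRestrict _ ((l.comp v).comp (LinearMap.ker w).subtype) hmem
    let e : LinearMap.range f ≃ₗ[R] M := (LinearEquiv.ofInjective f hs.inj).symm
    let u' : H'' →ₗ[R] LinearMap.ker w := LinearMap.codRestrict _ u (fun y => by simp [w, huv.app])
    have hs3 : SES u' t := by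
      refine ⟨?_, ?_, ?_⟩
      · intro x y hxy
        exact huv.inj (congrArg (fun z : LinearMap.ker w => z.1) hxy)
      · rintro ⟨x, hx⟩
        constructor
        · intro h0
          have h1 : (v x).1.1 = 0 := congrArg (fun z : LinearMap.range f => z.1) h0
          have h2 : (v x).1.2 = 0 := hx
          obtain ⟨y, rfl⟩ := huv.lift (b := x) (Subtype.ext (Prod.ext h1 h2))
          exact ⟨y, rfl⟩
        · rintro ⟨y, hy⟩
          rw [← hy]
          apply Subtype.ext
          change (v (u y)).1.1 = 0
          rw [huv.app]; rfl
      · rintro ⟨_, m, rfl⟩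
        obtain ⟨i, hi⟩ := huv.surj ⟨(f m, 0), hQ' _ _ (by simp [hs.app])⟩
        refine ⟨⟨i, ?_⟩, ?_⟩
        · simp [w, hi]
        · apply Subtype.ext
          change (v i).1.1 = f m
          rw [hi]
    exact ⟨H'', ModuleCat.of R (LinearMap.ker w), u', _, hs3.congr3 e, hL, hH''⟩

theorem Wg.ev_of_pd (h : Wg R X) {s : ℕ} (hM : PD R M s) : EV R M X 1 := by
  have : ∀ k, (∀ (X : Type u) [AddCommGroup X] [Module R X], Wg R X → EV R M X (k + 1)) →
      (∀ (X : Type u) [AddCommGroup X] [Module R X], Wg R X → EV R M X 1) := by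
    intro k
    induction k with
    | zero => intro h; exact h
    | succ k ih =>
      intro h
      refine ih fun X _ _ hX => ?_
      obtain ⟨Y, I, u, v, hI, huv, hY⟩ := hX.lstep
      exact huv.cov3 (EV.of_injective _) (h Y hY)
  exact this s (fun X _ _ _ => hM _ _ (by omega)) X h

theorem ID.of_gidLE_pd {n s : ℕ} (h : gidLE R M n) (hM : PD R M s) : ID R M n := by
  obtain ⟨H, P, f, g, hs, hP, hH⟩ := gid_key h
  obtain ⟨t, ht⟩ := hs.split_of_ev (hH.ev_of_pd hM)
  exact hP.retract t g ht

/-- the two-sided class gives Gorenstein injectivity -/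
theorem GI_of_class {P : ModuleCat.{u} R → Prop}
    (hP : ∀ Y : ModuleCat.{u} R, P Y → Orth R Y ∧ LStep P Y ∧ RStep P Y) (X : ModuleCat.{u} R)
    (hX : P X) : IsGorensteinInjective R X := by
  let S : ModuleCat.{u} R → ModuleCat.{u} R → Prop := fun X Y =>
    ∃ (I : ModuleCat.{u} R) (f : X →ₗ[R] I) (g : I →ₗ[R] Y), Module.Injective R I ∧ SES f g
  have hl : ∀ X : {X : ModuleCat.{u} R // P X}, ∃ Y : {X : ModuleCat.{u} R // P X}, S Y.1 X.1 := by
    rintro ⟨X, hX⟩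
    obtain ⟨Y, I, f, g, hI, hs, hY⟩ := (hP X hX).2.1
    exact ⟨⟨Y, hY⟩, I, f, g, hI, hs⟩
  have hr : ∀ X : {X : ModuleCat.{u} R // P X}, ∃ Y : {X : ModuleCat.{u} R // P X}, S X.1 Y.1 := by
    rintro ⟨X, hX⟩
    obtain ⟨Y, I, f, g, hI, hs, hY⟩ := (hP X hX).2.2
    exact ⟨⟨Y, hY⟩, I, f, g, hI, hs⟩
  choose l hl using hl
  choose r hr using hr
  obtain ⟨Z, hZ0, hZ⟩ : ∃ Z : ℤ → {X : ModuleCat.{u} R // P X}, Z 0 = ⟨X, hX⟩ ∧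
      ∀ n, S (Z n).1 (Z (n+1)).1 := by
    let Z : ℤ → {X : ModuleCat.{u} R // P X} := fun n => match n with
      | Int.ofNat n => r^[n] ⟨X, hX⟩
      | Int.negSucc n => l^[n+1] ⟨X, hX⟩
    refine ⟨Z, rfl, ?_⟩
    rintro (n | n)
    · have : Z (Int.ofNat n + 1) = r (Z (Int.ofNat n)) := Function.iterate_succ_apply' r n _
      rw [this]; exact hr _
    · rcases n with _ | n
      · exact hl _
      · have : Z (Int.negSucc (n+1)) = l (Z (Int.negSucc n)) := Function.iterate_succ_apply' l (n+1) _
        have e : Int.negSucc (n+1) + 1 = Int.negSucc n := by omega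
        rw [e, this]; exact hl _
  choose I f g hI hs using hZ
  let d : ∀ n : ℤ, I n →ₗ[R] I (n + 1) := fun n => (f (n+1)).comp (g n)
  have hker : ∀ n, LinearMap.ker (d n) = LinearMap.range (f n) := by
    intro n
    ext x
    simp only [LinearMap.mem_ker, d, LinearMap.comp_apply]
    rw [map_eq_zero_iff _ (hs (n+1)).inj]
    exact (hs n).exact x
  refine ⟨I, d, hI, ?_, ?_, ?_⟩
  · intro n
    rw [hker]
    exact LinearMap.range_comp_of_range_eq_top _ (LinearMap.range_eq_top.2 (hs n).surj)
  · intro E hE n φ hφ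
    have h1 : ∀ x, φ x ∈ LinearMap.range (f (n+1)) := by
      intro x
      rw [← hker]
      exact congrArg (fun t => t x) hφ
    let e := LinearEquiv.ofInjective (f (n+1)) (hs (n+1)).inj
    obtain ⟨ψ, hψ⟩ := (hs n).lift_of_ev ((hP _ (Z n).2).1 E hE)
      (e.symm.toLinearMap.comp (LinearMap.codRestrict _ φ h1))
    refine ⟨ψ, ?_⟩
    ext x
    have h2 : g n (ψ x) = e.symm (⟨φ x, h1 x⟩ : LinearMap.range (f (n+1))) := congrArg (fun t => t x) hψ
    change f (n+1) (g n (ψ x)) = φ x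
    rw [h2]
    have h3 := e.apply_symm_apply ⟨φ x, h1 x⟩
    exact congrArg Subtype.val h3
  · have e0 : X ≃ₗ[R] (Z 0).1 := by rw [hZ0]
    exact ⟨(e0.trans (LinearEquiv.ofInjective (f 0) (hs 0).inj)).trans (LinearEquiv.ofEq _ _ (hker 0).symm)⟩

end P3
end GG


namespace GG

open CategoryTheory CategoryTheory.Abelian

section P2

variable {R : Type u} [CommRing R]
variable {A B C X Y N M E : Type u} [AddCommGroup A] [Module R A] [AddCommGroup B] [Module R B]
    [AddCommGroup C] [Module R C] [AddCommGroup X] [Module R X] [AddCommGroup Y] [Module R Y]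
    [AddCommGroup N] [Module R N] [AddCommGroup M] [Module R M] [AddCommGroup E] [Module R E]

theorem SES.dual {f : A →ₗ[R] B} {g : B →ₗ[R] C} (h : SES f g) :
    SES (CharacterModule.dual g) (CharacterModule.dual f) := by
  refine ⟨CharacterModule.dual_injective_of_surjective _ h.surj, ?_,
    CharacterModule.dual_surjective_of_injective _ h.inj⟩
  intro c
  constructor
  · intro hc
    have hc' : ∀ a, c (f a) = 0 := fun a => DFunLike.congr_fun hc a
    let c0 : B →+ AddCircle (1 : ℚ) := c
    have key : ∀ b, g b = 0 → c0 b = 0 := by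
      intro b hb
      obtain ⟨a, rfl⟩ := h.lift hb
      exact hc' a
    refine ⟨(AddMonoidHom.liftOfSurjective g.toAddMonoidHom h.surj ⟨c0, ?_⟩ : C →+ AddCircle (1 : ℚ)), ?_⟩
    · intro b hb; exact key b hb
    · ext b
      exact AddMonoidHom.liftOfRightInverse_comp_apply g.toAddMonoidHom _ (Function.rightInverse_surjInv h.surj) ⟨c0, fun b hb => key b hb⟩ b
  · rintro ⟨c, rfl⟩
    ext a
    change c (g (f a)) = 0
    rw [h.app, map_zero]

theorem flat_ker {f : A →ₗ[R] B} {g : B →ₗ[R] C} (h : SES f g) [Module.Flat R B] [Module.Flat R C] :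
    Module.Flat R A := by
  have h1 := Module.Flat.iff_characterModule_injective.1 (inferInstance : Module.Flat R B)
  have h2 := Module.Flat.iff_characterModule_injective.1 (inferInstance : Module.Flat R C)
  rw [Module.Flat.iff_characterModule_injective]
  exact injective_of_ev fun I => h.dual.cov3 (EV.of_injective _) (EV.of_injective _)

section Noeth
set_option linter.unusedSectionVars false
variable [IsNoetherianRing R]

theorem EV.flat [Module.Finite R X] [Module.Flat R N] {i : ℕ} (h : EV R X R (i+1)) :
    EV R X N (i+1) := by
  induction i generalizing X with
  | zero =>
    obtain ⟨K, P, _, _, _, _, f, g, _, _, _, hs⟩ := exists_free_ses_finite R X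
    refine hs.ev_of_extend (EV.of_projective _) fun φ => ?_
    have : Module.FinitePresentation R K := Module.finitePresentation_of_finite R K
    obtain ⟨k, a, b, hab⟩ := Module.Flat.exists_factorization_of_finitePresentation φ
    have h1 : ∀ j : Fin k, ∃ ψ : P →ₗ[R] R, ψ.comp f = (Finsupp.lapply j).comp a := fun j =>
      hs.extend_of_ev h _
    choose ψ hψ using h1
    refine ⟨b.comp ((Finsupp.linearEquivFunOnFinite R R (Fin k)).symm.toLinearMap.comp (LinearMap.pi ψ)), ?_⟩
    rw [hab]
    ext x : 1
    simp only [LinearMap.comp_apply]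
    congr 1
    ext j
    exact congrArg (fun t => t x) (hψ j)
  | succ i ih =>
    obtain ⟨K, P, _, _, _, _, f, g, _, _, _, hs⟩ := exists_free_ses_finite R X
    exact hs.con3 (ih (hs.con1 (EV.of_projective _) h)) (EV.of_projective _)

theorem ID.flat {n : ℕ} (hR : ID R R n) [Module.Flat R N] : ID R N n :=
  ID.of_ideal fun _ => EV.flat (hR _ _ (by omega))

theorem PD.flat {n : ℕ} (hR : ID R R n) [Module.Flat R N] : PD R N n := by
  have key : ∀ k, ∀ (F : Type u) [AddCommGroup F] [Module R F] [Module.Flat R F],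
      (∀ (Z : Type u) [AddCommGroup Z] [Module R Z] [Module.Flat R Z], EV R F Z (k+1)) → PD R F k := by
    intro k
    induction k with
    | zero =>
      intro F _ _ _ h
      obtain ⟨K, P, _, _, _, _, f, g, _, hs⟩ := exists_free_ses R F
      have := flat_ker hs
      obtain ⟨s, hs'⟩ := hs.split_of_ev (h K)
      exact PD.zero_of_projective (Module.Projective.of_split s g hs')
    | succ k ih =>
      intro F _ _ _ h
      obtain ⟨K, P, _, _, _, _, f, g, _, hs⟩ := exists_free_ses R F
      have := flat_ker hs
      have hK : PD R K k := ih K fun Z _ _ _ => hs.con1 (EV.of_projective _) (h Z)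
      exact hs.pd3 hK ((PD.zero_of_projective inferInstance).mono (by omega))
  exact key n N fun Z _ _ _ => (ID.flat hR) _ _ (by omega)

open TensorProduct in
/-- the evaluation map -/
noncomputable def tauMap (L E : Type u) [AddCommGroup L] [Module R L] [AddCommGroup E] [Module R E] :
    L ⊗[R] E →ₗ[R] (Module.Dual R L →ₗ[R] E) :=
  (dualTensorHom R (Module.Dual R L) E).comp ((Module.Dual.eval R L).rTensor E)

theorem tauMap_bijective [Module.Free R A] [Module.Finite R A] :
    Function.Bijective (tauMap (R := R) A E) := by
  have h1 : Function.Bijective (dualTensorHom R (Module.Dual R A) E) := by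
    rw [← coe_dualTensorHomEquivOfBasis (Module.Free.chooseBasis R (Module.Dual R A))]
    exact LinearEquiv.bijective _
  have h2 : Function.Bijective ((Module.Dual.eval R A).rTensor E) := by
    have : (Module.Dual.eval R A).rTensor E = ((Module.evalEquiv R A).rTensor E).toLinearMap := rfl
    rw [this]
    exact LinearEquiv.bijective _
  exact h1.comp h2

theorem tauMap_natural (f : A →ₗ[R] B) (t) : tauMap (R := R) B E (f.rTensor E t) =
    (tauMap (R := R) A E t).comp f.dualMap := by
  have : (tauMap (R := R) B E).comp (f.rTensor E) =
    (LinearMap.lcomp R E f.dualMap).comp (tauMap (R := R) A E) := by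
    apply TensorProduct.ext'
    intro a e
    ext c
    simp [tauMap]
  exact congrArg (fun s => s t) this

theorem EV.char_inj [Module.Finite R X] [Module.Injective R E] {i : ℕ} (h : EV R X R (i+1)) :
    EV R X (CharacterModule E) (i+1) := by
  induction i generalizing X with
  | zero =>
    obtain ⟨K, P, _, _, _, _, f, g, _, _, _, hs⟩ := exists_free_ses_finite R X
    obtain ⟨K', P', _, _, _, _, f', g', _, _, _, hs'⟩ := exists_free_ses_finite R K
    obtain ⟨K'', P'', _, _, _, _, f'', g'', _, _, _, hs''⟩ := exists_free_ses_finite R K'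
    -- P'' → P' → P
    refine hs.ev_of_extend (EV.of_projective _) ?_
    change Function.Surjective (f.lcomp R (CharacterModule E))
    rw [← rTensor_injective_iff_lcomp_surjective]
    rw [← LinearMap.ker_eq_bot, LinearMap.ker_eq_bot']
    intro t ht
    obtain ⟨t', rfl⟩ := LinearMap.rTensor_surjective E hs'.surj t
    rw [← LinearMap.comp_apply, ← LinearMap.rTensor_comp] at ht
    set q := f'.comp g'' with hq
    obtain ⟨σ, hσ⟩ : ∃ σ : Module.Dual R P'' →ₗ[R] E, σ.comp q.dualMap = tauMap (R := R) P' E t' := by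
      have h1 := tauMap_natural (E := E) (f.comp g') t'
      rw [ht, map_zero] at h1
      have hker : LinearMap.ker q.dualMap ≤ LinearMap.ker (tauMap (R := R) P' E t') := by
        intro c hc
        have hc1 : ∀ x, c (f' x) = 0 := by
          intro x
          obtain ⟨x, rfl⟩ := hs''.surj x
          exact congrArg (fun s => s x) hc
        have hc2 : LinearMap.ker g' ≤ LinearMap.ker c := by
          intro x hx
          obtain ⟨y, rfl⟩ := hs'.lift hx
          exact hc1 y
        let cbar : K →ₗ[R] R := (LinearMap.ker g').liftQ c hc2 ∘ₗ (g'.quotKerEquivOfSurjective hs'.surj).symm.toLinearMap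
        have hcbar : cbar.comp g' = c := by
          ext x
          simp only [cbar, LinearMap.comp_apply, LinearEquiv.coe_coe]
          have : (g'.quotKerEquivOfSurjective hs'.surj).symm (g' x) = Submodule.Quotient.mk x := by
            rw [LinearEquiv.symm_apply_eq]; rfl
          rw [this]; rfl
        obtain ⟨ψ, hψ⟩ := hs.extend_of_ev h cbar
        have h2 : c = (f.comp g').dualMap ψ := by
          rw [← hcbar, ← hψ]; rfl
        rw [LinearMap.mem_ker, h2]
        exact (congrArg (fun s => s ψ) h1).symm
      let j : (Module.Dual R P' ⧸ LinearMap.ker q.dualMap) →ₗ[R] Module.Dual R P'' :=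
        (LinearMap.ker q.dualMap).liftQ q.dualMap le_rfl
      have hj : Function.Injective j := by
        rw [← LinearMap.ker_eq_bot]
        exact Submodule.ker_liftQ_eq_bot _ _ _ le_rfl
      obtain ⟨σ, hσ⟩ := Module.Injective.out j hj ((LinearMap.ker q.dualMap).liftQ _ hker)
      refine ⟨σ, ?_⟩
      ext c
      exact hσ (Submodule.Quotient.mk c)
    obtain ⟨t'', rfl⟩ := tauMap_bijective.2 σ
    rw [← tauMap_natural] at hσ
    rw [← tauMap_bijective.1 hσ, ← LinearMap.comp_apply, ← LinearMap.rTensor_comp]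
    have : g'.comp q = 0 := by
      ext x
      exact hs'.app _
    rw [this]; simp
  | succ i ih =>
    obtain ⟨K, P, _, _, _, _, f, g, _, _, _, hs⟩ := exists_free_ses_finite R X
    exact hs.con3 (ih (hs.con1 (EV.of_projective _) h)) (EV.of_projective _)

theorem PD.injective {n : ℕ} (hR : ID R R n) [Module.Injective R E] : PD R E (n+n) := by
  have key : ∀ k, ∀ (F : Type u) [AddCommGroup F] [Module R F],
      (∀ I : Ideal R, EV R (R ⧸ I) (CharacterModule F) (k+1)) → PD R F (n+k) := by
    intro k
    induction k with
    | zero =>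
      intro F _ _ h
      have := Module.Flat.iff_characterModule_injective.2 (injective_of_ev h)
      exact PD.flat hR
    | succ k ih =>
      intro F _ _ h
      obtain ⟨K, P, _, _, _, _, f, g, _, hs⟩ := exists_free_ses R F
      have : Module.Injective R (CharacterModule P) :=
        Module.Flat.iff_characterModule_injective.1 inferInstance
      have hK : PD R K (n+k) := ih K fun I => hs.dual.cov3 (EV.of_injective _) (h I)
      exact hs.pd3 hK ((PD.zero_of_projective inferInstance).mono (by omega))
  exact key n E fun I => EV.char_inj (hR _ _ (by omega))

end Noeth

variable (R) in
/-- modules with an infinite left resolution by injectives -/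
def Wl (X : Type u) [AddCommGroup X] [Module R X] : Prop :=
  ∃ P : ModuleCat.{u} R → Prop, (∀ Y : ModuleCat.{u} R, P Y → LStep P Y) ∧
    ∃ Y : ModuleCat.{u} R, P Y ∧ Nonempty (X ≃ₗ[R] Y)

theorem Wl.congr (h : Wl R X) (e : X ≃ₗ[R] Y) : Wl R Y := by
  obtain ⟨P, hP, Z, hZ, ⟨e'⟩⟩ := h
  exact ⟨P, hP, Z, hZ, ⟨e.symm.trans e'⟩⟩

theorem Wl.lstep (h : Wl R X) : LStep (fun Y : ModuleCat.{u} R => Wl R Y) X := by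
  obtain ⟨P, hP, Z, hZ, ⟨e'⟩⟩ := h
  exact ((hP Z hZ).congr e'.symm).mono fun Y hY => ⟨P, hP, Y, hY, ⟨LinearEquiv.refl R Y⟩⟩

theorem Wl.cons {f : A →ₗ[R] B} {g : B →ₗ[R] C} (h : SES f g) (hA : Wl R A) (hB : Module.Injective R B) :
    Wl R C := by
  refine ⟨fun Y => LStep (fun Z : ModuleCat.{u} R => Wl R Z) Y, ?_, ModuleCat.of R C, ?_,
    ⟨LinearEquiv.refl R C⟩⟩
  · intro Y hY
    exact LStep.mono hY fun Z hZ => hZ.lstep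
  · exact ⟨ModuleCat.of R A, ModuleCat.of R B, f, g, hB, h, hA⟩

/-- all higher Ext from injectives vanish -/
theorem Wl.ev (h : Wl R X) {s : ℕ} (hM : PD R M s) (i : ℕ) : EV R M X (i+1) := by
  have : ∀ k, (∀ (X : Type u) [AddCommGroup X] [Module R X], Wl R X → EV R M X (k + (i+1))) →
      (∀ (X : Type u) [AddCommGroup X] [Module R X], Wl R X → EV R M X (i+1)) := by
    intro k
    induction k with
    | zero => intro h; simpa using h
    | succ k ih =>
      intro h
      refine ih fun X _ _ hX => ?_
      obtain ⟨Y, I, u, v, hI, huv, hY⟩ := hX.lstep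
      have h1 := h Y hY
      rw [show k + 1 + (i+1) = k + i + 1 + 1 by omega] at h1
      exact huv.cov3 (EV.of_injective _) h1
  exact this s (fun X _ _ _ => hM _ _ (by omega)) X h

theorem Wl.GI [IsNoetherianRing R] {n : ℕ} (hR : ID R R n) (h : Wl R X) : IsGorensteinInjective R X := by
  refine GI_of_class (P := fun Y => Wl R Y) ?_ (ModuleCat.of R X) h
  intro Y hY
  refine ⟨fun E _ _ hE => hY.ev (PD.injective hR) 0, hY.lstep, ?_⟩
  obtain ⟨I, C, _, _, _, _, f, g, hI, hs⟩ := exists_inj_ses R Y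
  exact ⟨ModuleCat.of R C, ModuleCat.of R I, f, g, hI, hs, hY.cons hs hI⟩

/-- cosyzygies -/
def Cz : ℕ → ModuleCat.{u} R → ModuleCat.{u} R → Prop
  | 0, M, X => Nonempty (M ≃ₗ[R] X)
  | n+1, M, X => ∃ (I C : ModuleCat.{u} R) (f : M →ₗ[R] I) (g : I →ₗ[R] C), Module.Injective R I ∧
      SES f g ∧ Cz n C X

theorem injective_prod (hA : Module.Injective R A) (hB : Module.Injective R B) :
    Module.Injective R (A × B) := by
  apply injective_of_ev
  intro J
  have hs2 : SES (LinearMap.inl R A B) (LinearMap.snd R A B) :=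
    ⟨LinearMap.inl_injective, Function.Exact.inl_snd, LinearMap.snd_surjective⟩
  exact hs2.cov2 (EV.of_injective _) (EV.of_injective _)

theorem Cz.step {n : ℕ} {M X Z F : ModuleCat.{u} R} (h : Cz n M X) {a : Z →ₗ[R] F} {b : F →ₗ[R] M}
    (hs : SES a b) (hF : ID R F n) :
    ∃ (Y I : ModuleCat.{u} R) (f : Y →ₗ[R] I) (g : I →ₗ[R] X), Module.Injective R I ∧ SES f g ∧
      Cz n Z Y := by
  induction n generalizing M X Z F with
  | zero =>
    obtain ⟨e⟩ := h
    exact ⟨Z, F, a, _, hF.injective, hs.congr3 e, ⟨LinearEquiv.refl R Z⟩⟩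
  | succ n ih =>
    obtain ⟨J, C, u, v, hJ, huv, hC⟩ := h
    obtain ⟨JZ, CZ, _, _, _, _, z, w, hJZ, hzw⟩ := exists_inj_ses R Z
    obtain ⟨t, ht⟩ := Module.Injective.out a hs.inj z
    let φ : F →ₗ[R] (JZ × J) := t.prod (u.comp b)
    have hφ : Function.Injective φ := by
      rw [← LinearMap.ker_eq_bot, LinearMap.ker_eq_bot']
      intro x hx
      have h2 : u (b x) = 0 := congrArg Prod.snd hx
      have h3 : b x = 0 := huv.inj (by simpa using h2)
      obtain ⟨y, rfl⟩ := hs.lift h3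
      have h1 : t (a y) = 0 := congrArg Prod.fst hx
      rw [ht] at h1
      have : y = 0 := hzw.inj (by simpa using h1)
      rw [this, map_zero]
    have hφs := SES.coker hφ
    have hJJ := injective_prod hJZ hJ
    have hF' : ID R ((JZ × J) ⧸ LinearMap.range φ) n :=
      hφs.id3 ((ID.zero_of_injective hJJ).mono (by omega)) hF
    -- maps CZ → F' → C
    let β : ((JZ × J) ⧸ LinearMap.range φ) →ₗ[R] C := (LinearMap.range φ).liftQ (v.comp (LinearMap.snd R JZ J)) (by
      rintro _ ⟨x, rfl⟩
      simp [φ, huv.app])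
    let α0 : JZ →ₗ[R] ((JZ × J) ⧸ LinearMap.range φ) := (LinearMap.range φ).mkQ.comp (LinearMap.inl R JZ J)
    have hα0 : ∀ x, α0 x = 0 ↔ w x = 0 := by
      intro x
      rw [hzw.exact x]
      constructor
      · intro hx
        have : (x, (0 : J)) ∈ LinearMap.range φ := (Submodule.Quotient.mk_eq_zero _).1 hx
        obtain ⟨y, hy⟩ := this
        have h2 : u (b y) = 0 := congrArg Prod.snd hy
        have h3 : b y = 0 := huv.inj (by simpa using h2)
        obtain ⟨y, rfl⟩ := hs.lift h3
        refine ⟨y, ?_⟩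
        rw [← ht]
        exact congrArg Prod.fst hy
      · rintro ⟨y, rfl⟩
        refine (Submodule.Quotient.mk_eq_zero _).2 ⟨a y, ?_⟩
        refine Prod.ext (ht y) ?_
        change u (b (a y)) = 0
        rw [hs.app, map_zero]
    let wbar := (w.quotKerEquivOfSurjective hzw.surj)
    let α : CZ →ₗ[R] ((JZ × J) ⧸ LinearMap.range φ) :=
      ((LinearMap.ker w).liftQ α0 (fun x hx => (hα0 x).2 hx)).comp wbar.symm.toLinearMap
    have hα : ∀ x, α (w x) = α0 x := by
      intro x
      have : wbar.symm (w x) = Submodule.Quotient.mk x := by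
        rw [LinearEquiv.symm_apply_eq]; rfl
      simp only [α, LinearMap.comp_apply, LinearEquiv.coe_coe, this]; rfl
    have hαβ : SES α β := by
      refine ⟨?_, ?_, ?_⟩
      · rw [← LinearMap.ker_eq_bot, LinearMap.ker_eq_bot']
        intro x hx
        obtain ⟨x, rfl⟩ := hzw.surj x
        rw [hα, hα0] at hx
        exact hx
      · intro x
        constructor
        · intro hx
          obtain ⟨⟨p, j⟩, rfl⟩ := Submodule.mkQ_surjective _ x
          have : v j = 0 := hx
          obtain ⟨m, rfl⟩ := huv.lift this
          obtain ⟨y, rfl⟩ := hs.surj m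
          refine ⟨w (p - t y), ?_⟩
          rw [hα]
          refine (Submodule.Quotient.eq _).2 ⟨-y, ?_⟩
          refine Prod.ext ?_ ?_
          · simp [φ]
          · simp [φ]
        · rintro ⟨y, rfl⟩
          obtain ⟨y, rfl⟩ := hzw.surj y
          rw [hα]
          change v 0 = 0
          simp
      · intro c
        obtain ⟨j, rfl⟩ := huv.surj c
        exact ⟨Submodule.Quotient.mk (0, j), rfl⟩
    obtain ⟨Y, I, f, g, hI, hfg, hY⟩ := ih (Z := ModuleCat.of R CZ) (F := ModuleCat.of R _) hC hαβ hF'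
    exact ⟨Y, I, f, g, hI, hfg, ModuleCat.of R JZ, ModuleCat.of R CZ, z, w, hJZ, hzw, hY⟩

theorem Cz.wl [IsNoetherianRing R] {n : ℕ} (hR : ID R R n) {M X : ModuleCat.{u} R} (h : Cz n M X) :
    Wl R X := by
  refine ⟨fun X => ∃ M, Cz n M X, ?_, X, ⟨M, h⟩, ⟨LinearEquiv.refl R X⟩⟩
  rintro Y ⟨M, hM⟩
  obtain ⟨K, P, _, _, _, _, f, g, hP, hs⟩ := exists_free_ses R M
  obtain ⟨Y', I, f', g', hI, hs', hY'⟩ := Cz.step (Z := ModuleCat.of R K) (F := ModuleCat.of R P) hM hs (ID.flat hR)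
  exact ⟨Y', I, f', g', hI, hs', ModuleCat.of R K, hY'⟩

theorem GI_of_injective (h : Module.Injective R X) : IsGorensteinInjective R X := by
  refine GI_of_class (P := fun X => Module.Injective R X) ?_ (ModuleCat.of R X) h
  intro Y hY
  refine ⟨fun E _ _ _ => EV.of_injective _, ?_, ?_⟩
  · refine ⟨ModuleCat.of R PUnit, Y, 0, LinearMap.id, hY, ⟨fun _ _ _ => rfl, ?_, Function.surjective_id⟩, injective_punit⟩
    intro y
    simp [eq_comm]
  · refine ⟨ModuleCat.of R PUnit, Y, LinearMap.id, 0, hY, ⟨Function.injective_id, ?_, fun y => ⟨0, rfl⟩⟩, injective_punit⟩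
    intro y
    simp

theorem gidLE_of_gor [IsNoetherianRing R] {n : ℕ} (hR : ID R R n) (M : Type u) [AddCommGroup M] [Module R M] :
    gidLE R M n := by
  have key : ∀ k, ∀ (M : Type u) [AddCommGroup M] [Module R M],
      (∀ X : ModuleCat.{u} R, Cz k (ModuleCat.of R M) X → IsGorensteinInjective R X) → gidLE R M k := by
    intro k
    induction k with
    | zero =>
      intro M _ _ h
      exact CoresolutionLE.single (h (ModuleCat.of R M) ⟨LinearEquiv.refl R M⟩)
        (GI_of_injective injective_punit)
    | succ k ih =>
      intro M _ _ h
      obtain ⟨I, C, _, _, _, _, f, g, hI, hs⟩ := exists_inj_ses R M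
      refine CoresolutionLE.cons (G := ModuleCat.of R I) (GI_of_injective hI) hs (ih C fun X hX => ?_)
      exact h X ⟨ModuleCat.of R I, ModuleCat.of R C, f, g, hI, hs, hX⟩
  exact key n M fun X hX => (hX.wl hR).GI hR

end P2
end GG

namespace GG
open CategoryTheory CategoryTheory.Abelian TensorProduct RingTheory.Sequence
section P4a
variable {R : Type u} [CommRing R]
variable {A B C X Y N M L : Type u} [AddCommGroup A] [Module R A] [AddCommGroup B] [Module R B]
    [AddCommGroup C] [Module R C] [AddCommGroup X] [Module R X] [AddCommGroup Y] [Module R Y]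
    [AddCommGroup N] [Module R N] [AddCommGroup M] [Module R M] [AddCommGroup L] [Module R L]

theorem bij_of_loc (r : R) (f : N →ₗ[R] L) [IsLocalizedModule (Submonoid.powers r) f] :
    Function.Bijective fun x : L => r • x := by
  have := IsLocalizedModule.map_units f (⟨r, 1, pow_one r⟩ : Submonoid.powers r)
  exact (Module.End.isUnit_iff _).1 this

/-- the telescope presentation of a localization -/
theorem telescope (r : R) (f : N →ₗ[R] L) [IsLocalizedModule (Submonoid.powers r) f] :
    ∃ (a : (ℕ →₀ N) →ₗ[R] (ℕ →₀ N)) (b : (ℕ →₀ N) →ₗ[R] L), SES a b := by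
  have hb := bij_of_loc r f
  let e : L ≃ₗ[R] L := LinearEquiv.ofBijective (LinearMap.lsmul R L r) hb
  have he : ∀ x, e x = r • x := fun x => rfl
  let b : (ℕ →₀ N) →ₗ[R] L := Finsupp.lsum R fun n => ((e.symm.toLinearMap : Module.End R L) ^ n).comp f
  have hbs : ∀ n x, b (Finsupp.single n x) = ((e.symm.toLinearMap : Module.End R L) ^ n) (f x) := by
    intro n x; simp [b]
  let sh : (ℕ →₀ N) →ₗ[R] (ℕ →₀ N) := Finsupp.lmapDomain N R Nat.succ
  let a : (ℕ →₀ N) →ₗ[R] (ℕ →₀ N) := LinearMap.id - r • sh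
  have has : ∀ n x, a (Finsupp.single n x) = Finsupp.single n x - Finsupp.single (n+1) (r • x) := by
    intro n x
    simp [a, sh, Finsupp.mapDomain_single]
  have hes : ∀ x, e.symm (r • x) = x := fun x => by
    rw [← he, e.symm_apply_apply]
  have hba : ∀ y, b (a y) = 0 := by
    intro y
    induction y using Finsupp.induction_linear with
    | zero => simp
    | add y z hy hz => simp [hy, hz]
    | single n x =>
      rw [has, map_sub, hbs, hbs, pow_succ, map_smul, Module.End.mul_apply]
      rw [LinearEquiv.coe_coe, hes, sub_self]
  have hred1 : ∀ j n x, ∃ y, Finsupp.single n x = Finsupp.single (n+j) (r^j • x) + a y := by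
    intro j
    induction j with
    | zero => intro n x; exact ⟨0, by simp⟩
    | succ j ih =>
      intro n x
      obtain ⟨y, hy⟩ := ih n x
      refine ⟨y + Finsupp.single (n+j) (r^j • x), ?_⟩
      rw [map_add, has, hy, smul_smul, ← pow_succ']
      rw [← add_assoc n j 1]
      abel
  have hred : ∀ y, ∃ n x z, y = Finsupp.single n x + a z := by
    intro y
    induction y using Finsupp.induction_linear with
    | zero => exact ⟨0, 0, 0, by simp⟩
    | add y z hy hz =>
      obtain ⟨n, x, y', rfl⟩ := hy
      obtain ⟨n', x', z', rfl⟩ := hz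
      obtain ⟨w, hw⟩ := hred1 n' n x
      obtain ⟨w', hw'⟩ := hred1 n n' x'
      refine ⟨n + n', r^n' • x + r ^ n • x', w + w' + y' + z', ?_⟩
      rw [hw, hw', Finsupp.single_add, add_comm n' n]
      simp only [map_add]
      abel
    | single n x => exact ⟨n, x, 0, by simp⟩
  have hinv : ∀ n x, (r^n) • ((e.symm.toLinearMap : Module.End R L) ^ n) x = x := by
    intro n
    induction n with
    | zero => simp
    | succ n ih =>
      intro x
      rw [pow_succ', pow_succ, mul_smul, Module.End.mul_apply, ih, LinearEquiv.coe_coe, ← he, e.apply_symm_apply]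
  refine ⟨a, b, ?_, ?_, ?_⟩
  · rw [← LinearMap.ker_eq_bot, LinearMap.ker_eq_bot']
    intro y hy
    have h0 : ∀ n, y n = 0 := by
      intro n
      have h1 : y = r • sh y := sub_eq_zero.1 hy
      induction n with
      | zero =>
        rw [h1, Finsupp.smul_apply]
        have : (Finsupp.mapDomain Nat.succ y) 0 = 0 := Finsupp.mapDomain_of_notMem_range _ _ (by simp)
        rw [show sh y = Finsupp.mapDomain Nat.succ y from rfl, this, smul_zero]
      | succ n ih =>
        rw [h1, Finsupp.smul_apply]
        have : (Finsupp.mapDomain Nat.succ y) (n+1) = y n := Finsupp.mapDomain_apply Nat.succ_injective _ _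
        rw [show sh y = Finsupp.mapDomain Nat.succ y from rfl, this, ih, smul_zero]
    ext n; exact h0 n
  · intro y
    constructor
    · intro hy
      obtain ⟨n, x, z, rfl⟩ := hred y
      rw [map_add, hba, add_zero, hbs] at hy
      have h1 : f x = 0 := by
        rw [← hinv n (f x), hy, smul_zero]
      obtain ⟨⟨_, j, rfl⟩, hj⟩ := (IsLocalizedModule.eq_zero_iff (Submonoid.powers r) f).1 h1
      have hj' : r ^ j • x = 0 := hj
      obtain ⟨w, hw⟩ := hred1 j n x
      exact ⟨w + z, by rw [hw, hj']; simp⟩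
    · rintro ⟨z, rfl⟩; exact hba z
  · intro l
    obtain ⟨⟨x, ⟨_, j, rfl⟩⟩, hj⟩ := IsLocalizedModule.surj (Submonoid.powers r) f l
    refine ⟨Finsupp.single j x, ?_⟩
    rw [hbs, ← hj]
    have hj' : ∀ j (l : L), ((e.symm.toLinearMap : Module.End R L) ^ j) (r ^ j • l) = l := by
      intro j l
      rw [map_smul, hinv]
    exact hj' j l

theorem projective_finsupp [Module.Projective R N] : Module.Projective R (ℕ →₀ N) := by
  classical
  exact Module.Projective.of_equiv (finsuppLequivDFinsupp R (ι := ℕ) (M := N)).symm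

theorem PD.localization (r : R) {n : ℕ} (h : PD R N n) :
    PD R (Localization.Away r ⊗[R] N) (n+1) := by
  induction n generalizing N with
  | zero =>
    have := h.projective
    obtain ⟨a, b, hs⟩ := telescope r (TensorProduct.mk R (Localization.Away r) N 1)
    have := projective_finsupp (R := R) (N := N)
    exact hs.pd3 (PD.zero_of_projective inferInstance) ((PD.zero_of_projective inferInstance).mono (by omega))
  | succ n ih =>
    obtain ⟨K, P, _, _, _, _, f, g, hP, hs⟩ := exists_free_ses R N
    have hK : PD R K n := hs.pd1 ((PD.zero_of_projective inferInstance).mono (by omega)) h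
    have hK' := ih hK
    have hP' : PD R (Localization.Away r ⊗[R] P) 1 := by
      obtain ⟨a, b, hs⟩ := telescope r (TensorProduct.mk R (Localization.Away r) P 1)
      have := projective_finsupp (R := R) (N := P)
      exact hs.pd3 (PD.zero_of_projective inferInstance) ((PD.zero_of_projective inferInstance).mono (by omega))
    have hs' : SES (f.lTensor (Localization.Away r)) (g.lTensor (Localization.Away r)) :=
      ⟨Module.Flat.lTensor_preserves_injective_linearMap _ hs.inj, lTensor_exact _ hs.exact hs.surj,
        LinearMap.lTensor_surjective _ hs.surj⟩
    exact hs'.pd3 hK' (hP'.mono (by omega))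

/-- `R_r / R` -/
abbrev Dr (r : R) : Type u :=
  Localization.Away r ⧸ LinearMap.range (Algebra.linearMap R (Localization.Away r))

theorem Dr_ses (r : R) (h : IsSMulRegular N r) :
    SES (TensorProduct.mk R (Localization.Away r) N 1)
      ((LinearMap.range (Algebra.linearMap R (Localization.Away r))).mkQ.rTensor N) := by
  refine ⟨?_, ?_, LinearMap.rTensor_surjective _ (Submodule.mkQ_surjective _)⟩
  · rw [← LinearMap.ker_eq_bot, LinearMap.ker_eq_bot']
    intro x hx
    obtain ⟨⟨_, j, rfl⟩, hj⟩ := (IsLocalizedModule.eq_zero_iff (Submonoid.powers r) _).1 hx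
    have hj' : r ^ j • x = 0 := hj
    exact (h.pow j) (by simpa using hj')
  · have h1 := rTensor_exact (R := R) N (f := Algebra.linearMap R (Localization.Away r))
      (g := (LinearMap.range (Algebra.linearMap R (Localization.Away r))).mkQ)
      (fun x => by simp [-LinearMap.mem_range]; exact LinearMap.mem_range) (Submodule.mkQ_surjective _)
    intro y
    rw [h1 y]
    constructor
    · rintro ⟨z, rfl⟩
      obtain ⟨z, rfl⟩ := (TensorProduct.lid R N).symm.surjective z
      exact ⟨z, by simp⟩
    · rintro ⟨z, rfl⟩
      exact ⟨1 ⊗ₜ z, by simp⟩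

theorem isWeaklyRegular_swap {r s : R} {rest : List R} (h : IsWeaklyRegular N (r :: s :: rest)) :
    IsWeaklyRegular (QuotSMulTop s N) (r :: rest) := by
  rw [isWeaklyRegular_cons_iff, isWeaklyRegular_cons_iff] at h
  obtain ⟨h1, h2, h3⟩ := h
  rw [isWeaklyRegular_cons_iff]
  constructor
  · rw [isSMulRegular_iff_right_eq_zero_of_smul]
    intro x hx
    obtain ⟨x, rfl⟩ := Submodule.Quotient.mk_surjective _ x
    rw [← Submodule.Quotient.mk_smul, Submodule.Quotient.mk_eq_zero, Submodule.mem_smul_pointwise_iff_exists] at hx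
    obtain ⟨y, -, hy⟩ := hx
    have hy2 : (Submodule.Quotient.mk y : QuotSMulTop r N) = 0 := by
      apply (isSMulRegular_iff_right_eq_zero_of_smul.1 h2)
      rw [← Submodule.Quotient.mk_smul, hy, Submodule.Quotient.mk_eq_zero]
      exact Submodule.smul_mem_pointwise_smul _ _ _ trivial
    rw [Submodule.Quotient.mk_eq_zero, Submodule.mem_smul_pointwise_iff_exists] at hy2
    obtain ⟨z, -, rfl⟩ := hy2
    have : x = s • z := h1 (by simp only [← hy]; exact smul_comm _ _ _)
    rw [this, Submodule.Quotient.mk_eq_zero]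
    exact Submodule.smul_mem_pointwise_smul _ _ _ trivial
  · let e : QuotSMulTop s (QuotSMulTop r N) ≃ₗ[R] QuotSMulTop r (QuotSMulTop s N) :=
      (QuotSMulTop.equivQuotTensor s _) ≪≫ₗ (QuotSMulTop.equivQuotTensor r N).lTensor _ ≪≫ₗ
        TensorProduct.leftComm R _ _ _ ≪≫ₗ (QuotSMulTop.equivQuotTensor s N).symm.lTensor _ ≪≫ₗ
        (QuotSMulTop.equivQuotTensor r _).symm
    exact (e.isWeaklyRegular_congr rest).1 h3

/-- elements of `D_r ⊗ N` are killed by a power of `r` -/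
theorem Dr_torsion (r : R) (x : Dr r ⊗[R] N) : ∃ n, r ^ n • x = 0 := by
  induction x using TensorProduct.induction_on with
  | zero => exact ⟨0, by simp⟩
  | add x y hx hy =>
    obtain ⟨a, ha⟩ := hx
    obtain ⟨b, hb⟩ := hy
    exact ⟨a + b, by rw [smul_add, pow_add, mul_smul, mul_smul, hb, smul_comm, ha]; simp⟩
  | tmul x y =>
    obtain ⟨x, rfl⟩ := Submodule.Quotient.mk_surjective _ x
    obtain ⟨⟨x', ⟨_, j, rfl⟩⟩, hj⟩ := IsLocalizedModule.surj (Submonoid.powers r) (Algebra.linearMap R (Localization.Away r)) x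
    refine ⟨j, ?_⟩
    rw [TensorProduct.smul_tmul', ← Submodule.Quotient.mk_smul]
    have : (Submodule.Quotient.mk (r ^ j • x) : Dr r) = 0 := by
      rw [Submodule.Quotient.mk_eq_zero]
      exact ⟨x', hj.symm⟩
    rw [this, zero_tmul]

theorem tensor_torsion (s : R) (h : ∀ y : N, ∃ n, s ^ n • y = 0) (x : M ⊗[R] N) : ∃ n, s ^ n • x = 0 := by
  induction x using TensorProduct.induction_on with
  | zero => exact ⟨0, by simp⟩
  | add x y hx hy =>
    obtain ⟨a, ha⟩ := hx
    obtain ⟨b, hb⟩ := hy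
    exact ⟨a + b, by rw [smul_add, pow_add, mul_smul, mul_smul, hb, smul_comm, ha]; simp⟩
  | tmul x y =>
    obtain ⟨j, hj⟩ := h y
    refine ⟨j, ?_⟩
    rw [← TensorProduct.tmul_smul, hj, tmul_zero]

theorem Dr_weaklyRegular (r : R) (rest : List R) (h : IsWeaklyRegular N (r :: rest)) :
    IsWeaklyRegular (Dr r ⊗[R] N) rest := by
  induction rest generalizing N with
  | nil => exact IsWeaklyRegular.nil _ _
  | cons s rest ih =>
    have h' := isWeaklyRegular_swap h
    have h'' := ih h'
    rw [isWeaklyRegular_cons_iff]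
    rw [isWeaklyRegular_cons_iff] at h
    obtain ⟨h1, h2⟩ := h
    rw [isWeaklyRegular_cons_iff] at h2 h'
    refine ⟨?_, ((QuotSMulTop.tensorQuotSMulTopEquivQuotSMulTop s (Dr r) N).isWeaklyRegular_congr rest).1 h''⟩
    -- regularity of s
    have hs1 := Dr_ses r h1
    have hs2 := Dr_ses r h'.1
    rw [isSMulRegular_iff_right_eq_zero_of_smul]
    intro x hx
    obtain ⟨x, rfl⟩ := hs1.surj x
    rw [← map_smul] at hx
    obtain ⟨y, hy⟩ := hs1.lift hx
    -- image in N/s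
    obtain ⟨⟨z, ⟨_, j, rfl⟩⟩, hj⟩ := IsLocalizedModule.surj (Submonoid.powers r) (TensorProduct.mk R (Localization.Away r) N 1) x
    have hj' : r ^ j • x = TensorProduct.mk R (Localization.Away r) N 1 z := hj
    have h3 : s • z = r ^ j • y := hs1.inj (by
      rw [map_smul, map_smul, hy, ← hj', smul_comm])
    have key : ∀ (j : ℕ) (z y : N), s • z = r ^ j • y → ∃ w, z = r ^ j • w := by
      intro j
      induction j with
      | zero => intro z y _; exact ⟨z, by simp⟩
      | succ j ih =>
        intro z y hzy
        have h4 : (Submodule.Quotient.mk z : QuotSMulTop r N) = 0 := by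
          apply (isSMulRegular_iff_right_eq_zero_of_smul.1 h2.1)
          rw [← Submodule.Quotient.mk_smul, hzy, pow_succ', mul_smul, Submodule.Quotient.mk_eq_zero]
          exact Submodule.smul_mem_pointwise_smul _ _ _ trivial
        rw [Submodule.Quotient.mk_eq_zero, Submodule.mem_smul_pointwise_iff_exists] at h4
        obtain ⟨z1, -, rfl⟩ := h4
        have h5 : s • z1 = r ^ j • y := h1 (by
          simp only
          rw [smul_comm, hzy, pow_succ', mul_smul])
        obtain ⟨w, rfl⟩ := ih _ _ h5
        exact ⟨w, by rw [pow_succ', mul_smul]⟩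
    obtain ⟨w, rfl⟩ := key j z y h3
    have hb := bij_of_loc r (TensorProduct.mk R (Localization.Away r) N 1)
    have hreg : IsSMulRegular (Localization.Away r ⊗[R] N) r := hb.1
    have : x = TensorProduct.mk R (Localization.Away r) N 1 w := (hreg.pow j) (by
      simp only [hj', map_smul])
    rw [this, hs1.app]

end P4a
end GG

namespace GG
open CategoryTheory CategoryTheory.Abelian TensorProduct RingTheory.Sequence IsLocalRing
section P4b
variable {R : Type u} [CommRing R]
variable {N M : Type u} [AddCommGroup N] [Module R N] [AddCommGroup M] [Module R M]

theorem exists_regular_of_mdepth [IsLocalRing R] [Nontrivial M] {d : ℕ} (h : mdepth R M = d) :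
    ∃ rs : List R, rs.length = d ∧ (∀ r ∈ rs, r ∈ maximalIdeal R) ∧ IsRegular M rs := by
  have hne : {c : ℕ∞ | ∃ rs : List R, c = rs.length ∧
    (∀ r ∈ rs, r ∈ IsLocalRing.maximalIdeal R) ∧ RingTheory.Sequence.IsRegular M rs}.Nonempty :=
    ⟨0, [], by simp, by simp, IsRegular.nil _ _⟩
  have hlt : sSup {c : ℕ∞ | ∃ rs : List R, c = rs.length ∧
    (∀ r ∈ rs, r ∈ IsLocalRing.maximalIdeal R) ∧ RingTheory.Sequence.IsRegular M rs} < ⊤ := by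
    change mdepth R M < ⊤
    rw [h]; exact ENat.natCast_lt_top d
  have := hne.to_subtype
  obtain ⟨rs, h1, h2, h3⟩ := ENat.sSup_mem_of_nonempty_of_lt_top hlt
  refine ⟨rs, ?_, h2, h3⟩
  change mdepth R M = _ at h1
  rw [h] at h1
  exact_mod_cast h1.symm

/-- iterated local cohomology -/
noncomputable def Ht : List R → ModuleCat.{u} R → ModuleCat.{u} R
  | [], N => N
  | r :: rs, N => Ht rs (ModuleCat.of R (Dr r ⊗[R] N))

theorem Ht_pd (rs : List R) (N : ModuleCat.{u} R) {s : ℕ} (hw : IsWeaklyRegular N rs) (h : PD R N s) :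
    ∃ s', PD R (Ht rs N) s' := by
  induction rs generalizing N s with
  | nil => exact ⟨s, h⟩
  | cons r rs ih =>
    refine ih _ (s := s+1) (Dr_weaklyRegular r rs hw) ?_
    exact (Dr_ses r ((isWeaklyRegular_cons_iff _ _ _).1 hw).1).pd3 h (PD.localization r h)

theorem Ht_ev [IsLocalRing R] (rs : List R) (N : ModuleCat.{u} R) (hw : IsWeaklyRegular N rs)
    (hm : ∀ r ∈ rs, r ∈ maximalIdeal R) {j : ℕ} (h : EV R (R ⧸ maximalIdeal R) (Ht rs N) j) :
    EV R (R ⧸ maximalIdeal R) N (j + rs.length) := by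
  induction rs generalizing N with
  | nil => exact h
  | cons r rs ih =>
    have h1 := ih _ (Dr_weaklyRegular r rs hw) (fun r hr => hm r (by simp [hr])) h
    rw [List.length_cons, ← add_assoc]
    refine (Dr_ses r ((isWeaklyRegular_cons_iff _ _ _).1 hw).1).cov1 h1 ?_
    refine EV.of_smul r 1 ?_ (bij_of_loc r (TensorProduct.mk R (Localization.Away r) N 1)) _
    intro y
    obtain ⟨y, rfl⟩ := Ideal.Quotient.mk_surjective y
    rw [pow_one, Algebra.smul_def, Ideal.Quotient.algebraMap_eq, ← map_mul, Ideal.Quotient.eq_zero_iff_mem]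
    exact Ideal.mul_mem_right _ _ (hm r (by simp))

theorem Ht_torsion_of (s : R) (rs : List R) (N : ModuleCat.{u} R) (h : ∀ y : N, ∃ n, s ^ n • y = 0)
    (y : Ht rs N) : ∃ n, s ^ n • y = 0 := by
  induction rs generalizing N with
  | nil => exact h y
  | cons r rs ih => exact ih _ (fun y => tensor_torsion s h y) y

theorem Ht_torsion (rs : List R) (N : ModuleCat.{u} R) (s : R) (hs : s ∈ rs)
    (y : Ht rs N) : ∃ n, s ^ n • y = 0 := by
  induction rs generalizing N with
  | nil => simp at hs
  | cons r rs ih =>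
    rcases List.mem_cons.1 hs with rfl | hs
    · exact Ht_torsion_of s rs _ (fun y => Dr_torsion s y) y
    · exact ih _ hs y

/-- the radical of a regular sequence of length `dim R` is the maximal ideal -/
theorem maximalIdeal_le_radical [IsLocalRing R] [IsNoetherianRing R] {d : ℕ} (hd : ringKrullDim R = d)
    (rs : List R) (hl : rs.length = d) (hm : ∀ r ∈ rs, r ∈ maximalIdeal R) (h : IsRegular R rs) :
    maximalIdeal R ≤ (Ideal.ofList rs).radical := by
  have h1 := ringKrullDim_add_length_eq_ringKrullDim_of_isRegular rs h
  have h2 : ringKrullDim (R ⧸ Ideal.ofList rs) ≤ 0 := by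
    rw [hd, hl] at h1
    generalize ringKrullDim (R ⧸ Ideal.ofList rs) = k at h1
    induction k using WithBot.recBotCoe with
    | bot => exact bot_le
    | coe k =>
      have h1' : k + (d : ℕ∞) = d := by exact_mod_cast h1
      have h2' : k + (d : ℕ∞) = 0 + d := by rw [h1', zero_add]
      have : k = 0 := by
        have := (ENat.add_le_add_iff_right (ENat.natCast_ne_top d)).1 h2'.le
        exact le_antisymm this bot_le
      rw [this]; rfl
  rw [Ideal.radical_eq_sInf]
  refine le_sInf ?_
  rintro p ⟨hp1, hp2⟩
  have h3 : ringKrullDim (R ⧸ p) ≤ 0 :=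
    (ringKrullDim_le_of_surjective (Ideal.Quotient.factor hp1) (Ideal.Quotient.factor_surjective hp1)).trans h2
  have : Ring.KrullDimLE 0 (R ⧸ p) := (Ring.krullDimLE_iff).2 (by exact_mod_cast h3)
  have h4 : IsField (R ⧸ p) := Ring.KrullDimLE.isField_of_isDomain
  have h5 : p.IsMaximal := Ideal.Quotient.maximal_of_isField _ h4
  exact (IsLocalRing.eq_maximalIdeal h5).ge

theorem Ht_maxTorsion [IsLocalRing R] [IsNoetherianRing R] (rs : List R)
    (hr : maximalIdeal R ≤ (Ideal.ofList rs).radical) (N : ModuleCat.{u} R) (y : Ht rs N) :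
    ∃ n : ℕ, ∀ a ∈ (maximalIdeal R) ^ n, a • y = 0 := by
  let J : Ideal R := LinearMap.ker (LinearMap.toSpanSingleton R (Ht rs N) y)
  have hJ : ∀ a, a ∈ J ↔ a • y = 0 := fun a => by rw [LinearMap.mem_ker, LinearMap.toSpanSingleton_apply]
  have h1 : Ideal.ofList rs ≤ J.radical := by
    rw [Ideal.span_le]
    intro s hs
    obtain ⟨n, hn⟩ := Ht_torsion rs N s hs y
    exact ⟨n, (hJ _).2 hn⟩
  have h2 : maximalIdeal R ≤ J.radical := hr.trans (Ideal.radical_le_radical_iff.2 h1)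
  obtain ⟨n, hn⟩ := Ideal.exists_pow_le_of_le_radical_of_fg h2 (IsNoetherian.noetherian _)
  exact ⟨n, fun a ha => (hJ a).1 (hn ha)⟩

/-- finite injective dimension tested on the residue field -/
theorem ID.of_residue [IsLocalRing R] [IsNoetherianRing R] [Module.Finite R M] {d : ℕ} (hd : ringKrullDim R = d) {n : ℕ}
    (h : ∀ i, n < i → EV R (R ⧸ maximalIdeal R) M i) : ID R M n := by
  have key : ∀ (k : ℕ) (q : PrimeSpectrum R), Order.coheight q ≤ k → ∀ i, n < i → EV R (R ⧸ q.asIdeal) M i := by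
    intro k
    induction k with
    | zero =>
      intro q hq i hi
      have : q = closedPoint R := by
        have h0 : Order.coheight q = 0 := le_antisymm (by simpa using hq) bot_le
        rw [Order.coheight_eq_zero] at h0
        exact le_antisymm (le_maximalIdeal q.2.ne_top) (h0 (le_maximalIdeal q.2.ne_top))
      rw [this]
      exact h i hi
    | succ k ih =>
      intro q hq i hi
      by_cases hqm : q.asIdeal = maximalIdeal R
      · rw [hqm]; exact h i hi
      refine EV.nakayama q hqm fun q' hqq' => ih q' ?_ (i+1) (by omega)
      have h1 := Order.coheight_add_one_le hqq'
      have h2 := h1.trans hq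
      have : Order.coheight q' + 1 ≤ (k : ℕ∞) + 1 := by exact_mod_cast h2
      exact (ENat.add_le_add_iff_right (by simp)).1 this
  refine ID.of_primes fun q => ?_
  have hc : Order.coheight q < ⊤ := by
    have h1 : (Order.coheight q : WithBot ℕ∞) ≤ ringKrullDim R := Order.coheight_le_krullDim q
    rw [hd] at h1
    have h2 : Order.coheight q ≤ (d : ℕ∞) := by exact_mod_cast h1
    exact h2.trans_lt (ENat.natCast_lt_top d)
  obtain ⟨k, hk⟩ := ENat.ne_top_iff_exists.1 hc.ne
  exact key k q hk.ge (n+1) (by omega)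

theorem gor_of_Ht [IsLocalRing R] [IsNoetherianRing R] {d : ℕ} (hd : ringKrullDim R = d)
    (rs : List R) (hm : ∀ r ∈ rs, r ∈ maximalIdeal R) (h : IsWeaklyRegular R rs) {n : ℕ}
    (hg : gidLE R (Ht rs (ModuleCat.of R R)) n) : ∃ n, ID R R n := by
  obtain ⟨s, hs⟩ := Ht_pd rs (ModuleCat.of R R) h (PD.zero_of_projective (inferInstanceAs (Module.Projective R R)))
  have h1 := ID.of_gidLE_pd hg hs
  refine ⟨n + rs.length, ID.of_residue hd fun i hi => ?_⟩
  obtain ⟨j, rfl⟩ : ∃ j, i = j + rs.length := ⟨i - rs.length, by omega⟩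
  exact Ht_ev rs (ModuleCat.of R R) h hm (h1 _ _ (by omega))

end P4b
end GG

namespace GG
open CategoryTheory CategoryTheory.Abelian CategoryTheory.Limits
section P4c
section general
universe v₁ u₁ v₂ u₂
variable {C : Type u₁} [Category.{v₁} C] [Abelian C] [HasProjectiveResolutions C]
  {D : Type u₂} [Category.{v₂} D] [Abelian D]
  {F G H : C ⥤ D} [F.Additive] [G.Additive] [H.Additive] (α : F ⟶ G) (β : G ⟶ H)
  (w : α ≫ β = 0)

/-- the short complex of complexes obtained from a resolution -/
noncomputable def scP (K : ChainComplex C ℕ) : ShortComplex (ChainComplex D ℕ) :=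
  ShortComplex.mk ((NatTrans.mapHomologicalComplex α _).app K)
    ((NatTrans.mapHomologicalComplex β _).app K) (by
      ext n
      exact congrArg (fun t => t.app (K.X n)) w)

/-- functoriality of `scP` -/
noncomputable def scPMap {K L : ChainComplex C ℕ} (φ : K ⟶ L) : scP α β w K ⟶ scP α β w L where
  τ₁ := (F.mapHomologicalComplex _).map φ
  τ₂ := (G.mapHomologicalComplex _).map φ
  τ₃ := (H.mapHomologicalComplex _).map φ
  comm₁₂ := (NatTrans.mapHomologicalComplex α _).naturality φ
  comm₂₃ := (NatTrans.mapHomologicalComplex β _).naturality φ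

variable (h : ∀ (P : C) [Projective P],
  (ShortComplex.mk (α.app P) (β.app P) (congrArg (fun t => t.app P) w)).ShortExact)

include h in
theorem scP_shortExact {X : C} (P : ProjectiveResolution X) : (scP α β w P.complex).ShortExact := by
  apply HomologicalComplex.shortExact_of_degreewise_shortExact
  intro i
  exact h (P.complex.X i)

/-- connecting map -/
noncomputable def dl (n : ℕ) {X : C} (P : ProjectiveResolution X) :
    (H.mapHomologicalComplex _ ⋙ HomologicalComplex.homologyFunctor _ (ComplexShape.down ℕ) (n+1)).obj P.complex ⟶
    (F.mapHomologicalComplex _ ⋙ HomologicalComplex.homologyFunctor _ (ComplexShape.down ℕ) n).obj P.complex :=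
  (scP_shortExact α β w h P).δ (n + 1) n (by simp)

theorem dl_nat (n : ℕ) {X Y : C} (P : ProjectiveResolution X) (Q : ProjectiveResolution Y)
    (φ : P.complex ⟶ Q.complex) :
    (H.mapHomologicalComplex _ ⋙ HomologicalComplex.homologyFunctor _ (ComplexShape.down ℕ) (n+1)).map φ ≫
      dl α β w h n Q = dl α β w h n P ≫
    (F.mapHomologicalComplex _ ⋙ HomologicalComplex.homologyFunctor _ (ComplexShape.down ℕ) n).map φ :=
  (HomologicalComplex.HomologySequence.δ_naturality (scPMap α β w φ)
      (scP_shortExact α β w h P) (scP_shortExact α β w h Q) (n + 1) n (by simp)).symm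

theorem dl_isIso (n : ℕ) {X : C} (P : ProjectiveResolution X) (h0 : IsZero ((G.leftDerived n).obj X))
    (h1 : IsZero ((G.leftDerived (n+1)).obj X)) : IsIso (dl α β w h n P) := by
  have hS := scP_shortExact α β w h P
  have e0 : IsZero ((scP α β w P.complex).X₂.homology n) :=
    h0.of_iso (P.isoLeftDerivedObj G n).symm
  have e1 : IsZero ((scP α β w P.complex).X₂.homology (n+1)) :=
    h1.of_iso (P.isoLeftDerivedObj G (n+1)).symm
  exact hS.isIso_δ (n+1) n (by simp) e1 e0

/-- connecting natural transformation of derived functors -/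
noncomputable def connD (n : ℕ) : H.leftDerived (n + 1) ⟶ F.leftDerived n where
  app X := ((projectiveResolution X).isoLeftDerivedObj H (n + 1)).hom ≫
    dl α β w h n (projectiveResolution X) ≫
    ((projectiveResolution X).isoLeftDerivedObj F n).inv
  naturality X Y f := by
    let P := projectiveResolution X
    let Q := projectiveResolution Y
    let φ := ProjectiveResolution.lift f P Q
    have comm : φ.f 0 ≫ Q.π.f 0 = P.π.f 0 ≫ f := by
      have := ProjectiveResolution.lift_commutes_zero f P Q
      simpa using this
    have h1 := ProjectiveResolution.isoLeftDerivedObj_hom_naturality f P Q φ comm H (n + 1)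
    have h2 := ProjectiveResolution.isoLeftDerivedObj_inv_naturality f P Q φ comm F n
    have h3 := dl_nat α β w h n P Q φ
    change (H.leftDerived (n+1)).map f ≫ (Q.isoLeftDerivedObj H (n + 1)).hom ≫
      dl α β w h n Q ≫ (Q.isoLeftDerivedObj F n).inv =
      ((P.isoLeftDerivedObj H (n + 1)).hom ≫
      dl α β w h n P ≫ (P.isoLeftDerivedObj F n).inv) ≫
      (F.leftDerived n).map f
    rw [← Category.assoc, h1]
    simp only [Category.assoc]
    rw [h2, ← Category.assoc (dl _ _ _ _ _ _), ← h3, Category.assoc]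

theorem connD_isIso (n : ℕ) (X : C) (h0 : IsZero ((G.leftDerived n).obj X))
    (h1 : IsZero ((G.leftDerived (n+1)).obj X)) : IsIso ((connD α β w h n).app X) := by
  have := dl_isIso α β w h n (projectiveResolution X) h0 h1
  unfold connD
  infer_instance
end general
end P4c
end GG

namespace GG
open CategoryTheory CategoryTheory.Abelian CategoryTheory.Limits
section P4d
variable {R : Type u} [CommRing R]

/-- contravariant Hom -/
noncomputable abbrev FY (Y : ModuleCat.{u} R) : ModuleCat.{u} R ⥤ (ModuleCat.{u} R)ᵒᵖ :=
  ((linearYoneda R (ModuleCat.{u} R)).obj Y).rightOp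

/-- map of contravariant Hom -/
noncomputable abbrev FYmap {Y Z : ModuleCat.{u} R} (f : Y ⟶ Z) : FY Z ⟶ FY Y :=
  NatTrans.rightOp ((linearYoneda R (ModuleCat.{u} R)).map f)

theorem FYmap_comp_zero {S : ShortComplex (ModuleCat.{u} R)} : FYmap S.g ≫ FYmap S.f = 0 := by
  ext P
  apply Quiver.Hom.unop_inj
  ext x
  change ((show P ⟶ S.X₁ from x) ≫ S.f) ≫ S.g = 0
  rw [Category.assoc, S.zero, comp_zero]

theorem FY_shortExact {S : ShortComplex (ModuleCat.{u} R)} (hS : S.ShortExact) (P : ModuleCat.{u} R)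
    [Projective P] : (ShortComplex.mk ((FYmap S.g).app P) ((FYmap S.f).app P)
      (congrArg (fun t => NatTrans.app t P) (FYmap_comp_zero (S := S)))).ShortExact := by
  have := hS.mono_f
  have := hS.epi_g
  let T : ShortComplex (ModuleCat.{u} R) :=
    ShortComplex.mk (((linearYoneda R (ModuleCat.{u} R)).map S.f).app (Opposite.op P))
     (((linearYoneda R (ModuleCat.{u} R)).map S.g).app (Opposite.op P)) (by
      ext x
      change ((show P ⟶ S.X₁ from x) ≫ S.f) ≫ S.g = 0
      rw [Category.assoc, S.zero, comp_zero])
  have hT : T.ShortExact := by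
    refine ModuleCat.shortComplex_shortExact T ?_ ?_ ?_
    · intro x
      constructor
      · intro (hx : (show P ⟶ S.X₂ from x) ≫ S.g = 0)
        exact ⟨hS.exact.lift (show P ⟶ S.X₂ from x) hx, hS.exact.lift_f _ _⟩
      · rintro ⟨y, rfl⟩
        change ((show P ⟶ S.X₁ from y) ≫ S.f) ≫ S.g = 0
        rw [Category.assoc, S.zero, comp_zero]
    · intro x y (h : (show P ⟶ S.X₁ from x) ≫ S.f = (show P ⟶ S.X₁ from y) ≫ S.f)
      exact (cancel_mono S.f).1 h
    · intro (x : P ⟶ S.X₃)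
      have h := Projective.factorThru_comp x S.g
      exact ⟨Projective.factorThru x S.g, h⟩
  exact hT.op

theorem FY_map_isIso {B : ModuleCat.{u} R} (a : R) (hB : Function.Bijective fun b : B => a • b)
    (P : ModuleCat.{u} R) : IsIso ((FY B).map (a • 𝟙 P)) := by
  let e : B ≃ₗ[R] B := LinearEquiv.ofBijective (LinearMap.lsmul R B a) hB
  have : IsIso (((linearYoneda R (ModuleCat.{u} R)).obj B).map (a • 𝟙 P).op) := by
    rw [ConcreteCategory.isIso_iff_bijective]
    constructor
    · intro (x : P ⟶ B) (y : P ⟶ B) hxy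
      have h1 : (a • 𝟙 P) ≫ x = (a • 𝟙 P) ≫ y := hxy
      change x = y
      rw [Linear.smul_comp, Linear.smul_comp, Category.id_comp, Category.id_comp] at h1
      ext p
      apply hB.1
      exact congrArg (fun t => ModuleCat.Hom.hom t p) h1
    · intro x
      refine ⟨(show P ⟶ B from x) ≫ ModuleCat.ofHom e.symm.toLinearMap, ?_⟩
      change (a • 𝟙 P) ≫ (show P ⟶ B from x) ≫ ModuleCat.ofHom e.symm.toLinearMap = _
      apply ModuleCat.hom_ext
      apply LinearMap.ext
      intro p
      have : e (e.symm ((show P ⟶ B from x).hom p)) = (show P ⟶ B from x).hom p := e.apply_symm_apply _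
      simp only [Linear.smul_comp, Category.id_comp]
      exact this
  change IsIso (((linearYoneda R (ModuleCat.{u} R)).obj B).map (a • 𝟙 P).op).op
  infer_instance

theorem FY_derived_zero {B X : ModuleCat.{u} R} (a : R) (hB : Function.Bijective fun b : B => a • b)
    (hX : ∀ x : X, a • x = 0) (n : ℕ) : IsZero (((FY B).leftDerived n).obj X) := by
  let P := projectiveResolution X
  have h0 : a • 𝟙 X = 0 := by
    ext x; exact hX x
  have h1 := (FY B).leftDerived_map_eq n (a • 𝟙 X) (P := P) (Q := P) (a • 𝟙 P.complex) (by
    rw [h0]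
    ext x
    have : P.π.f 0 (a • x) = 0 := by
      rw [map_smul]
      have : ∀ y : ((ChainComplex.single₀ (ModuleCat.{u} R)).obj X).X 0, a • y = 0 := hX
      exact this _
    simp only [Linear.smul_comp, Category.id_comp, Functor.map_zero, comp_zero]
    rw [map_smul] at this
    exact this)
  have h2 : IsIso (((FY B).mapHomologicalComplex (ComplexShape.down ℕ)).map (a • 𝟙 P.complex)) := by
    have : ∀ i, IsIso ((((FY B).mapHomologicalComplex (ComplexShape.down ℕ)).map (a • 𝟙 P.complex)).f i) := by
      intro i
      exact FY_map_isIso a hB (P.complex.X i)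
    apply HomologicalComplex.Hom.isIso_of_components
  have h3 : IsIso (((FY B).leftDerived n).map (a • 𝟙 X)) := by
    rw [h1]
    have : IsIso (((FY B).mapHomologicalComplex (ComplexShape.down ℕ) ⋙ HomologicalComplex.homologyFunctor _ _ n).map
     (a • 𝟙 P.complex)) := by
      rw [Functor.comp_map]; infer_instance
    infer_instance
  have h4 : ((FY B).leftDerived n).map (0 : X ⟶ X) = 0 := by
    rw [(FY B).leftDerived_map_eq n (0 : X ⟶ X) (P := P) (Q := P) 0 (by simp)]
    rw [Functor.map_zero, zero_comp, comp_zero]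
  rw [h0, h4] at h3
  exact ((isIsoZero_iff_source_target_isZero _ _).1 h3).1

theorem diag_iso {S : ShortComplex (ModuleCat.{u} R)} (hS : S.ShortExact) (r : R)
    (hB : Function.Bijective fun b : S.X₂ => r • b) {D : Type v} [SmallCategory D]
    (I : D ⥤ Ideal R) (hI : ∀ t, ∃ k, r ^ k ∈ I.obj t) (n : ℕ) :
    Nonempty ((localCohomology.diagram I n) ⋙ (evaluation _ _).obj S.X₃ ≅
      (localCohomology.diagram I (n+1)) ⋙ (evaluation _ _).obj S.X₁) := by
  have hz : ∀ t m, IsZero (((FY S.X₂).leftDerived m).obj ((localCohomology.ringModIdeals I).obj t)) := by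
    intro t m
    obtain ⟨k, hk⟩ := hI t
    refine FY_derived_zero (r ^ k) ?_ ?_ m
    · have : (fun b : S.X₂ => r ^ k • b) = (fun b => r • b)^[k] := by
        funext b
        exact (smul_iterate_apply _ _ _).symm
      rw [this]
      exact hB.iterate k
    · intro (x : R ⧸ I.obj t)
      obtain ⟨x, rfl⟩ := Ideal.Quotient.mk_surjective x
      change Ideal.Quotient.mk _ (r ^ k * x) = 0
      exact Ideal.Quotient.eq_zero_iff_mem.2 (Ideal.mul_mem_right _ _ hk)
  let c := connD (FYmap S.g) (FYmap S.f) (FYmap_comp_zero (S := S)) (fun P _ => FY_shortExact hS P) n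
  have hc : ∀ t, IsIso (c.app ((localCohomology.ringModIdeals I).obj t)) := fun t =>
    connD_isIso _ _ _ _ n _ (hz t n) (hz t (n+1))
  let T : (localCohomology.diagram I n) ⋙ (evaluation _ _).obj S.X₃ ⟶
      (localCohomology.diagram I (n+1)) ⋙ (evaluation _ _).obj S.X₁ :=
    Functor.whiskerLeft (localCohomology.ringModIdeals I).op (NatTrans.leftOp c)
  have hT : ∀ t, IsIso (T.app t) := fun t => by
    have := hc t.unop
    change IsIso (c.app ((localCohomology.ringModIdeals I).obj t.unop)).unop
    infer_instance
  have : IsIso T := NatIso.isIso_of_isIso_app T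
  exact ⟨asIso T⟩
end P4d
end GG

namespace GG
open CategoryTheory CategoryTheory.Abelian CategoryTheory.Limits TensorProduct RingTheory.Sequence IsLocalRing
section P4e
variable {R : Type u} [CommRing R]

theorem FY_pres (H : ModuleCat.{u} R) : PreservesFiniteColimits (FY H) := by
  have : PreservesLimits ((linearYoneda R (ModuleCat.{u} R)).obj H ⋙ forget (ModuleCat.{u} R)) :=
    inferInstanceAs (PreservesLimits (yoneda.obj H))
  have : PreservesFiniteLimits ((linearYoneda R (ModuleCat.{u} R)).obj H) := by
    refine ⟨fun J _ _ => ?_⟩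
    exact preservesLimitsOfShape_of_reflects_of_preserves _ (forget (ModuleCat.{u} R))
  exact preservesFiniteColimits_rightOp _

/-- the ideal powers functor -/
abbrev JI (J : Ideal R) := localCohomology.idealPowersDiagram J

theorem lc_zero (J : Ideal R) (H : ModuleCat.{u} R) (hH : ∀ y : H, ∃ n, ∀ a ∈ J ^ n, a • y = 0) :
    Nonempty (((localCohomology J 0).obj H) ≅ H) := by
  have := FY_pres H
  let K := (localCohomology.ringModIdeals (JI J)).op ⋙ (FY H).leftOp
  let T : K ⟶ (localCohomology.diagram (JI J) 0) ⋙ (evaluation _ _).obj H :=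
    Functor.whiskerLeft (localCohomology.ringModIdeals (JI J)).op
      (NatTrans.leftOp (FY H).leftDerivedZeroIsoSelf.hom)
  have hT : ∀ t, IsIso (T.app t) := fun t => by
    change IsIso ((FY H).leftDerivedZeroIsoSelf.hom.app ((localCohomology.ringModIdeals (JI J)).obj t.unop)).unop
    infer_instance
  have : IsIso T := NatIso.isIso_of_isIso_app T
  let c : Cocone K :=
    { pt := H
      ι :=
        { app := fun t => ModuleCat.ofHom
            (X := ModuleCat.of R (R ⧸ J ^ t.unop.unop) ⟶ H) (Y := H)
            { toFun := fun f => f.hom (1 : R ⧸ J ^ t.unop.unop)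
              map_add' := fun _ _ => rfl
              map_smul' := fun _ _ => rfl }
          naturality := by
            intro s t w
            apply ModuleCat.hom_ext
            apply LinearMap.ext
            intro (f : ModuleCat.of R (R ⧸ J ^ s.unop.unop) ⟶ H)
            rfl } }
  have hbij : Function.Bijective (colimit.desc K c).hom := by
    constructor
    · rw [injective_iff_map_eq_zero]
      intro x hx
      have : PreservesFilteredColimitsOfSize.{0, 0} (forget (ModuleCat.{u} R)) :=
        preservesFilteredColimitsOfSize_shrink _
      obtain ⟨t, f, rfl⟩ := Concrete.colimit_exists_rep K x
      have h1 : (c.ι.app t) f = 0 := by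
        rw [← hx]
        have := colimit.ι_desc c t
        rw [← this]; rfl
      have h2 : (show ModuleCat.of R (R ⧸ J ^ t.unop.unop) ⟶ H from f) = 0 := by
        apply ModuleCat.hom_ext
        apply LinearMap.ext
        intro (z : R ⧸ J ^ t.unop.unop)
        obtain ⟨z, rfl⟩ := Ideal.Quotient.mk_surjective z
        have : (Ideal.Quotient.mk (J ^ t.unop.unop)) z = z • (1 : R ⧸ J ^ t.unop.unop) := by
          rw [Algebra.smul_def, mul_one]; rfl
        rw [this]
        erw [map_smul]
        have h1' : (show ModuleCat.of R (R ⧸ J ^ t.unop.unop) ⟶ H from f).hom (1 : R ⧸ J ^ t.unop.unop) = 0 := h1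
        erw [h1']
        simp
      have : f = 0 := h2
      rw [this, map_zero]
    · intro y
      obtain ⟨n, hn⟩ := hH y
      have hL : J ^ n ≤ LinearMap.ker (LinearMap.toSpanSingleton R H y) := fun a ha => hn a ha
      let f : ModuleCat.of R (R ⧸ J ^ n) ⟶ H := ModuleCat.ofHom
        ((J ^ n).liftQ (LinearMap.toSpanSingleton R H y) hL)
      refine ⟨(colimit.ι K (Opposite.op (Opposite.op n))).hom f, ?_⟩
      have := colimit.ι_desc c (Opposite.op (Opposite.op n))
      have h2 : (colimit.ι K (Opposite.op (Opposite.op n)) ≫ colimit.desc K c).hom f = y := by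
        rw [this]
        change ((J ^ n).liftQ (LinearMap.toSpanSingleton R H y) hL) (Submodule.Quotient.mk 1) = y
        rw [Submodule.liftQ_apply]; exact one_smul R y
      exact h2
  have hiso : IsIso (colimit.desc K c) := (ConcreteCategory.isIso_iff_bijective _).2 hbij
  exact ⟨colimitObjIsoColimitCompEvaluation _ _ ≪≫ HasColimit.isoOfNatIso (asIso T).symm ≪≫ asIso (colimit.desc K c)⟩

theorem lc_succ (J : Ideal R) {S : ShortComplex (ModuleCat.{u} R)} (hS : S.ShortExact) (r : R) (hr : r ∈ J)
    (hB : Function.Bijective fun b : S.X₂ => r • b) (n : ℕ) :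
    Nonempty ((localCohomology J (n+1)).obj S.X₁ ≅ (localCohomology J n).obj S.X₃) := by
  obtain ⟨e⟩ := diag_iso hS r hB (JI J) (fun t => ⟨t.unop, Ideal.pow_mem_pow hr _⟩) n
  exact ⟨colimitObjIsoColimitCompEvaluation _ _ ≪≫ HasColimit.isoOfNatIso e.symm ≪≫
    (colimitObjIsoColimitCompEvaluation _ _).symm⟩

theorem loc_bij (r : R) (N : Type u) [AddCommGroup N] [Module R N] :
    Function.Bijective fun b : (Localization.Away r ⊗[R] N) => r • b :=
  (Module.End.isUnit_iff _).1
    (IsLocalizedModule.map_units (TensorProduct.mk R (Localization.Away r) N 1) (⟨r, Submonoid.mem_powers r⟩ : Submonoid.powers r))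

theorem lc_Ht (J : Ideal R) (rs : List R) (hrs : ∀ r ∈ rs, r ∈ J) (N : ModuleCat.{u} R)
    (hw : IsWeaklyRegular N rs) (ht : ∀ y : Ht rs N, ∃ n, ∀ a ∈ J ^ n, a • y = 0) :
    Nonempty ((localCohomology J rs.length).obj N ≅ Ht rs N) := by
  induction rs generalizing N with
  | nil => exact lc_zero J N ht
  | cons r rs ih =>
    obtain ⟨e⟩ := ih (fun r hr => hrs r (by simp [hr])) _ (Dr_weaklyRegular r rs hw) ht
    obtain ⟨e'⟩ := lc_succ J (Dr_ses (N := N) r ((isWeaklyRegular_cons_iff _ _ _).1 hw).1).shortExact r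
      (hrs r (by simp)) (loc_bij r N) rs.length
    exact ⟨e' ≪≫ e⟩

theorem gidLE.congr {M N : Type u} [AddCommGroup M] [Module R M] [AddCommGroup N] [Module R N]
    (e : N ≃ₗ[R] M) {n : ℕ} (h : gidLE R M n) : gidLE R N n := by
  obtain ⟨G, d, ε, h1, h2, h3, h4, h5⟩ := h
  refine ⟨G, d, ε.comp e.toLinearMap, h1, h2.comp e.injective, ?_, h4, h5⟩
  rw [LinearMap.range_comp_of_range_eq_top _ (LinearMap.range_eq_top.2 e.surjective), h3]
end P4e
end GG

namespace GG
open CategoryTheory CategoryTheory.Abelian TensorProduct RingTheory.Sequence IsLocalRing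
section P5a
variable {R : Type u} [CommRing R]

theorem coresolution_of_cousin {F : ℕ → Set (PrimeSpectrum R)} {M : ModuleCat.{u} R}
    {P : ModuleCat.{u} R → Prop} (h : CousinResolves R F M P) {n : ℕ} (hF : ∀ i, n < i → F i = ∅) :
    CoresolutionLE R P M n := by
  obtain ⟨h1, h2, h3, h4⟩ := h
  refine ⟨fun i => ModuleCat.of R (cousinC R F M i),
    fun i => LinearMap.codRestrict _ (cousinD R F M i) (fun c => h1 (i+1) ⟨_, rfl⟩),
    LinearMap.codRestrict _ (cousinTheta R F M 0) (fun c => h1 0 ⟨_, rfl⟩), h4, ?_, ?_, ?_, ?_⟩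
  · intro x y hxy
    exact h2 (congrArg Subtype.val hxy)
  · rw [LinearMap.ker_codRestrict, h3 0]
    ext x
    constructor
    · rintro ⟨y, rfl⟩
      exact ⟨y, rfl⟩
    · rintro ⟨y, hy⟩
      exact ⟨y, Subtype.ext hy⟩
  · intro i
    rw [LinearMap.ker_codRestrict, h3 (i+1)]
    ext x
    constructor
    · rintro ⟨y, rfl⟩
      exact ⟨_, rfl⟩
    · rintro ⟨y, hy⟩
      obtain ⟨z, rfl⟩ := Submodule.mkQ_surjective _ y
      exact ⟨z, Subtype.ext hy⟩
  · intro i hi x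
    apply Subtype.ext
    funext p
    have h5 : ∀ q, q ∉ F i := fun q => by rw [hF i hi]; exact fun h => h
    exact absurd p.2.1 (h5 p.1)

theorem htM_le (M : Type u) [AddCommGroup M] [Module R M] {d : ℕ} (hd : mdim R M ≤ d) (p : PrimeSpectrum R) :
    htM R M p ≤ d := by
  refine iSup_le fun h => ?_
  have := (Order.height_le_krullDim (⟨p, h⟩ : ↥(Module.support R M))).trans hd
  exact_mod_cast this

theorem heightFiltration_empty (M : Type u) [AddCommGroup M] [Module R M] {d : ℕ} (hd : mdim R M ≤ d) (i : ℕ) (hi : d < i) :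
    heightFiltration R M i = ∅ := by
  ext p
  simp only [heightFiltration, Set.mem_ofPred_eq, Set.mem_empty_iff_false, iff_false, not_and, not_le]
  intro _
  exact (htM_le M hd p).trans_lt (by exact_mod_cast hi)

theorem mdim_self : mdim R R = ringKrullDim R := Module.supportDim_self_eq_ringKrullDim R

theorem gor_of_ggor [IsNoetherianRing R] {d : ℕ} (hd : ringKrullDim R = d)
    (h : IsGGorenstein R (ModuleCat.of R R)) : ID R R d := by
  have h1 := coresolution_of_cousin h.2.2 (n := d)
    (fun i hi => heightFiltration_empty R (by rw [mdim_self, hd]) i hi)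
  exact ID.of_gidLE_pd (s := 0) h1 (PD.zero_of_projective (inferInstanceAs (Module.Projective R R)))
end P5a
end GG

namespace GG
open CategoryTheory CategoryTheory.Abelian TensorProduct RingTheory.Sequence IsLocalRing
section P5b
variable {R : Type u} [CommRing R]
variable {A B C X Y N M : Type u} [AddCommGroup A] [Module R A] [AddCommGroup B] [Module R B]
    [AddCommGroup C] [Module R C] [AddCommGroup X] [Module R X] [AddCommGroup Y] [Module R Y]
    [AddCommGroup N] [Module R N] [AddCommGroup M] [Module R M]

variable (R) in
/-- `Ext^{>k}(Inj, X) = 0` -/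
def Ok (k : ℕ) (X : Type u) [AddCommGroup X] [Module R X] : Prop :=
  ∀ (E : Type u) [AddCommGroup E] [Module R E], Module.Injective R E → ∀ i, k < i → EV R E X i

theorem Wg.wl (h : Wg R X) : Wl R X := by
  obtain ⟨P, hP, Z, hZ, he⟩ := h
  exact ⟨P, fun Y hY => (hP Y hY).2, Z, hZ, he⟩

theorem PD.injective' [IsNoetherianRing R] {n : ℕ} (hR : ID R R n) (hE : Module.Injective R X) : PD R X n := by
  intro N _ _ i hi
  obtain ⟨H, P, f, g, hs, hP, hH⟩ := gid_key (gidLE_of_gor hR N)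
  exact hs.cov3 (hP _ _ hi) (hH.wl.ev (PD.injective hR) i)

theorem Ok.injective {n : ℕ} (hX : ID R X n) (h : Ok R 0 X) : Module.Injective R X := by
  induction n generalizing X with
  | zero => exact hX.injective
  | succ n ih =>
    obtain ⟨I, C, _, _, _, _, f, g, hI, hs⟩ := exists_inj_ses R X
    have hC : Module.Injective R C := ih (hs.id3 ((ID.zero_of_injective hI).mono (by omega)) hX) (by
      intro E _ _ hE i hi
      obtain ⟨i, rfl⟩ := Nat.exists_eq_succ_of_ne_zero hi.ne'
      exact hs.cov3 (EV.of_injective _) (h E hE _ (by omega)))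
    obtain ⟨r, hr⟩ := hs.extend_of_ev (h C hC 1 (by omega)) LinearMap.id
    exact (ID.retract (ID.zero_of_injective hI) f r hr).injective

theorem Wl.of_ok [IsNoetherianRing R] {n : ℕ} (hR : ID R R n) (h : Ok R 0 X) : Wl R X := by
  obtain ⟨H, P, f, g, hs, hP, hH⟩ := gid_key (gidLE_of_gor hR X)
  refine hH.wl.cons hs (Ok.injective hP ?_)
  intro E _ _ hE i hi
  obtain ⟨i, rfl⟩ := Nat.exists_eq_succ_of_ne_zero hi.ne'
  exact hs.cov2 (hH.wl.ev (PD.injective hR) i) (h E hE _ hi)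

theorem Wl.ok [IsNoetherianRing R] {n : ℕ} (hR : ID R R n) (h : Wl R X) : Ok R 0 X := by
  intro E _ _ hE i hi
  obtain ⟨i, rfl⟩ := Nat.exists_eq_succ_of_ne_zero hi.ne'
  exact h.ev (PD.injective hR) i

theorem Ok.step {f : A →ₗ[R] B} {g : B →ₗ[R] C} (hs : SES f g) {k : ℕ} (hA : Ok R (k+1) A) (hB : Ok R 0 B) :
    Ok R k C := by
  intro E _ _ hE i hi
  exact hs.cov3 (hB E hE i (by omega)) (hA E hE (i+1) (by omega))

theorem Ok.of_gor [IsNoetherianRing R] {n : ℕ} (hR : ID R R n) : Ok R n X := by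
  intro E _ _ hE i hi
  exact PD.injective' hR hE _ _ hi
end P5b
end GG

namespace GG
open CategoryTheory CategoryTheory.Abelian TensorProduct RingTheory.Sequence IsLocalRing
section P5c
variable {R : Type u} [CommRing R] {M : Type u} [AddCommGroup M] [Module R M]

theorem ev_coheight [IsNoetherianRing R] [IsLocalRing R] [Module.Finite R M] {d : ℕ}
    (h : ∀ i < d, EV R (R ⧸ maximalIdeal R) M i) (c : ℕ) :
    ∀ (q : PrimeSpectrum R), Order.coheight q ≤ c → ∀ i, i + c < d → EV R (R ⧸ q.asIdeal) M i := by
  induction c with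
  | zero =>
    intro q hq i hi
    by_cases hqm : q.asIdeal = maximalIdeal R
    · rw [hqm]; exact h i (by omega)
    · refine EV.nakayama q hqm fun q' hq' => ?_
      have h1 := (Order.coheight_add_one_le hq').trans hq
      simp at h1
  | succ c ih =>
    intro q hq i hi
    by_cases hqm : q.asIdeal = maximalIdeal R
    · rw [hqm]; exact h i (by omega)
    · refine EV.nakayama q hqm fun q' hq' => ih q' ?_ _ (by omega)
      have h1 := (Order.coheight_add_one_le hq').trans hq
      rw [Nat.cast_add, Nat.cast_one] at h1
      exact (ENat.add_le_add_iff_right (by simp)).1 h1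

theorem height_add_coheight_le {α : Type*} [Preorder α] {d : ℕ} (h : Order.krullDim α ≤ d) (a : α) :
    Order.height a + Order.coheight a ≤ d := by
  haveI : Nonempty α := ⟨a⟩
  rw [Order.krullDim_eq_iSup_height_add_coheight_of_nonempty] at h
  have h2 : (⨆ a : α, Order.height a + Order.coheight a) ≤ (d : ℕ∞) := by exact_mod_cast h
  exact (le_iSup (fun a : α => Order.height a + Order.coheight a) a).trans h2

/-- part A: for `M` MCM. -/
theorem ev_of_mcm [IsNoetherianRing R] [IsLocalRing R] [Module.Finite R M] [Nontrivial M] {d : ℕ}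
    (hd : ringKrullDim R = d) (hM : mdepth R M = d) (q : PrimeSpectrum R) (i : ℕ)
    (hi : (i : ℕ∞) < Order.height q) : EV R (R ⧸ q.asIdeal) M i := by
  obtain ⟨rs, hl, hm, hr⟩ := exists_regular_of_mdepth hM
  have h0 : ∀ i < d, EV R (R ⧸ maximalIdeal R) M i := by
    rw [← hl]
    refine ModuleCat.subsingleton_ext_of_exists_isRegular (maximalIdeal R) (ModuleCat.of R (R ⧸ maximalIdeal R)) ?_ (ModuleCat.of R M) ?_ rs hm hr
    · change Module.support R (R ⧸ maximalIdeal R) ⊆ _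
      rw [Module.support_eq_zeroLocus, Ideal.annihilator_quotient]
    · refine lt_top_iff_ne_top.2 fun h => ?_
      have := Submodule.eq_bot_of_le_smul_of_le_jacobson_bot (maximalIdeal R) (⊤ : Submodule R M) Module.Finite.fg_top h.ge
        (IsLocalRing.maximalIdeal_le_jacobson _)
      exact top_ne_bot this
  have h1 := height_add_coheight_le (hd.le : Order.krullDim (PrimeSpectrum R) ≤ d) q
  obtain ⟨c, hc⟩ := ENat.ne_top_iff_exists.1 (ne_top_of_le_ne_top (ENat.natCast_ne_top d) ((le_add_left le_rfl).trans h1))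
  obtain ⟨b, hb⟩ := ENat.ne_top_iff_exists.1 (ne_top_of_le_ne_top (ENat.natCast_ne_top d) ((le_add_right le_rfl).trans h1))
  rw [← hc, ← hb] at h1
  rw [← hb] at hi
  norm_cast at h1 hi
  exact ev_coheight h0 c q hc.ge i (by omega)
end P5c
end GG

namespace GG
open CategoryTheory CategoryTheory.Abelian TensorProduct RingTheory.Sequence IsLocalRing
section P5d
variable {R : Type u} [CommRing R] {K : Type u} [AddCommGroup K] [Module R K]
variable {F S : Set (PrimeSpectrum R)}

/-- If `k/1 ≠ 0` in `K_p`, then every annihilator of `k` is in `p`. -/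
theorem mkL_eq_zero {p : PrimeSpectrum R} {k : K} :
    LocalizedModule.mkLinearMap p.asIdeal.primeCompl K k = 0 ↔ ∃ s : R, s ∉ p.asIdeal ∧ s • k = 0 := by
  rw [IsLocalizedModule.eq_zero_iff p.asIdeal.primeCompl]
  constructor
  · rintro ⟨s, hs⟩
    exact ⟨s.1, s.2, hs⟩
  · rintro ⟨s, h1, h2⟩
    exact ⟨⟨s, h1⟩, h2⟩

theorem mem_supp_of_ann {q : PrimeSpectrum R} {k : K} (h : ∀ s : R, s • k = 0 → s ∈ q.asIdeal) :
    q ∈ Module.support R K :=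
  Module.mem_support_iff'.2 ⟨k, fun r hr h' => hr (h r h')⟩

theorem lemL (hF : Module.support R K ⊆ F) {p : PrimeSpectrum R}
    (hp : ∀ q ∈ F, q ≤ p → q = p) (k : K) {x : R} (hx : x ∈ p.asIdeal) :
    ∃ s j, s ∉ p.asIdeal ∧ (x ^ j * s) • k = 0 := by
  by_contra hcon
  push Not at hcon
  have hdis : Disjoint ((LinearMap.ker (LinearMap.toSpanSingleton R K k) : Ideal R) : Set R)
      ((Submonoid.powers x ⊔ p.asIdeal.primeCompl : Submonoid R) : Set R) := by
    rw [Set.disjoint_left]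
    intro a ha hb
    obtain ⟨y, ⟨j, rfl⟩, s, hs, rfl⟩ := Submonoid.mem_sup.1 hb
    exact hcon s j hs ha
  obtain ⟨q, hq, h1, h2⟩ := Ideal.exists_le_prime_disjoint _ _ hdis
  rw [Set.disjoint_left] at h2
  have h3 : (⟨q, hq⟩ : PrimeSpectrum R) ∈ F := hF (mem_supp_of_ann (k := k) fun s hs => h1 hs)
  have h4 := hp _ h3 (fun a ha => by
    by_contra h
    exact h2 ha (Submonoid.mem_sup_right (show a ∈ p.asIdeal.primeCompl from h)))
  have h5 : q = p.asIdeal := congrArg PrimeSpectrum.asIdeal h4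
  exact h2 (show x ∈ q from h5 ▸ hx) (Submonoid.mem_sup_left (Submonoid.mem_powers x))

theorem min_ann (hF : Module.support R K ⊆ F) {p : PrimeSpectrum R}
    (hp : ∀ q ∈ F, q ≤ p → q = p) {k : K}
    (hk : LocalizedModule.mkLinearMap p.asIdeal.primeCompl K k ≠ 0) :
    p.asIdeal ∈ Ideal.minimalPrimes (LinearMap.ker (LinearMap.toSpanSingleton R K k)) := by
  refine ⟨⟨p.2, ?_⟩, ?_⟩
  · intro s hs
    by_contra h
    exact hk (mkL_eq_zero.2 ⟨s, h, hs⟩)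
  · rintro q ⟨hq, h1⟩ h2
    have h3 : (⟨q, hq⟩ : PrimeSpectrum R) ∈ F := hF (mem_supp_of_ann (k := k) fun s hs => h1 hs)
    have h4 := hp _ h3 h2
    have h5 : q = p.asIdeal := congrArg PrimeSpectrum.asIdeal h4
    exact h5.ge

theorem theta_mem [IsNoetherianRing R] (hF : Module.support R K ⊆ F) (hp : ∀ p ∈ S, ∀ q ∈ F, q ≤ p → q = p) (k : K) :
    thetaFull R S K k ∈ finSupp R S K := by
  change {p : S | thetaFull R S K k p ≠ 0}.Finite
  refine Set.Finite.of_finite_image (f := fun p : S => p.1.asIdeal) ?_ ?_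
  · refine (Ideal.finite_minimalPrimes_of_isNoetherianRing R (LinearMap.ker (LinearMap.toSpanSingleton R K k) : Ideal R)).subset ?_
    rintro _ ⟨p, h, rfl⟩
    exact min_ann hF (hp p.1 p.2) h
  · intro p _ q _ h
    exact Subtype.ext (PrimeSpectrum.ext h)

theorem hom_of_ann {q : PrimeSpectrum R} (h : EV R (R ⧸ q.asIdeal) K 0) {k : K}
    (hk : ∀ s ∈ q.asIdeal, s • k = 0) : k = 0 := by
  rw [EV.zero_iff] at h
  have := h (Submodule.liftQ q.asIdeal (LinearMap.toSpanSingleton R K k) hk)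
  have := LinearMap.congr_fun this (Submodule.mkQ _ 1)
  change (1 : R) • k = 0 at this
  rwa [one_smul] at this

theorem ass_ann [IsNoetherianRing R] {k : K} (hk : k ≠ 0) :
    ∃ (q : PrimeSpectrum R) (r : R), ∀ s, s ∈ q.asIdeal ↔ s • (r • k) = 0 := by
  obtain ⟨q, hq, -⟩ := exists_le_isAssociatedPrime_of_isNoetherianRing R
    (⟨k, Submodule.mem_span_singleton_self k⟩ : Submodule.span R {k}) (by simpa using hk)
  obtain ⟨h1, ⟨y, hy⟩, h2⟩ := isAssociatedPrime_iff.1 hq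
  obtain ⟨r, rfl⟩ := Submodule.mem_span_singleton.1 hy
  refine ⟨⟨q, h1⟩, r, fun s => ?_⟩
  simp only [h2]
  rw [Submodule.mem_colon_singleton, Submodule.mem_bot]
  exact Subtype.ext_iff

theorem theta_inj [IsNoetherianRing R] (hF : Module.support R K ⊆ F)
    (h : ∀ q ∈ F, q ∉ S → EV R (R ⧸ q.asIdeal) K 0) : Function.Injective (thetaFull R S K) := by
  refine (injective_iff_map_eq_zero _).2 fun k hk => ?_
  by_contra hk0
  obtain ⟨q, r, hq⟩ := ass_ann (R := R) hk0
  have hr : r • k ≠ 0 := fun h => q.2.ne_top ((Ideal.eq_top_iff_one _).2 ((hq 1).2 (by rw [h, smul_zero])))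
  have hqF : q ∈ F := hF (mem_supp_of_ann (k := r • k) fun s => (hq s).2)
  by_cases hqS : q ∈ S
  · have := congrFun hk ⟨q, hqS⟩
    obtain ⟨s, h1, h2⟩ := mkL_eq_zero.1 (show LocalizedModule.mkLinearMap q.asIdeal.primeCompl K k = 0 from this)
    exact h1 ((hq s).2 (by rw [smul_comm, h2, smul_zero]))
  · exact hr (hom_of_ann (h q hqF hqS) fun s => (hq s).1)

theorem loc_zero [IsNoetherianRing R] (hF : Module.support R K ⊆ F) {p : PrimeSpectrum R}
    (hp : ∀ q ∈ F, q ≤ p → q = p) (h : EV R (R ⧸ p.asIdeal) K 0) :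
    ∀ k : K, LocalizedModule.mkLinearMap p.asIdeal.primeCompl K k = 0 := by
  intro k
  by_contra hk
  have h1 := min_ann hF hp hk
  have h2 : (LinearMap.ker (LinearMap.toSpanSingleton R K k) : Ideal R) = Module.annihilator R (Submodule.span R {k}) := by
    ext s
    rw [← Submodule.annihilator, Submodule.mem_annihilator_span_singleton]
    rfl
  rw [h2] at h1
  have h3 := Module.associatedPrimes.minimalPrimes_annihilator_subset_associatedPrimes R (Submodule.span R {k}) h1
  obtain ⟨h4, ⟨y, hy⟩, h5⟩ := isAssociatedPrime_iff.1 h3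
  have h6 : ∀ s ∈ p.asIdeal, s • y = 0 := by
    intro s hs
    rw [h5, Submodule.mem_colon_singleton, Submodule.mem_bot] at hs
    exact congrArg Subtype.val hs
  have h7 := hom_of_ann h h6
  subst h7
  refine h4.ne_top ((Ideal.eq_top_iff_one _).2 ?_)
  rw [h5, Submodule.mem_colon_singleton, Submodule.mem_bot]
  exact Subtype.ext (smul_zero _)

theorem loc_surj (p : PrimeSpectrum R) (z : LocalizedModule p.asIdeal.primeCompl K) :
    ∃ (s : R) (k : K), s ∉ p.asIdeal ∧ s • z = LocalizedModule.mkLinearMap p.asIdeal.primeCompl K k := by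
  obtain ⟨⟨k, s⟩, h⟩ := IsLocalizedModule.surj p.asIdeal.primeCompl (LocalizedModule.mkLinearMap p.asIdeal.primeCompl K) z
  exact ⟨s.1, k, s.2, h⟩

theorem locP_bij {p : PrimeSpectrum R} {x : R} (hx : x ∉ p.asIdeal) :
    Function.Bijective fun z : LocalizedModule p.asIdeal.primeCompl K => x • z :=
  (Module.End.isUnit_iff _).1 (IsLocalizedModule.map_units (LocalizedModule.mkLinearMap p.asIdeal.primeCompl K) (⟨x, hx⟩ : p.asIdeal.primeCompl))

variable (R S K) in
noncomputable def thetaF [IsNoetherianRing R] (h : ∀ k, thetaFull R S K k ∈ finSupp R S K) : K →ₗ[R] finSupp R S K :=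
  LinearMap.codRestrict _ (thetaFull R S K) h

theorem cousin_ses [IsNoetherianRing R] (h : ∀ k, thetaFull R S K k ∈ finSupp R S K)
    (hi : Function.Injective (thetaFull R S K)) :
    SES (thetaF R K S h) (Submodule.mkQ (Submodule.comap (finSupp R S K).subtype (LinearMap.range (thetaFull R S K)))) := by
  refine ⟨fun x y hxy => hi (congrArg Subtype.val hxy), fun x => ?_, Submodule.mkQ_surjective _⟩
  rw [Submodule.mkQ_apply, Submodule.Quotient.mk_eq_zero]
  constructor
  · rintro ⟨y, hy⟩
    exact ⟨y, Subtype.ext hy⟩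
  · rintro ⟨y, hy⟩
    exact ⟨y, congrArg Subtype.val hy⟩

theorem finSupp_kill {q : PrimeSpectrum R} (y : finSupp R S K)
    (h : ∀ p : S, y.1 p ≠ 0 → ∃ s, s ∉ q.asIdeal ∧ s • y.1 p = 0) : ∃ s, s ∉ q.asIdeal ∧ s • y = 0 := by
  classical
  have hf : {p : S | y.1 p ≠ 0}.Finite := y.2
  have h' : ∀ p : S, ∃ s, s ∉ q.asIdeal ∧ s • y.1 p = 0 := by
    intro p
    by_cases hp : y.1 p = 0
    · exact ⟨1, fun h1 => q.2.ne_top ((Ideal.eq_top_iff_one _).2 h1), by rw [hp, smul_zero]⟩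
    · exact h p hp
  choose s hs1 hs2 using h'
  refine ⟨∏ p ∈ hf.toFinset, s p, fun hmem => ?_, ?_⟩
  · obtain ⟨p, _, hp⟩ := (Ideal.IsPrime.prod_mem_iff (hp := q.2)).1 hmem
    exact hs1 p hp
  · apply Subtype.ext
    funext p
    change (∏ p ∈ hf.toFinset, s p) • y.1 p = 0
    by_cases hp : y.1 p = 0
    · rw [hp, smul_zero]
    · rw [← Finset.prod_erase_mul _ _ (hf.mem_toFinset.2 (show p ∈ {p : S | y.1 p ≠ 0} from hp)), mul_smul, hs2, smul_zero]

theorem supp_next [IsNoetherianRing R] (hF : Module.support R K ⊆ F) (hp : ∀ p ∈ S, ∀ q ∈ F, q ≤ p → q = p) (hSF : S ⊆ F) :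
    Module.support R (nextKType R S K) ⊆ F \ S := by
  intro q hq
  obtain ⟨z, hz⟩ := Module.mem_support_iff'.1 hq
  obtain ⟨y, rfl⟩ := Submodule.mkQ_surjective _ z
  have hqF : q ∈ F := by
    by_contra hqF
    obtain ⟨s, h1, h2⟩ := finSupp_kill (q := q) y (fun p _ => by
      obtain ⟨s, k, h1, h2⟩ := loc_surj p.1 (y.1 p)
      have h3 : q ∉ Module.support R K := fun h => hqF (hF h)
      rw [Module.notMem_support_iff'] at h3
      obtain ⟨t, ht, ht'⟩ := h3 k
      refine ⟨t, ht, (locP_bij (K := K) h1).1 ?_⟩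
      change s • t • y.1 p = s • 0
      rw [smul_comm, h2, ← map_smul, ht', map_zero, smul_zero])
    refine hz s h1 ?_
    rw [← map_smul, h2, map_zero]
  refine ⟨hqF, fun hqS => ?_⟩
  obtain ⟨s, k, h1, h2⟩ := loc_surj q (y.1 ⟨q, hqS⟩)
  obtain ⟨t, ht, ht'⟩ := finSupp_kill (q := q) (s • y - ⟨_, theta_mem hF hp k⟩) (fun p hp0 => by
    have hpq : p.1 ≠ q := by
      rintro hpq
      obtain ⟨p, hpS⟩ := p
      change p = q at hpq
      subst hpq
      apply hp0
      change s • y.1 ⟨p, hpS⟩ - thetaFull R S K k ⟨p, hpS⟩ = 0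
      rw [h2, sub_eq_zero]; rfl
    have hle : ¬ p.1 ≤ q := fun h => hpq (hp q hqS _ (hSF p.2) h)
    obtain ⟨x, hx, hxq⟩ := SetLike.not_le_iff_exists.1 (show ¬ p.1.asIdeal ≤ q.asIdeal from hle)
    obtain ⟨a, k', ha, hk'⟩ := loc_surj p.1 ((s • y - ⟨_, theta_mem hF hp k⟩ : finSupp R S K).1 p)
    obtain ⟨b, j, hb, hj⟩ := lemL hF (hp p.1 p.2) k' hx
    refine ⟨x ^ j, fun h => hxq (q.2.mem_of_pow_mem j h), (locP_bij (K := K) (p := p.1) (x := b * a) ?_).1 ?_⟩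
    · exact fun h => (p.1.2.mem_or_mem h).elim hb ha
    · beta_reduce
      rw [smul_zero, smul_comm, mul_smul, hk', ← map_smul, ← map_smul, ← mul_smul, hj, map_zero])
  refine hz (t * s) (fun h => (q.2.mem_or_mem h).elim ht h1) ?_
  rw [← map_smul, Submodule.mkQ_apply, Submodule.Quotient.mk_eq_zero]
  refine ⟨t • k, ?_⟩
  rw [smul_sub, sub_eq_zero, ← mul_smul] at ht'
  rw [ht', map_smul]; rfl
end P5d
end GG

namespace GG
open CategoryTheory CategoryTheory.Abelian TensorProduct RingTheory.Sequence IsLocalRing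
section P5e
variable {R : Type u} [CommRing R]

section
variable (S : Set (PrimeSpectrum R)) (K : Type u) [AddCommGroup K] [Module R K]
open scoped Classical in
noncomputable def dsEquiv :
    DirectSum S (fun p => LocalizedModule p.1.asIdeal.primeCompl K) ≃ₗ[R] finSupp R S K :=
  LinearEquiv.ofBijective
    { toFun := fun x => ⟨fun p => x p, (DFinsupp.finite_support x)⟩
      map_add' := fun x y => rfl
      map_smul' := fun x y => rfl }
    ⟨fun x y h => DFinsupp.ext fun p => congrFun (congrArg Subtype.val h) p, fun y => by
      have hf : {p : S | y.1 p ≠ 0}.Finite := y.2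
      refine ⟨DFinsupp.mk hf.toFinset (fun p => y.1 p), Subtype.ext (funext fun p => ?_)⟩
      change (DFinsupp.mk hf.toFinset (fun p => y.1 p) : DirectSum S (fun p => LocalizedModule p.1.asIdeal.primeCompl K)) p = y.1 p
      rw [DFinsupp.mk_apply]
      split_ifs with h
      · rfl
      · rw [hf.mem_toFinset] at h
        by_contra h'
        exact h (fun h'' => h' h''.symm)⟩

variable {S K} in
theorem ev_finSupp [IsNoetherianRing R] {q : PrimeSpectrum R} {i : ℕ}
    (h : ∀ p ∈ S, EV R (R ⧸ q.asIdeal) (LocalizedModule p.asIdeal.primeCompl K) i) :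
    EV R (R ⧸ q.asIdeal) (finSupp R S K) i :=
  (EV.directSum _ (fun p : S => h p.1 p.2)).congr_right (dsEquiv S K)

variable {K} in
theorem ev_loc {q p : PrimeSpectrum R} (h : ¬ q ≤ p) (i : ℕ) :
    EV R (R ⧸ q.asIdeal) (LocalizedModule p.asIdeal.primeCompl K) i := by
  obtain ⟨x, hx, hxq⟩ := SetLike.not_le_iff_exists.1 (show ¬ q.asIdeal ≤ p.asIdeal from h)
  refine EV.of_smul x 1 ?_ (locP_bij hxq) i
  intro y
  obtain ⟨y, rfl⟩ := Submodule.mkQ_surjective _ y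
  rw [← map_smul, Submodule.mkQ_apply, Submodule.Quotient.mk_eq_zero, pow_one, smul_eq_mul]
  exact q.asIdeal.mul_mem_right _ hx

variable {K} in
theorem loc_subsingleton {p : PrimeSpectrum R} (h : ∀ k : K, LocalizedModule.mkLinearMap p.asIdeal.primeCompl K k = 0) :
    Subsingleton (LocalizedModule p.asIdeal.primeCompl K) := by
  refine ⟨fun a b => ?_⟩
  suffices ∀ z : LocalizedModule p.asIdeal.primeCompl K, z = 0 by rw [this a, this b]
  intro z
  obtain ⟨s, k, h1, h2⟩ := loc_surj p z
  exact (locP_bij (K := K) h1).1 (by beta_reduce; rw [h2, h k, smul_zero])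
end

section
variable (M : Type u) [AddCommGroup M] [Module R M]

variable {M} in
theorem htM_eq {p : PrimeSpectrum R} (h : p ∈ Module.support R M) :
    htM R M p = Order.height (⟨p, h⟩ : ↥(Module.support R M)) := by
  rw [htM, iSup_pos h]

theorem htM_le_height (p : PrimeSpectrum R) : htM R M p ≤ Order.height p :=
  iSup_le fun h => Order.height_le_height_apply_of_strictMono (Subtype.val : Module.support R M → _)
    (fun _ _ h => h) _

theorem hf_anti (n : ℕ) : heightFiltration R M (n+1) ⊆ heightFiltration R M n :=
  fun p hp => ⟨hp.1, le_trans (by exact_mod_cast Nat.le_succ n) hp.2⟩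

theorem hf_diff {n : ℕ} {p : PrimeSpectrum R} (hp : p ∈ heightFiltration R M n \ heightFiltration R M (n+1)) :
    htM R M p = n := by
  refine le_antisymm ?_ hp.1.2
  by_contra h
  exact hp.2 ⟨hp.1.1, by rw [Nat.cast_add, Nat.cast_one]; exact Order.add_one_le_of_lt (not_le.1 h)⟩

theorem hf_min {n : ℕ} {p : PrimeSpectrum R} (hp : p ∈ heightFiltration R M n \ heightFiltration R M (n+1)) :
    ∀ q ∈ heightFiltration R M n, q ≤ p → q = p := by
  intro q hq hle
  by_contra hne
  have h1 := hf_diff M hp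
  rw [htM_eq hp.1.1] at h1
  have h2 := hq.2
  rw [htM_eq hq.1] at h2
  have h3 : (⟨q, hq.1⟩ : ↥(Module.support R M)) < ⟨p, hp.1.1⟩ := lt_of_le_of_ne hle fun h => hne (congrArg Subtype.val h)
  have h4 := Order.height_add_one_le h3
  rw [h1] at h4
  have h5 : ((n + 1 : ℕ) : ℕ∞) ≤ n := by
    rw [Nat.cast_add, Nat.cast_one]; exact (add_le_add_left h2 1).trans h4
  norm_cast at h5
  omega
end

variable [IsNoetherianRing R] {M : ModuleCat.{u} R}

theorem cousin_main (hM : ∀ (q : PrimeSpectrum R) (i : ℕ), (i : ℕ∞) < Order.height q → EV R (R ⧸ q.asIdeal) M i) (n : ℕ) :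
    Module.support R (cousinK R (heightFiltration R M) M n) ⊆ heightFiltration R M n ∧
    (∀ (q : PrimeSpectrum R) (i : ℕ), ((i + n : ℕ) : ℕ∞) < Order.height q →
      EV R (R ⧸ q.asIdeal) (cousinK R (heightFiltration R M) M n) i) := by
  induction n with
  | zero => exact ⟨fun p hp => ⟨hp, by simp⟩, fun q i hi => hM q i hi⟩
  | succ n ih =>
    obtain ⟨h1, h2⟩ := ih
    have hm : ∀ p ∈ heightFiltration R M n \ heightFiltration R M (n+1), ∀ q ∈ heightFiltration R M n, q ≤ p → q = p :=
      fun p hp => hf_min M hp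
    refine ⟨(supp_next h1 hm Set.sdiff_subset).trans ?_, ?_⟩
    · rintro p ⟨hp, hp'⟩
      by_contra h
      exact hp' ⟨hp, h⟩
    · intro q i hi
      have hs := cousin_ses (theta_mem h1 hm) (theta_inj h1 fun q hq hq' => h2 q 0 (by
        have : q ∈ heightFiltration R M (n+1) := by by_contra h; exact hq' ⟨hq, h⟩
        refine lt_of_lt_of_le ?_ (this.2.trans (htM_le_height _ _))
        norm_cast; omega))
      refine hs.cov3 (ev_finSupp fun p hp => ?_) (h2 q (i+1) (by convert hi using 2; omega))
      by_cases hpn : (n : ℕ∞) < Order.height p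
      · have := loc_subsingleton (loc_zero h1 (hm p hp) (h2 p 0 (by rwa [zero_add])))
        exact EV.of_subsingleton_right i
      · refine ev_loc (fun hle => hpn ?_) i
        refine lt_of_lt_of_le ?_ ((lt_of_lt_of_le hi (Order.height_mono hle)).le)
        norm_cast; omega

theorem cousin_theta (hM : ∀ (q : PrimeSpectrum R) (i : ℕ), (i : ℕ∞) < Order.height q → EV R (R ⧸ q.asIdeal) M i) (n : ℕ) :
    (∀ k, thetaFull R (heightFiltration R M n \ heightFiltration R M (n+1)) (cousinK R (heightFiltration R M) M n) k ∈ finSupp R _ _) ∧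
    Function.Injective (thetaFull R (heightFiltration R M n \ heightFiltration R M (n+1)) (cousinK R (heightFiltration R M) M n)) := by
  obtain ⟨h1, h2⟩ := cousin_main hM n
  exact ⟨theta_mem h1 (fun p hp => hf_min M hp), theta_inj h1 fun q hq hq' => h2 q 0 (by
        have : q ∈ heightFiltration R M (n+1) := by by_contra h; exact hq' ⟨hq, h⟩
        refine lt_of_lt_of_le ?_ (this.2.trans (htM_le_height _ _))
        norm_cast; omega)⟩

theorem cousin_resolves (hM : ∀ (q : PrimeSpectrum R) (i : ℕ), (i : ℕ∞) < Order.height q → EV R (R ⧸ q.asIdeal) M i)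
    {P : ModuleCat.{u} R → Prop} (hP : ∀ n, P (ModuleCat.of R (cousinC R (heightFiltration R M) M n))) :
    CousinResolves R (heightFiltration R M) M P := by
  refine ⟨fun n => ?_, (cousin_theta hM 0).2, fun n => ?_, hP⟩
  · rintro _ ⟨k, rfl⟩
    exact (cousin_theta hM n).1 k
  · have h := (cousin_theta hM (n+1)).2
    ext x
    have h0 := map_zero (thetaFull R (heightFiltration R M (n+1) \ heightFiltration R M (n+1+1)) (cousinK R (heightFiltration R M) M (n+1)))
    constructor
    · intro hx
      exact (Submodule.Quotient.mk_eq_zero _).1 (h (Eq.trans hx h0.symm))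
    · intro hx
      exact (congrArg (thetaFull R (heightFiltration R M (n+1) \ heightFiltration R M (n+1+1)) (cousinK R (heightFiltration R M) M (n+1))) ((Submodule.Quotient.mk_eq_zero _).2 hx)).trans h0
end P5e
end GG

namespace GG
open CategoryTheory CategoryTheory.Abelian TensorProduct RingTheory.Sequence IsLocalRing
section P5f
variable {R : Type u} [CommRing R] [IsLocalRing R] [IsNoetherianRing R]

theorem residue_inj {X : Type u} [AddCommGroup X] [Module R X] {f : (R ⧸ maximalIdeal R) →ₗ[R] X} (hf : f ≠ 0) :
    Function.Injective f := by
  refine (injective_iff_map_eq_zero _).2 fun a ha => ?_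
  obtain ⟨a, rfl⟩ := Ideal.Quotient.mk_surjective a
  rw [Ideal.Quotient.eq_zero_iff_mem]
  by_contra h
  have hu : IsUnit a := by simpa using h
  apply hf
  have h1 : f 1 = 0 := by
    have : f (Ideal.Quotient.mk _ a) = a • f 1 := by rw [← map_smul]; congr 1; rw [Algebra.smul_def, mul_one]; rfl
    rw [this] at ha
    exact (hu.smul_eq_zero).1 ha
  ext
  exact h1

theorem exists_max_regular {n : ℕ} (hn : ringKrullDim R = n) :
    ∃ rs : List R, (∀ r ∈ rs, r ∈ maximalIdeal R) ∧ IsRegular R rs ∧ rs.length ≤ n ∧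
      ∃ f : (R ⧸ maximalIdeal R) →ₗ[R] (R ⧸ (Ideal.ofList rs • ⊤ : Submodule R R)), Function.Injective f := by
  let T : Set ℕ := {l | ∃ rs : List R, rs.length = l ∧ (∀ r ∈ rs, r ∈ maximalIdeal R) ∧ IsRegular R rs}
  have hb : ∀ l ∈ T, l ≤ n := by
    rintro _ ⟨rs, rfl, hm, hr⟩
    have h := ringKrullDim_add_length_eq_ringKrullDim_of_isRegular rs hr
    rw [hn] at h
    have hnt : Nontrivial (R ⧸ Ideal.ofList rs) := by
      refine Ideal.Quotient.nontrivial_iff.2 fun h => ?_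
      exact hr.2 (by rw [h]; simp)
    have h0 : (0 : WithBot ℕ∞) ≤ ringKrullDim (R ⧸ Ideal.ofList rs) := ringKrullDim_nonneg_of_nontrivial
    have : (rs.length : WithBot ℕ∞) ≤ n := by
      rw [← h]; exact le_add_of_nonneg_left h0
    exact_mod_cast this
  have hmem : sSup T ∈ T := Nat.sSup_mem ⟨0, [], rfl, by simp, IsRegular.nil _ _⟩ ⟨n, hb⟩
  have hle := hb _ hmem
  obtain ⟨rs, hl, hm, hr⟩ := hmem
  refine ⟨rs, hm, hr, by omega, ?_⟩
  by_contra hcon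
  push Not at hcon
  have hnt : Nontrivial (R ⧸ (Ideal.ofList rs • ⊤ : Submodule R R)) := Submodule.Quotient.nontrivial_iff.2 hr.2.symm
  have hE : EV R (R ⧸ maximalIdeal R) (R ⧸ (Ideal.ofList rs • ⊤ : Submodule R R)) 0 := by
    rw [EV.zero_iff]
    intro f
    by_contra hf
    exact hcon f (residue_inj hf)
  obtain ⟨ts, ht1, ht2, ht3⟩ := ModuleCat.exists_isRegular_of_exists_subsingleton_ext (maximalIdeal R) 1
    (ModuleCat.of R (R ⧸ (Ideal.ofList rs • ⊤ : Submodule R R))) (by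
      refine lt_top_iff_ne_top.2 fun h => ?_
      have := Submodule.eq_bot_of_le_smul_of_le_jacobson_bot (maximalIdeal R) (⊤ : Submodule R (R ⧸ (Ideal.ofList rs • ⊤ : Submodule R R))) Module.Finite.fg_top h.ge
        (IsLocalRing.maximalIdeal_le_jacobson _)
      exact top_ne_bot this) (ModuleCat.of R (R ⧸ maximalIdeal R)) (by
      change Module.support R (R ⧸ maximalIdeal R) = _
      rw [Module.support_eq_zeroLocus, Ideal.annihilator_quotient]) (by
      intro i hi
      obtain rfl : i = 0 := by omega
      exact hE)
  have hmm : ∀ r ∈ rs ++ ts, r ∈ maximalIdeal R := by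
    intro r hr
    rcases List.mem_append.1 hr with h | h
    · exact hm r h
    · exact ht2 r h
  have hw : IsWeaklyRegular R (rs ++ ts) := (isWeaklyRegular_append_iff R rs ts).2 ⟨hr.1, ht3.1⟩
  have : sSup T + 1 ∈ T := ⟨rs ++ ts, by simp [hl, ht1], hmm,
    (IsLocalRing.isRegular_iff_isWeaklyRegular_of_subset_maximalIdeal hmm).2 hw⟩
  have := le_csSup ⟨n, hb⟩ this
  omega

theorem PD.of_regular (rs : List R) (hm : ∀ r ∈ rs, r ∈ maximalIdeal R) (hr : IsRegular R rs) :
    PD R (R ⧸ (Ideal.ofList rs • ⊤ : Submodule R R)) rs.length := by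
  have h := ModuleCat.projectiveDimension_quotient_eq_add_length_of_isWeaklyRegular (ModuleCat.of R R) rs hr.1 hm
  have h0 : projectiveDimension (ModuleCat.of R R) = 0 := ModuleCat.projectiveDimension_eq_zero_of_projective _
  rw [h0, zero_add] at h
  have h2 := (projectiveDimension_le_iff _ _).1 h.le
  intro N _ _ i hi
  exact HasProjectiveDimensionLT.subsingleton _ (rs.length + 1) i hi _

theorem ID.le_dim {n : ℕ} (hn : ringKrullDim R = n) {N : ℕ} (h : ID R R N) : ID R R n := by
  obtain ⟨rs, hm, hr, hl, f, hf⟩ := exists_max_regular hn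
  by_cases hN : N ≤ n
  · exact h.mono hN
  obtain ⟨c, rfl⟩ := Nat.exists_eq_add_of_le (not_le.1 hN).le
  clear hN
  induction c with
  | zero => exact h
  | succ c ih =>
    refine ih (ID.of_residue hn fun i hi => ?_)
    rcases Nat.lt_or_ge (n + (c+1)) i with h1 | h1
    · exact h _ _ h1
    · exact (SES.coker hf).con1 (PD.of_regular rs hm hr _ _ (by omega)) (h _ _ (by omega))
end P5f
end GG

namespace GG
open CategoryTheory CategoryTheory.Abelian TensorProduct RingTheory.Sequence IsLocalRing
section P5g
variable {R : Type u} [CommRing R] (T : Submonoid R)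
variable {A B C X : Type u} [AddCommGroup A] [Module R A] [AddCommGroup B] [Module R B]
    [AddCommGroup C] [Module R C] [AddCommGroup X] [Module R X]

noncomputable def locMap (f : A →ₗ[R] B) : LocalizedModule T A →ₗ[Localization T] LocalizedModule T B :=
  LinearMap.extendScalarsOfIsLocalization T (Localization T)
    (IsLocalizedModule.map T (LocalizedModule.mkLinearMap T A) (LocalizedModule.mkLinearMap T B) f)

theorem SES.loc {f : A →ₗ[R] B} {g : B →ₗ[R] C} (h : SES f g) : SES (locMap T f) (locMap T g) :=
  ⟨IsLocalizedModule.map_injective T _ _ f h.inj, IsLocalizedModule.map_exact T _ _ _ f g h.exact,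
    IsLocalizedModule.map_surjective T _ _ g h.surj⟩

noncomputable def locEquiv (e : A ≃ₗ[R] B) : LocalizedModule T A ≃ₗ[Localization T] LocalizedModule T B :=
  LinearEquiv.ofBijective (locMap T e.toLinearMap)
    ⟨IsLocalizedModule.map_injective T _ _ e.toLinearMap e.injective, IsLocalizedModule.map_surjective T _ _ e.toLinearMap e.surjective⟩

theorem injective_loc [IsNoetherianRing R] (h : Module.Injective R A) :
    Module.Injective (Localization T) (LocalizedModule T A) :=
  Module.injective_of_isLocalizedModule T (LocalizedModule.mkLinearMap T A)

theorem ID.loc [IsNoetherianRing R] {n : ℕ} (h : ID R A n) : ID (Localization T) (LocalizedModule T A) n := by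
  induction n generalizing A with
  | zero =>
    exact ID.zero_of_injective (injective_loc T h.injective)
  | succ n ih =>
    obtain ⟨I, C, _, _, _, _, f, g, hI, hs⟩ := exists_inj_ses R A
    exact (hs.loc T).id1 ((ID.zero_of_injective (injective_loc T hI)).mono (by omega))
      (ih (hs.id3 ((ID.zero_of_injective hI).mono (by omega)) h))

theorem ID.loc_self [IsNoetherianRing R] {n : ℕ} (h : ID R R n) : ID (Localization T) (Localization T) n :=
  (ID.loc T h).congr (LinearEquiv.extendScalarsOfIsLocalization T (Localization T)
    (IsLocalizedModule.linearEquiv T (LocalizedModule.mkLinearMap T R) (Algebra.linearMap R (Localization T))))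

theorem Wl.loc [IsNoetherianRing R] (h : Wl R A) : Wl (Localization T) (LocalizedModule T A) := by
  refine ⟨fun Z => ∃ Y : ModuleCat.{u} R, Wl R Y ∧ Nonempty (LocalizedModule T Y ≃ₗ[Localization T] Z), ?_,
    ModuleCat.of _ (LocalizedModule T A), ⟨ModuleCat.of R A, h, ⟨LinearEquiv.refl _ _⟩⟩, ⟨LinearEquiv.refl _ _⟩⟩
  rintro Z ⟨Y, hY, ⟨e⟩⟩
  obtain ⟨Y', I, f, g, hI, hs, hY'⟩ := hY.lstep
  exact ⟨ModuleCat.of _ (LocalizedModule T Y'), ModuleCat.of _ (LocalizedModule T I), _, _, injective_loc T hI,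
    (hs.loc T).congr3 e, Y', hY', ⟨LinearEquiv.refl _ _⟩⟩

theorem injective_restrict [Module (Localization T) A] [IsScalarTower R (Localization T) A]
    (h : Module.Injective (Localization T) A) : Module.Injective R A := by
  refine ⟨fun X Y _ _ _ _ f hf g => ?_⟩
  have hu : ∀ x : T, IsUnit ((algebraMap R (Module.End R A)) x) := by
    intro x
    rw [Module.End.isUnit_iff]
    have hb : IsUnit (algebraMap R (Localization T) x) := IsLocalization.map_units _ x
    have := (hb.smul_bijective (β := A))
    convert this using 2 with a
    simp [Module.algebraMap_end_apply]
  let g' := LinearMap.extendScalarsOfIsLocalization T (Localization T) (LocalizedModule.lift T g hu)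
  obtain ⟨k, hk⟩ := h.out (locMap T f) (IsLocalizedModule.map_injective T _ _ f hf) g'
  refine ⟨(k.restrictScalars R).comp (LocalizedModule.mkLinearMap T Y), fun x => ?_⟩
  have h1 := hk (LocalizedModule.mkLinearMap T X x)
  have h2 : locMap T f (LocalizedModule.mkLinearMap T X x) = LocalizedModule.mkLinearMap T Y (f x) :=
    IsLocalizedModule.map_apply T _ _ f x
  rw [h2] at h1
  refine h1.trans ?_
  exact LinearMap.congr_fun (LocalizedModule.lift_comp T g hu) x

theorem Wl.restrict [Module (Localization T) A] [IsScalarTower R (Localization T) A]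
    (h : Wl (Localization T) A) : Wl R A := by
  refine ⟨fun Z => ∃ (_ : Module (Localization T) Z) (_ : IsScalarTower R (Localization T) Z), Wl (Localization T) Z, ?_,
    ModuleCat.of R A, ⟨inferInstanceAs (Module (Localization T) A), inferInstanceAs (IsScalarTower R (Localization T) A), h⟩, ⟨LinearEquiv.refl _ _⟩⟩
  rintro Z ⟨_, _, hZ⟩
  obtain ⟨Y, I, f, g, hI, hs, hY⟩ := hZ.lstep
  letI m1 : Module R Y := Module.compHom Y (algebraMap R (Localization T))
  letI m2 : Module R I := Module.compHom I (algebraMap R (Localization T))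
  have s1 : IsScalarTower R (Localization T) Y := ⟨fun r s y => by
    rw [Algebra.smul_def, mul_smul]; rfl⟩
  have s2 : IsScalarTower R (Localization T) I := ⟨fun r s y => by
    rw [Algebra.smul_def, mul_smul]; rfl⟩
  refine ⟨ModuleCat.of R Y, ModuleCat.of R I, f.restrictScalars R, g.restrictScalars R, injective_restrict T hI,
    ⟨hs.inj, hs.exact, hs.surj⟩, inferInstanceAs (Module (Localization T) Y), s1, hY⟩

theorem Wl.directSum [IsNoetherianRing R] {ι : Type u} (F : ι → Type u) [∀ j, AddCommGroup (F j)]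
    [∀ j, Module R (F j)] (h : ∀ j, Wl R (F j)) : Wl R (DirectSum ι F) := by
  classical
  refine ⟨fun Z => ∃ G : ι → ModuleCat.{u} R, (∀ j, Wl R (G j)) ∧ Nonempty (DirectSum ι (fun j => G j) ≃ₗ[R] Z), ?_,
    ModuleCat.of R (DirectSum ι F), ⟨fun j => ModuleCat.of R (F j), h, ⟨LinearEquiv.refl _ _⟩⟩, ⟨LinearEquiv.refl _ _⟩⟩
  rintro Z ⟨G, hG, ⟨e⟩⟩
  choose Y I f g hI hs hY using fun j => (hG j).lstep
  refine ⟨ModuleCat.of R (DirectSum ι fun j => Y j), ModuleCat.of R (DirectSum ι fun j => I j),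
    DFinsupp.mapRange.linearMap f, e.toLinearMap.comp (DFinsupp.mapRange.linearMap g), injective_directSum _ hI, SES.congr3 (f := DFinsupp.mapRange.linearMap f) (g := DFinsupp.mapRange.linearMap g) ⟨?_, ?_, ?_⟩ e,
    Y, hY, ⟨LinearEquiv.refl _ _⟩⟩
  · exact (DFinsupp.mapRange_injective _ (fun j => map_zero _)).2 fun j => (hs j).inj
  · intro x
    constructor
    · intro hx
      have : ∀ j, ∃ y, f j y = x j := fun j => (hs j).lift (DFunLike.congr_fun hx j)
      choose y hy using this
      refine ⟨DFinsupp.mk x.support fun j => y j, DFinsupp.ext fun j => ?_⟩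
      change f j ((DFinsupp.mk x.support fun j => y j : DirectSum ι fun j => Y j) j) = x j
      rw [DFinsupp.mk_apply]
      split_ifs with hj
      · exact hy j
      · rw [map_zero]; exact (DFinsupp.notMem_support_iff.1 hj).symm
    · rintro ⟨y, rfl⟩
      exact DFinsupp.ext fun j => (hs j).app _
  · exact (DFinsupp.mapRange_surjective _ (fun j => map_zero _)).2 fun j => (hs j).surj
end P5g
end GG

namespace GG
open CategoryTheory CategoryTheory.Abelian TensorProduct RingTheory.Sequence IsLocalRing
section P5h
variable {R : Type u} [CommRing R] [IsNoetherianRing R]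

theorem cousin_loc_ok {M : ModuleCat.{u} R}
    (hM : ∀ (q : PrimeSpectrum R) (i : ℕ), (i : ℕ∞) < Order.height q → EV R (R ⧸ q.asIdeal) M i)
    (T : Submonoid R) {n : ℕ} (hS : ID (Localization T) (Localization T) n)
    (ih : ∀ m < n, Wl R (cousinC R (heightFiltration R M) M m)) :
    ∀ j k, j + k = n → Ok (Localization T) k (LocalizedModule T (cousinK R (heightFiltration R M) M j)) := by
  have : IsNoetherianRing (Localization T) := IsLocalization.isNoetherianRing T _ inferInstance
  intro j
  induction j with
  | zero =>
    intro k hk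
    obtain rfl : k = n := by omega
    exact Ok.of_gor hS
  | succ j hj =>
    intro k hk
    exact Ok.step ((cousin_ses (cousin_theta hM j).1 (cousin_theta hM j).2).loc T) (hj (k+1) (by omega))
      (Wl.ok hS ((ih j (by omega)).loc T))

theorem cousin_wl {M : ModuleCat.{u} R} {N : ℕ} (hR : ID R R N)
    (hM : ∀ (q : PrimeSpectrum R) (i : ℕ), (i : ℕ∞) < Order.height q → EV R (R ⧸ q.asIdeal) M i) (n : ℕ) :
    Wl R (cousinC R (heightFiltration R M) M n) := by
  induction n using Nat.strong_induction_on with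
  | _ n ih =>
  refine Wl.congr (Wl.directSum _ fun p => ?_) (dsEquiv _ _)
  obtain ⟨p, hp⟩ := p
  change Wl R (LocalizedModule p.asIdeal.primeCompl (cousinK R (heightFiltration R M) M n))
  by_cases hlt : (n : ℕ∞) < Order.height p
  · have hmain := cousin_main hM n
    have := loc_subsingleton (loc_zero hmain.1 (hf_min M hp) (hmain.2 p 0 (by rwa [zero_add])))
    exact Wl.of_ok hR fun E _ _ hE i hi => EV.of_subsingleton_right i
  · have hh : Order.height p = n :=
      le_antisymm (not_lt.1 hlt) ((hf_diff M hp).symm.le.trans (htM_le_height M p))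
    have : IsNoetherianRing (Localization.AtPrime p.asIdeal) :=
      IsLocalization.isNoetherianRing p.asIdeal.primeCompl _ inferInstance
    have hdim : ringKrullDim (Localization.AtPrime p.asIdeal) = n := by
      rw [IsLocalization.AtPrime.ringKrullDim_eq_height p.asIdeal (Localization.AtPrime p.asIdeal),
        PrimeSpectrum.height_eq_orderHeight, hh]
      rfl
    have hS : ID (Localization.AtPrime p.asIdeal) (Localization.AtPrime p.asIdeal) n :=
      ID.le_dim hdim (hR.loc_self p.asIdeal.primeCompl)
    have := cousin_loc_ok hM p.asIdeal.primeCompl hS ih n 0 rfl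
    exact Wl.restrict p.asIdeal.primeCompl (Wl.of_ok hS this)

theorem ggor_of_gor [IsLocalRing R] {d N : ℕ} (hd : ringKrullDim R = d) (hR : ID R R N) (M : ModuleCat.{u} R)
    (hf : Module.Finite R M) (hM : IsMaximalCM R M) : IsGGorenstein R M := by
  have hnt : Nontrivial M := by
    by_contra h
    have := not_nontrivial_iff_subsingleton.1 h
    have h2 := hM.2
    rw [mdim, hd, Module.support_eq_empty, Order.krullDim_eq_bot] at h2
    exact WithBot.bot_ne_coe h2
  have hdep : mdepth R M = d := by
    have := hM.1
    rw [IsCMModule, hM.2, hd] at this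
    exact_mod_cast this
  refine ⟨exists_ne 0, hf, ?_⟩
  have h := fun q i hi => ev_of_mcm (M := M) hd hdep q i hi
  exact cousin_resolves h fun n => Wl.GI hR (cousin_wl hR h n)

theorem main18 [IsLocalRing R] {d : ℕ} (hd : ringKrullDim R = d) (hCM : IsCMLocalRing R) :
    ((∀ M : ModuleCat.{u} R, Module.Finite R M → IsMaximalCM R M → IsGGorenstein R M) ↔
      IsGorensteinLocalRing R) ∧
    ((∀ N : ModuleCat.{u} R,
        (∀ x : N, ∃ n : ℕ, ∀ a ∈ (maximalIdeal R) ^ n, a • x = 0) →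
        ∃ n, gidLE R N n) ↔ IsGorensteinLocalRing R) ∧
    ((∃ n, gidLE R ((localCohomology (maximalIdeal R) d).obj (ModuleCat.of R R)) n) ↔
      IsGorensteinLocalRing R) := by
  have hdep : mdepth R R = d := by
    have := hCM
    rw [IsCMLocalRing, hd] at this
    exact_mod_cast this
  obtain ⟨rs, hl, hm, hr⟩ := exists_regular_of_mdepth (M := R) hdep
  have hrad := maximalIdeal_le_radical hd rs hl hm hr
  refine ⟨⟨fun h => ?_, ?_⟩, ⟨fun h => ?_, ?_⟩, ⟨?_, ?_⟩⟩
  · refine ⟨inferInstance, d, (gor_of_ggor hd (h (ModuleCat.of R R) (inferInstanceAs (Module.Finite R R)) ?_)).idLE⟩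
    have h1 : mdim R R = ringKrullDim R := mdim_self
    exact ⟨show (mdepth R R : WithBot ℕ∞) = mdim R R from h1.symm ▸ hCM, h1⟩
  · rintro ⟨_, n, hn⟩ M hf hM
    exact ggor_of_gor hd (ID.of_idLE hn) M hf hM
  · obtain ⟨n, hn⟩ := h (Ht rs (ModuleCat.of R R)) (Ht_maxTorsion rs hrad _)
    obtain ⟨n, hn⟩ := gor_of_Ht hd rs hm hr.1 hn
    exact ⟨inferInstance, n, hn.idLE⟩
  · rintro ⟨_, n, hn⟩ M _
    exact ⟨n, gidLE_of_gor (ID.of_idLE hn) M⟩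
  · rintro ⟨n, hn⟩
    obtain ⟨e⟩ := lc_Ht (maximalIdeal R) rs hm (ModuleCat.of R R) hr.1 (Ht_maxTorsion rs hrad _)
    rw [hl] at e
    obtain ⟨n, hn⟩ := gor_of_Ht hd rs hm hr.1 (gidLE.congr e.symm.toLinearEquiv hn)
    exact ⟨inferInstance, n, hn.idLE⟩
  · rintro ⟨_, n, hn⟩
    exact ⟨n, gidLE_of_gor (ID.of_idLE hn) _⟩
end P5h
end GG

open GG IsLocalRing in
/-- Characterizations of Gorenstein local rings among Cohen–Macaulay local rings. -/
theorem stmt18 (R : Type u) [CommRing R] [IsLocalRing R] [IsNoetherianRing R]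
    (d : ℕ) (hd : ringKrullDim R = d) (hCM : IsCMLocalRing R)
    (hR : HasDualizingComplex R) :
    ((∀ M : ModuleCat.{u} R, Module.Finite R M → IsMaximalCM R M → IsGGorenstein R M) ↔
      IsGorensteinLocalRing R) ∧
    ((∀ N : ModuleCat.{u} R,
        (∀ x : N, ∃ n : ℕ, ∀ a ∈ (maximalIdeal R) ^ n, a • x = 0) →
        ∃ n, gidLE R N n) ↔ IsGorensteinLocalRing R) ∧
    ((∃ n, gidLE R ((localCohomology (maximalIdeal R) d).obj (ModuleCat.of R R)) n) ↔
      IsGorensteinLocalRing R) := by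
  exact GG.main18 hd hCM
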